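/- Let ν be a Lévy measure, ε ∈ (0,1], Σ > 0 and t > 0, and set σ̄²(ε) := ∫_{|x|≤ε} x² ν(dx) (assumed positive and finite). Let μ_t be the probability measure on ℝ with characteristic function u ↦ exp(t(−u²Σ²/2 + ∫_{|x|≤ε}(e^{iux} − 1 − iux) ν(dx))) (the marginal at time t of the Lévy process with triplet (0, Σ², ν·1_{|x|≤ε}) with compensated small jumps). Then ‖μ_t − N(0, t(Σ² + σ̄²(ε)))‖_TV ≤ √(2/(π t Σ²)) · W_1(ρ_t, N(0, t σ̄²(ε))) ≤ √(2/(π t Σ²)) · min(2√(t σ̄²(ε)), ε/2), where ρ_t is the probability measure with characteristic function u ↦ exp(t ∫_{|x|≤ε}(e^{iux} − 1 − iux) ν(dx)). -/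

import Mathlib

open MeasureTheory ProbabilityTheory
open scoped ENNReal NNReal

/-- Wasserstein "distance" of order `p` with respect to a cost function `c`,
with values in `ℝ≥0∞`: the infimum over all couplings `π` of `μ` and `ν` of
`(∫ c(x,y)^p dπ)^(1/p)`. -/
noncomputable def wassersteinCost {E : Type*} [MeasurableSpace E]
    (c : E → E → ℝ) (p : ℝ) (μ ν : Measure E) : ℝ≥0∞ :=
  ⨅ π ∈ {π : Measure (E × E) |
      IsProbabilityMeasure π ∧ π.map Prod.fst = μ ∧ π.map Prod.snd = ν},
    (∫⁻ z, ENNReal.ofReal (c z.1 z.2) ^ p ∂π) ^ (1 / p)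

/-- Wasserstein distance of order `p` between measures on `ℝ` (usual metric). -/
noncomputable def wasserstein (p : ℝ) (μ ν : Measure ℝ) : ℝ≥0∞ :=
  wassersteinCost (fun x y => |x - y|) p μ ν

/-- Characteristic function of a measure on `ℝ`. -/
noncomputable def charFn (μ : Measure ℝ) (u : ℝ) : ℂ :=
  ∫ x, Complex.exp ((u * x : ℝ) * Complex.I) ∂μ

/-- Toscani–Fourier distance of order `s`, with values in `ℝ≥0∞`. -/
noncomputable def toscani (s : ℝ) (μ ν : Measure ℝ) : ℝ≥0∞ :=
  ⨆ u : {u : ℝ // u ≠ 0}, ENNReal.ofReal (‖charFn μ u.1 - charFn ν u.1‖ / |u.1| ^ s)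

/-- Total variation distance between two measures. -/
noncomputable def tvDist {α : Type*} [MeasurableSpace α] (μ ν : Measure α) : ℝ :=
  ⨆ A : {A : Set α // MeasurableSet A}, |(μ A.1).toReal - (ν A.1).toReal|

/-- Convolution of two measures on `ℝ`. -/
noncomputable def mconv (μ ν : Measure ℝ) : Measure ℝ :=
  (μ.prod ν).map (fun z => z.1 + z.2)

/-- The Poisson distribution with mean `lam`, as a measure on `ℕ`. -/
noncomputable def poissonNat (lam : ℝ) : Measure ℕ :=
  Measure.sum fun k : ℕ =>
    ENNReal.ofReal (Real.exp (-lam) * lam ^ k / (Nat.factorial k)) • Measure.dirac k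

/-- The Poisson distribution with mean `lam`, as a measure on `ℝ`. -/
noncomputable def poissonReal (lam : ℝ) : Measure ℝ :=
  Measure.sum fun k : ℕ =>
    ENNReal.ofReal (Real.exp (-lam) * lam ^ k / (Nat.factorial k)) • Measure.dirac (k : ℝ)

/-- `f'` is a weak derivative of `f` on `ℝ`. -/
def IsWeakDeriv (f f' : ℝ → ℝ) : Prop :=
  ∀ φ : ℝ → ℝ, ContDiff ℝ (⊤ : ℕ∞) φ → HasCompactSupport φ →
    ∫ x, f x * deriv φ x = -∫ x, f' x * φ x

/-- The integrand of the Lévy–Khintchine exponent with truncation `1`. -/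
noncomputable def lkIntegrand (u x : ℝ) : ℂ :=
  Complex.exp ((u * x : ℝ) * Complex.I) - 1 -
    (if |x| ≤ 1 then ((u * x : ℝ) : ℂ) * Complex.I else 0)

/-- The integrand of the Lévy–Khintchine exponent fully compensated (for small jumps). -/
noncomputable def lkIntegrandC (u x : ℝ) : ℂ :=
  Complex.exp ((u * x : ℝ) * Complex.I) - 1 - ((u * x : ℝ) : ℂ) * Complex.I

section
open MeasureTheory ProbabilityTheory Set Filter Topology
open scoped ENNReal NNReal

noncomputable def qf (P : Measure ℝ) (t : ℝ) : ℝ := sInf {x | t ≤ cdf P x}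

lemma qf_nonempty (P : Measure ℝ) {t : ℝ} (ht1 : t < 1) : {x | t ≤ cdf P x}.Nonempty := by
  have := (tendsto_cdf_atTop P).eventually (lt_mem_nhds ht1)
  obtain ⟨x, hx⟩ := this.exists
  exact ⟨x, hx.le⟩

lemma qf_bdd (P : Measure ℝ) {t : ℝ} (ht0 : 0 < t) : BddBelow {x | t ≤ cdf P x} := by
  have := (tendsto_cdf_atBot P).eventually (gt_mem_nhds ht0)
  obtain ⟨x, hx⟩ := this.exists
  refine ⟨x, fun y hy => ?_⟩
  by_contra h
  push Not at h
  have := monotone_cdf P h.le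
  simp only [mem_ofPred_eq] at hy
  linarith

lemma qf_le_iff (P : Measure ℝ) {t : ℝ} (ht0 : 0 < t) (ht1 : t < 1) (x : ℝ) :
    qf P t ≤ x ↔ t ≤ cdf P x := by
  constructor
  · intro h
    have hrc := (cdf P).right_continuous x
    have hev : ∀ᶠ y in 𝓝[>] x, t ≤ cdf P y := by
      filter_upwards [self_mem_nhdsWithin] with y hy
      have : qf P t < y := lt_of_le_of_lt h hy
      obtain ⟨z, hz, hzy⟩ := (csInf_lt_iff (qf_bdd P ht0) (qf_nonempty P ht1)).1 this
      exact le_trans hz (monotone_cdf P hzy.le)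
    have h2 : Tendsto (cdf P) (𝓝[>] x) (𝓝 (cdf P x)) :=
      tendsto_nhdsWithin_mono_left Ioi_subset_Ici_self hrc
    exact ge_of_tendsto h2 hev
  · intro h
    exact csInf_le (qf_bdd P ht0) h

lemma qf_monoOn (P : Measure ℝ) : MonotoneOn (qf P) (Ioo 0 1) := by
  intro s hs t ht hst
  rw [qf_le_iff P hs.1 hs.2]
  exact le_trans hst ((qf_le_iff P ht.1 ht.2 _).1 le_rfl)

lemma qf_aem (P : Measure ℝ) : AEMeasurable (qf P) (volume.restrict (Ioo 0 1)) :=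
  aemeasurable_restrict_of_monotoneOn measurableSet_Ioo (qf_monoOn P)

instance : IsProbabilityMeasure (volume.restrict (Ioo (0:ℝ) 1)) := ⟨by simp⟩

lemma vol_aux {r : ℝ} (h0 : 0 ≤ r) (h1 : r ≤ 1) :
    (volume.restrict (Ioo (0:ℝ) 1)) (Iic r) = ENNReal.ofReal r := by
  rw [restrict_Ioo_eq_restrict_Ioc, Measure.restrict_apply measurableSet_Iic]
  rw [show Iic r ∩ Ioc (0:ℝ) 1 = Ioc 0 r by ext x; simp; grind]
  simp

lemma qf_map (P : Measure ℝ) [IsProbabilityMeasure P] :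
    (volume.restrict (Ioo (0:ℝ) 1)).map (qf P) = P := by
  have : IsProbabilityMeasure ((volume.restrict (Ioo (0:ℝ) 1)).map (qf P)) :=
    Measure.isProbabilityMeasure_map (qf_aem P)
  refine Measure.ext_of_Iic _ _ fun x => ?_
  rw [Measure.map_apply_of_aemeasurable (qf_aem P) measurableSet_Iic, ← ofReal_cdf P x,
    ← vol_aux (cdf_nonneg P x) (cdf_le_one P x)]
  apply measure_congr
  filter_upwards [ae_restrict_mem measurableSet_Ioo] with t ht
  exact propext (qf_le_iff P ht.1 ht.2 x)

lemma abs_sub_eq_lintegral (p q : ℝ) :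
    ENNReal.ofReal |p - q| = ∫⁻ x, (symmDiff (Ici p) (Ici q)).indicator 1 x := by
  rw [lintegral_indicator_one (measurableSet_Ici.symmDiff measurableSet_Ici)]
  rcases le_total p q with h | h
  · rw [show symmDiff (Ici p) (Ici q) = Ico p q by
      ext x; simp [Set.mem_symmDiff]; grind]
    rw [Real.volume_Ico, abs_of_nonpos (by linarith)]; congr 1; ring
  · rw [show symmDiff (Ici p) (Ici q) = Ico q p by
      ext x; simp [Set.mem_symmDiff]; grind]
    rw [Real.volume_Ico, abs_of_nonneg (by linarith)]

lemma measure_iic_aux {r s : ℝ} (h0 : 0 ≤ r) (h1 : r ≤ 1) (h0' : 0 ≤ s) (h1' : s ≤ 1) :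
    (volume.restrict (Ioo (0:ℝ) 1)) (symmDiff (Iic r) (Iic s)) = ENNReal.ofReal |r - s| := by
  rw [restrict_Ioo_eq_restrict_Ioc, Measure.restrict_apply (measurableSet_Iic.symmDiff measurableSet_Iic)]
  rcases le_total r s with h | h
  · rw [show symmDiff (Iic r) (Iic s) ∩ Ioc 0 1 = Ioc r s by
      ext x; simp [Set.mem_symmDiff]; grind]
    rw [Real.volume_Ioc, abs_of_nonpos (by linarith)]; congr 1; ring
  · rw [show symmDiff (Iic r) (Iic s) ∩ Ioc 0 1 = Ioc s r by
      ext x; simp [Set.mem_symmDiff]; grind]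
    rw [Real.volume_Ioc, abs_of_nonneg (by linarith)]

theorem wasserstein_one_le_coupling (P G : Measure ℝ) (π : Measure (ℝ × ℝ)) [IsProbabilityMeasure π]
    (h1 : π.map Prod.fst = P) (h2 : π.map Prod.snd = G) :
    wasserstein 1 P G ≤ ∫⁻ z, ENNReal.ofReal |z.1 - z.2| ∂π := by
  unfold wasserstein wassersteinCost
  refine (iInf₂_le π ⟨inferInstance, h1, h2⟩).trans ?_
  simp

theorem wasserstein_one_le_cdf (P G : Measure ℝ) [IsProbabilityMeasure P] [IsProbabilityMeasure G] :
    wasserstein 1 P G ≤ ∫⁻ x, ENNReal.ofReal |cdf P x - cdf G x| := by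
  set U := volume.restrict (Ioo (0:ℝ) 1) with hU
  have hP := qf_aem P
  have hG := qf_aem G
  have hPG : AEMeasurable (fun t => (qf P t, qf G t)) U := hP.prodMk hG
  have : IsProbabilityMeasure (U.map (fun t => (qf P t, qf G t))) :=
    Measure.isProbabilityMeasure_map hPG
  refine (wasserstein_one_le_coupling P G (U.map (fun t => (qf P t, qf G t))) ?_ ?_).trans ?_
  · rw [AEMeasurable.map_map_of_aemeasurable measurable_fst.aemeasurable hPG]
    exact qf_map P
  · rw [AEMeasurable.map_map_of_aemeasurable measurable_snd.aemeasurable hPG]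
    exact qf_map G
  rw [lintegral_map' (by fun_prop) hPG]
  obtain ⟨P', hP'm, hP'⟩ := hP
  obtain ⟨G', hG'm, hG'⟩ := hG
  have e1 : ∫⁻ t, ENNReal.ofReal |qf P t - qf G t| ∂U
      = ∫⁻ t, (∫⁻ x, (symmDiff (Ici (P' t)) (Ici (G' t))).indicator 1 x) ∂U := by
    apply lintegral_congr_ae
    filter_upwards [hP', hG'] with t h1 h2
    rw [h1, h2, abs_sub_eq_lintegral]
  rw [e1, lintegral_lintegral_swap]
  · apply le_of_eq
    apply lintegral_congr
    intro x
    rw [← measure_iic_aux (cdf_nonneg P x) (cdf_le_one P x) (cdf_nonneg G x) (cdf_le_one G x),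
      ← lintegral_indicator_one (measurableSet_Iic.symmDiff measurableSet_Iic)]
    apply lintegral_congr_ae
    filter_upwards [hP', hG', ae_restrict_mem measurableSet_Ioo] with t h1 h2 ht
    have a1 := qf_le_iff P ht.1 ht.2 x
    have a2 := qf_le_iff G ht.1 ht.2 x
    rw [h1] at a1
    rw [h2] at a2
    simp only [Set.indicator, Set.mem_symmDiff, mem_Ici, mem_Iic, a1, a2, Pi.one_apply]
  · have hs : MeasurableSet {z : ℝ × ℝ | z.2 ∈ symmDiff (Ici (P' z.1)) (Ici (G' z.1))} := by
      simp only [Set.mem_symmDiff, mem_Ici]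
      have a1 : MeasurableSet {z : ℝ × ℝ | P' z.1 ≤ z.2} :=
        measurableSet_le (by fun_prop) (by fun_prop)
      have a2 : MeasurableSet {z : ℝ × ℝ | G' z.1 ≤ z.2} :=
        measurableSet_le (by fun_prop) (by fun_prop)
      exact (a1.inter a2.compl).union (a2.inter a1.compl)
    have : Measurable (fun z : ℝ × ℝ => ({z : ℝ × ℝ | z.2 ∈ symmDiff (Ici (P' z.1)) (Ici (G' z.1))}).indicator (1 : ℝ × ℝ → ℝ≥0∞) z) :=
      measurable_one.indicator hs
    exact this.aemeasurable
end

section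
open MeasureTheory ProbabilityTheory Set Filter Topology
open scoped ENNReal NNReal FourierTransform SchwartzMap

lemma planch_aux (f : ℝ → ℂ) (hf : Integrable f) (hf2 : MemLp f 2) (hF : MemLp (𝓕 f) 2) :
    eLpNorm f 2 volume ≤ eLpNorm (𝓕 f) 2 volume := by
  have hc : MemLp (fun x => (starRingEnd ℂ) (f x)) 2 := hf2.star
  set F : Lp ℂ 2 (volume : Measure ℝ) := hc.toLp _ with hFdef
  have hFc : MemLp (fun x => (starRingEnd ℂ) (𝓕 f x)) 2 := hF.star
  set Gf : Lp ℂ 2 (volume : Measure ℝ) := hFc.toLp _ with hGdef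
  have key : ∀ ψ : 𝓢(ℝ, ℂ), ‖inner ℂ F (ψ.toLp 2)‖ ≤ ‖Gf‖ * ‖ψ.toLp 2 (volume : Measure ℝ)‖ := by
    intro ψ
    set φ := 𝓕⁻ ψ with hφ
    have hψ : ψ = 𝓕 φ := by simp [hφ]
    have e1 : inner ℂ F (ψ.toLp 2) = ∫ x, f x * ψ x := by
      rw [L2.inner_def]
      apply integral_congr_ae
      filter_upwards [hc.coeFn_toLp, ψ.coeFn_toLp 2 volume] with x h1 h2
      rw [h1, h2]; simp [mul_comm]
    have e2 : inner ℂ Gf (φ.toLp 2) = ∫ x, 𝓕 f x * φ x := by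
      rw [L2.inner_def]
      apply integral_congr_ae
      filter_upwards [hFc.coeFn_toLp, φ.coeFn_toLp 2 volume] with x h1 h2
      rw [h1, h2]; simp [mul_comm]
    have e3 : ∫ x, 𝓕 f x * φ x = ∫ x, f x * ψ x := by
      rw [hψ]
      simpa using! VectorFourier.integral_bilin_fourierIntegral_eq_flip (ContinuousLinearMap.mul ℂ ℂ)
        (L := innerₗ ℝ) Real.continuous_fourierChar continuous_inner hf φ.integrable
    rw [e1, ← e3, ← e2]
    refine (norm_inner_le_norm _ _).trans ?_
    rw [hψ, SchwartzMap.norm_fourier_toL2_eq]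
  have key2 : ∀ H : Lp ℂ 2 (volume : Measure ℝ), ‖inner ℂ F H‖ ≤ ‖Gf‖ * ‖H‖ := by
    have hd := SchwartzMap.denseRange_toLpCLM (E := ℝ) (F := ℂ) (p := 2) (by simp) (μ := volume)
    intro H
    refine hd.induction_on (p := fun H => ‖inner ℂ F H‖ ≤ ‖Gf‖ * ‖H‖) H ?_ ?_
    · exact isClosed_le (by fun_prop) (by fun_prop)
    · intro ψ; exact key ψ
  have k3 := key2 F
  have k4 : ‖F‖ ≤ ‖Gf‖ := by
    rw [inner_self_eq_norm_sq_to_K, norm_pow, RCLike.norm_ofReal, abs_norm] at k3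
    rcases eq_or_lt_of_le (norm_nonneg F) with h | h
    · rw [← h]; positivity
    · nlinarith
  rw [Lp.norm_toLp, Lp.norm_toLp] at k4
  have := (ENNReal.toReal_le_toReal hc.2.ne hFc.2.ne).1 k4
  have s1 : eLpNorm (fun x => (starRingEnd ℂ) (f x)) 2 volume = eLpNorm f 2 volume :=
    eLpNorm_congr_norm_ae (by simp)
  have s2 : eLpNorm (fun x => (starRingEnd ℂ) (𝓕 f x)) 2 volume = eLpNorm (𝓕 f) 2 volume :=
    eLpNorm_congr_norm_ae (by simp)
  rwa [s1, s2] at this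

/-- Fourier transform with probabilistic normalization -/
noncomputable def ft (f : ℝ → ℂ) (u : ℝ) : ℂ := ∫ x, Complex.exp ((u * x : ℝ) * Complex.I) * f x

lemma ft_eq (f : ℝ → ℂ) (u : ℝ) : ft f u = 𝓕 f (-u / (2 * Real.pi)) := by
  rw [Real.fourier_real_eq_integral_exp_smul]
  unfold ft
  congr 1; ext x
  rw [smul_eq_mul]; congr 3
  have := Real.pi_pos
  push_cast
  field_simp

lemma planch (f : ℝ → ℂ) (hf : Integrable f) (hf2 : MemLp f 2) :
    ENNReal.ofReal (2 * Real.pi) * ∫⁻ x, ‖f x‖ₑ ^ 2 ≤ ∫⁻ u, ‖ft f u‖ₑ ^ 2 := by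
  have hcont : Continuous (𝓕 f) := VectorFourier.fourierIntegral_continuous Real.continuous_fourierChar
      (L := innerₗ ℝ) continuous_inner hf
  have e1 : ∫⁻ u, ‖ft f u‖ₑ ^ 2 = ENNReal.ofReal (2 * Real.pi) * ∫⁻ w, ‖𝓕 f w‖ₑ ^ 2 := by
    simp_rw [ft_eq]
    have hpi := Real.pi_pos
    have hm := Real.map_volume_mul_left (a := -1/(2*Real.pi)) (by
      rw [div_ne_zero_iff]; exact ⟨by norm_num, by positivity⟩)
    rw [show |(-1 / (2 * Real.pi))⁻¹| = 2 * Real.pi by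
      rw [inv_div, abs_div, abs_of_pos (by positivity)]; simp] at hm
    rw [← smul_eq_mul (ENNReal.ofReal _), ← lintegral_smul_measure, ← hm, lintegral_map (by fun_prop) (by fun_prop)]
    congr 1; ext u; congr 3; ring_nf
  rw [e1]
  refine mul_le_mul_right ?_ _
  by_cases hF : MemLp (𝓕 f) 2
  · have := planch_aux f hf hf2 hF
    rw [eLpNorm_eq_lintegral_rpow_enorm_toReal (by simp) (by simp),
      eLpNorm_eq_lintegral_rpow_enorm_toReal (by simp) (by simp)] at this
    simp only [ENNReal.toReal_ofNat] at this
    rw [ENNReal.rpow_le_rpow_iff (by norm_num)] at this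
    simpa using this
  · have : ∫⁻ w, ‖𝓕 f w‖ₑ ^ 2 = ⊤ := by
      by_contra h
      apply hF
      refine ⟨hcont.aestronglyMeasurable, ?_⟩
      rw [eLpNorm_lt_top_iff_lintegral_rpow_enorm_lt_top (by simp) (by simp)]
      simpa using lt_top_iff_ne_top.2 h
    rw [this]; exact le_top

lemma ft_hasDerivAt (f : ℝ → ℂ) (hf : Integrable f) (hf' : Integrable (fun x : ℝ => (x:ℂ) * f x)) (u : ℝ) :
    HasDerivAt (ft f) (Complex.I * ft (fun x => (x:ℂ) * f x) u) u := by
  have hpi := Real.pi_pos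
  have h1 := Real.hasDerivAt_fourier hf (by simpa using hf') (-u / (2 * Real.pi))
  have h2 : HasDerivAt (fun u : ℝ => -u / (2 * Real.pi)) (-1 / (2 * Real.pi)) u :=
    ((hasDerivAt_id u).neg).div_const _
  have h3 := h1.scomp u h2
  rw [show ft f = (𝓕 f ∘ fun u : ℝ => -u / (2 * Real.pi)) by ext u; exact ft_eq f u]
  refine h3.congr_deriv ?_
  symm
  rw [← ft_eq]
  unfold ft
  rw [← integral_const_mul, ← integral_smul]
  congr 1; ext x
  simp only [smul_eq_mul, Complex.real_smul]
  have : (Real.pi : ℂ) ≠ 0 := by exact_mod_cast hpi.ne'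
  push_cast
  field_simp
end

section
open MeasureTheory ProbabilityTheory Set Filter Topology
open scoped ENNReal NNReal

noncomputable def dcdf (P G : Measure ℝ) (x : ℝ) : ℝ := cdf P x - cdf G x

section
variable (P G : Measure ℝ) [IsProbabilityMeasure P] [IsProbabilityMeasure G]

lemma dcdf_meas : Measurable (dcdf P G) :=
  (monotone_cdf P).measurable.sub (monotone_cdf G).measurable

lemma dcdf_le_one (x : ℝ) : |dcdf P G x| ≤ 1 := by
  unfold dcdf
  rw [abs_le]
  constructor <;> linarith [cdf_nonneg P x, cdf_nonneg G x, cdf_le_one P x, cdf_le_one G x]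

lemma tail4 (hP : Integrable (fun x => x ^ 4) P) (x : ℝ) (hx : x ≠ 0) (A : Set ℝ) (hA : MeasurableSet A)
    (hA' : ∀ z ∈ A, |x| ≤ |z|) : P.real A * x ^ 4 ≤ ∫ x, x ^ 4 ∂P := by
  calc P.real A * x ^ 4 = ∫ z, A.indicator (fun _ => x ^ 4) z ∂P := by
        rw [integral_indicator hA]; simp
    _ ≤ _ := by
        apply integral_mono ((integrable_const _).indicator hA) hP
        intro z
        by_cases hz : z ∈ A
        · simp only [hz, indicator_of_mem]
          have := hA' z hz
          have h2 := pow_le_pow_left₀ (abs_nonneg _) this 4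
          rwa [Even.pow_abs (by decide), Even.pow_abs (by decide)] at h2
        · simp only [hz, not_false_eq_true, indicator_of_notMem]; positivity

lemma dcdf_tail (hP : Integrable (fun x => x ^ 4) P) (hG : Integrable (fun x => x ^ 4) G) :
    ∃ C, 0 < C ∧ ∀ x, |dcdf P G x| ≤ C / (1 + x ^ 4) := by
  set MP := ∫ x, x ^ 4 ∂P
  set MG := ∫ x, x ^ 4 ∂G
  have hMP : 0 ≤ MP := integral_nonneg fun x => by positivity
  have hMG : 0 ≤ MG := integral_nonneg fun x => by positivity
  refine ⟨1 + MP + MG, by positivity, fun x => ?_⟩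
  rw [le_div_iff₀ (by positivity)]
  have h1 := dcdf_le_one P G x
  have h2 : |dcdf P G x| * x ^ 4 ≤ MP + MG := by
    rcases lt_trichotomy x 0 with hx | hx | hx
    · have a1 := tail4 P hP x hx.ne (Iic x) measurableSet_Iic (by
        intro z hz; simp only [mem_Iic] at hz; rw [abs_of_neg hx, abs_of_neg (by linarith)]; linarith)
      have a2 := tail4 G hG x hx.ne (Iic x) measurableSet_Iic (by
        intro z hz; simp only [mem_Iic] at hz; rw [abs_of_neg hx, abs_of_neg (by linarith)]; linarith)
      rw [← cdf_eq_real] at a1 a2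
      have : |dcdf P G x| ≤ cdf P x + cdf G x := by
        unfold dcdf
        rw [abs_le]; constructor <;> linarith [cdf_nonneg P x, cdf_nonneg G x]
      calc _ ≤ (cdf P x + cdf G x) * x ^ 4 := by gcongr
        _ ≤ _ := by linarith
    · subst hx; simp; positivity
    · have a1 := tail4 P hP x hx.ne' (Iic x)ᶜ measurableSet_Iic.compl (by
        intro z hz; simp only [compl_Iic, mem_Ioi] at hz; rw [abs_of_pos hx, abs_of_pos (by linarith)]; linarith)
      have a2 := tail4 G hG x hx.ne' (Iic x)ᶜ measurableSet_Iic.compl (by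
        intro z hz; simp only [compl_Iic, mem_Ioi] at hz; rw [abs_of_pos hx, abs_of_pos (by linarith)]; linarith)
      rw [probReal_compl_eq_one_sub measurableSet_Iic, ← cdf_eq_real] at a1 a2
      have : |dcdf P G x| ≤ (1 - cdf P x) + (1 - cdf G x) := by
        unfold dcdf
        rw [abs_le]; constructor <;> linarith [cdf_le_one P x, cdf_le_one G x]
      calc _ ≤ ((1 - cdf P x) + (1 - cdf G x)) * x ^ 4 := by gcongr
        _ ≤ _ := by linarith
  nlinarith

lemma memLp2_of_bdd_int {f : ℝ → ℂ} (hf : Integrable f) (C : ℝ) (hC : ∀ x, ‖f x‖ ≤ C) : MemLp f 2 := by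
  rw [memLp_two_iff_integrable_sq_norm hf.1]
  refine (hf.norm.const_mul C).mono' (hf.1.norm.pow 2) (ae_of_all _ fun x => ?_)
  rw [Real.norm_of_nonneg (by positivity), sq]
  exact mul_le_mul_of_nonneg_right (hC x) (norm_nonneg _)

lemma dcdf_facts (hP : Integrable (fun x => x ^ 4) P) (hG : Integrable (fun x => x ^ 4) G) :
    Integrable (fun x => (dcdf P G x : ℂ)) ∧ MemLp (fun x => (dcdf P G x : ℂ)) 2 ∧
    Integrable (fun x : ℝ => (x : ℂ) * (dcdf P G x : ℂ)) ∧
    MemLp (fun x : ℝ => (x : ℂ) * (dcdf P G x : ℂ)) 2 := by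
  obtain ⟨C, hC, hb⟩ := dcdf_tail P G hP hG
  have hm := dcdf_meas P G
  have b1 : ∀ x, ‖(dcdf P G x : ℂ)‖ ≤ (2 * C) * (1 + x ^ 2)⁻¹ := by
    intro x
    rw [Complex.norm_real, Real.norm_eq_abs]
    refine (hb x).trans ?_
    rw [← div_eq_mul_inv, div_le_div_iff₀ (by positivity) (by positivity)]
    nlinarith [sq_nonneg (x ^ 2 - 1), sq_nonneg (x^2), sq_nonneg x]
  have b2 : ∀ x : ℝ, ‖(x : ℂ) * (dcdf P G x : ℂ)‖ ≤ (2 * C) * (1 + x ^ 2)⁻¹ := by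
    intro x
    rw [norm_mul, Complex.norm_real, Real.norm_eq_abs, Complex.norm_real, Real.norm_eq_abs]
    have : |x| * |dcdf P G x| ≤ |x| * (C / (1 + x ^ 4)) := by gcongr; exact hb x
    refine this.trans ?_
    rw [← div_eq_mul_inv, ← mul_div_assoc, div_le_div_iff₀ (by positivity) (by positivity)]
    have h1 : |x| ≤ (1 + x ^ 2) / 2 := by nlinarith [sq_nonneg (|x| - 1), sq_abs x]
    have h2 : |x| * (1 + x ^ 2) ≤ 2 * (1 + x ^ 4) := by
      calc _ ≤ (1 + x ^ 2) / 2 * (1 + x ^ 2) := by gcongr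
        _ ≤ _ := by nlinarith [sq_nonneg (x ^ 2 - 1), sq_nonneg (x^2)]
    calc _ = C * (|x| * (1 + x ^ 2)) := by ring
      _ ≤ C * (2 * (1 + x ^ 4)) := by gcongr
      _ = _ := by ring
  have i1 : Integrable (fun x => (dcdf P G x : ℂ)) :=
    (integrable_inv_one_add_sq.const_mul (2 * C)).mono' (by fun_prop) (ae_of_all _ b1)
  have i2 : Integrable (fun x : ℝ => (x : ℂ) * (dcdf P G x : ℂ)) :=
    (integrable_inv_one_add_sq.const_mul (2 * C)).mono' (by fun_prop) (ae_of_all _ b2)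
  have b3 : ∀ x : ℝ, (2 * C) * (1 + x ^ 2)⁻¹ ≤ 2 * C := by
    intro x
    have : (1 + x ^ 2)⁻¹ ≤ 1 := inv_le_one_of_one_le₀ (by nlinarith [sq_nonneg x])
    nlinarith
  exact ⟨i1, memLp2_of_bdd_int i1 (2 * C) fun x => (b1 x).trans (b3 x), i2,
    memLp2_of_bdd_int i2 (2 * C) fun x => (b2 x).trans (b3 x)⟩

lemma dcdf_eq_integral (x : ℝ) :
    (dcdf P G x : ℂ) = ∫ z : ℝ × ℝ, ((Ici z.1).indicator (1 : ℝ → ℂ) x - (Ici z.2).indicator 1 x) ∂(P.prod G) := by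
  have e1 : ∀ z : ℝ × ℝ, (Ici z.1).indicator (1 : ℝ → ℂ) x = (Iic x).indicator 1 z.1 := by
    intro z; simp [indicator]
  have e2 : ∀ z : ℝ × ℝ, (Ici z.2).indicator (1 : ℝ → ℂ) x = (Iic x).indicator 1 z.2 := by
    intro z; simp [indicator]
  simp_rw [e1, e2]
  have i1 : Integrable ((Iic x).indicator (1 : ℝ → ℂ)) P := (integrable_const 1).indicator measurableSet_Iic
  have i2 : Integrable ((Iic x).indicator (1 : ℝ → ℂ)) G := (integrable_const 1).indicator measurableSet_Iic
  rw [integral_sub (i1.comp_fst G) (i2.comp_snd P)]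
  rw [integral_fun_fst (fun y => (Iic x).indicator (1 : ℝ → ℂ) y), integral_fun_snd (fun y => (Iic x).indicator (1 : ℝ → ℂ) y)]
  rw [integral_indicator measurableSet_Iic, integral_indicator measurableSet_Iic]
  simp [dcdf, cdf_eq_real]

lemma ind_int (p g : ℝ) (u : ℝ) (hu : u ≠ 0) :
    ∫ x, Complex.exp ((u * x : ℝ) * Complex.I) * ((Ici p).indicator (1 : ℝ → ℂ) x - (Ici g).indicator 1 x)
     = (Complex.exp ((u * g : ℝ) * Complex.I) - Complex.exp ((u * p : ℝ) * Complex.I)) / (Complex.I * u) := by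
  have hI : ∀ p g : ℝ, p ≤ g → ∫ x, Complex.exp ((u * x : ℝ) * Complex.I) * (Ico p g).indicator (1 : ℝ → ℂ) x
     = (Complex.exp ((u * g : ℝ) * Complex.I) - Complex.exp ((u * p : ℝ) * Complex.I)) / (Complex.I * u) := by
    intro p g hpg
    have : ∀ x, Complex.exp ((u * x : ℝ) * Complex.I) * (Ico p g).indicator (1 : ℝ → ℂ) x
      = (Ico p g).indicator (fun x : ℝ => Complex.exp ((Complex.I * u) * x)) x := by
      intro x; by_cases hx : x ∈ Ico p g
      · simp only [hx, indicator_of_mem]; simp; ring_nf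
      · simp [hx]
    simp_rw [this]
    rw [integral_indicator measurableSet_Ico, integral_Ico_eq_integral_Ioc, ← intervalIntegral.integral_of_le hpg,
      integral_exp_mul_complex (by simp [hu])]
    push_cast; ring_nf
  rcases le_total p g with h | h
  · rw [← hI p g h]
    congr 1; ext x; congr 1
    simp only [indicator, mem_Ici, mem_Ico]
    by_cases h1 : p ≤ x <;> by_cases h2 : g ≤ x <;> simp [h1, h2]
    · linarith
  · have := hI g p h
    have e : ∀ x, Complex.exp ((u * x : ℝ) * Complex.I) * ((Ici p).indicator (1 : ℝ → ℂ) x - (Ici g).indicator 1 x) =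
      - (Complex.exp ((u * x : ℝ) * Complex.I) * (Ico g p).indicator (1 : ℝ → ℂ) x) := by
      intro x
      rw [← mul_neg]; congr 1
      simp only [indicator, mem_Ici, mem_Ico]
      by_cases h1 : p ≤ x <;> by_cases h2 : g ≤ x <;> simp [h1, h2]
      · linarith
    simp_rw [e]
    rw [integral_neg, this]; ring

lemma ft_dcdf (hP : Integrable (fun x : ℝ => x) P) (hG : Integrable (fun x : ℝ => x) G) (u : ℝ) (hu : u ≠ 0) :
    ft (fun x => (dcdf P G x : ℂ)) u = (charFn G u - charFn P u) / (Complex.I * u) := by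
  unfold ft
  simp_rw [dcdf_eq_integral P G, ← integral_const_mul]
  have hm : Measurable (fun q : ℝ × (ℝ × ℝ) => Complex.exp ((u * q.1 : ℝ) * Complex.I) *
      ((Ici q.2.1).indicator (1 : ℝ → ℂ) q.1 - (Ici q.2.2).indicator 1 q.1)) := by
    have a1 : MeasurableSet {q : ℝ × (ℝ × ℝ) | q.2.1 ≤ q.1} := measurableSet_le (by fun_prop) (by fun_prop)
    have a2 : MeasurableSet {q : ℝ × (ℝ × ℝ) | q.2.2 ≤ q.1} := measurableSet_le (by fun_prop) (by fun_prop)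
    have m1 : Measurable (fun q : ℝ × (ℝ × ℝ) => (Ici q.2.1).indicator (1 : ℝ → ℂ) q.1) :=
      (measurable_one (α := ℂ) (β := ℝ × ℝ × ℝ)).indicator a1
    have m2 : Measurable (fun q : ℝ × (ℝ × ℝ) => (Ici q.2.2).indicator (1 : ℝ → ℂ) q.1) :=
      (measurable_one (α := ℂ) (β := ℝ × ℝ × ℝ)).indicator a2
    exact (by fun_prop : Measurable _).mul (m1.sub m2)
  rw [integral_integral_swap]
  · simp_rw [ind_int _ _ u hu]
    rw [integral_div]
    congr 1
    have b1 : Integrable (fun y : ℝ => Complex.exp ((u * y : ℝ) * Complex.I)) P :=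
      (integrable_const (1:ℝ)).mono' (by fun_prop) (ae_of_all _ fun y => by rw [Complex.norm_exp_ofReal_mul_I])
    have b2 : Integrable (fun y : ℝ => Complex.exp ((u * y : ℝ) * Complex.I)) G :=
      (integrable_const (1:ℝ)).mono' (by fun_prop) (ae_of_all _ fun y => by rw [Complex.norm_exp_ofReal_mul_I])
    rw [integral_sub (b2.comp_snd P) (b1.comp_fst G), integral_fun_fst (fun y : ℝ => Complex.exp ((u * y : ℝ) * Complex.I)),
      integral_fun_snd (fun y : ℝ => Complex.exp ((u * y : ℝ) * Complex.I))]
    simp [charFn]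
  · refine ⟨hm.aestronglyMeasurable, ?_⟩
    unfold HasFiniteIntegral
    simp only [Function.uncurry]
    rw [lintegral_prod_symm _ hm.enorm.aemeasurable]
    have : ∀ z : ℝ × ℝ, ∫⁻ x, ‖Complex.exp ((u * x : ℝ) * Complex.I) *
      ((Ici z.1).indicator (1 : ℝ → ℂ) x - (Ici z.2).indicator 1 x)‖ₑ = ENNReal.ofReal |z.1 - z.2| := by
      intro z
      rw [abs_sub_eq_lintegral]
      congr 1; ext x
      rw [enorm_mul, show ‖Complex.exp ((u * x : ℝ) * Complex.I)‖ₑ = 1 by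
        rw [← ofReal_norm, Complex.norm_exp_ofReal_mul_I]; simp, one_mul]
      simp only [indicator, mem_Ici, Set.mem_symmDiff]
      by_cases h1 : z.1 ≤ x <;> by_cases h2 : z.2 ≤ x <;> simp [h1, h2]
    simp_rw [this]
    have hi : Integrable (fun z : ℝ × ℝ => z.1 - z.2) (P.prod G) := (hP.comp_fst G).sub (hG.comp_snd P)
    have := hi.2
    unfold HasFiniteIntegral at this
    simpa [Real.enorm_eq_ofReal_abs] using this
end
end

section
open MeasureTheory ProbabilityTheory Set Filter Topology
open scoped ENNReal NNReal

lemma fatou_real (P : Measure ℝ) (f : ℕ → ℝ → ℝ) (g : ℝ → ℝ) (hf0 : ∀ n x, 0 ≤ f n x)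
    (hfi : ∀ n, Integrable (f n) P) (hlim : ∀ x, Tendsto (fun n => f n x) atTop (𝓝 (g x)))
    (hg : Measurable g)
    (c : ℕ → ℝ) (C : ℝ) (hc : ∀ᶠ n in atTop, ∫ x, f n x ∂P ≤ c n) (hcl : Tendsto c atTop (𝓝 C)) :
    Integrable g P ∧ ∫ x, g x ∂P ≤ C := by
  have hg0 : ∀ x, 0 ≤ g x := fun x => ge_of_tendsto' (hlim x) fun n => hf0 n x
  have hC : 0 ≤ C := by
    refine ge_of_tendsto hcl ?_
    filter_upwards [hc] with n hn
    exact (integral_nonneg (hf0 n)).trans hn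
  have key : ∫⁻ x, ENNReal.ofReal (g x) ∂P ≤ ENNReal.ofReal C := by
    calc ∫⁻ x, ENNReal.ofReal (g x) ∂P
        = ∫⁻ x, liminf (fun n => ENNReal.ofReal (f n x)) atTop ∂P := by
          congr 1; ext x
          exact ((ENNReal.continuous_ofReal.tendsto _).comp (hlim x)).liminf_eq.symm
      _ ≤ liminf (fun n => ∫⁻ x, ENNReal.ofReal (f n x) ∂P) atTop :=
          lintegral_liminf_le' fun n => (hfi n).aemeasurable.ennreal_ofReal
      _ ≤ liminf (fun n => ENNReal.ofReal (c n)) atTop := by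
          refine liminf_le_liminf ?_
          filter_upwards [hc] with n hn
          rw [← ofReal_integral_eq_lintegral_ofReal (hfi n) (ae_of_all _ (hf0 n))]
          exact ENNReal.ofReal_le_ofReal hn
      _ = ENNReal.ofReal C := ((ENNReal.continuous_ofReal.tendsto _).comp hcl).liminf_eq
  have hi : Integrable g P := by
    refine ⟨hg.aestronglyMeasurable, ?_⟩
    rw [hasFiniteIntegral_iff_ofReal (ae_of_all _ hg0)]
    exact key.trans_lt ENNReal.ofReal_lt_top
  refine ⟨hi, ?_⟩
  rw [← ofReal_integral_eq_lintegral_ofReal hi (ae_of_all _ hg0)] at key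
  exact (ENNReal.ofReal_le_ofReal_iff hC).1 key

noncomputable def Om (m : Measure ℝ) (u : ℝ) : ℝ := ∫ y, (1 - Real.cos (u * y)) / y ^ 2 ∂m
noncomputable def Psi (m : Measure ℝ) (u : ℝ) : ℂ := ∫ y, lkIntegrandC u y / (y : ℂ) ^ 2 ∂m
noncomputable def Psi' (m : Measure ℝ) (u : ℝ) : ℂ :=
  ∫ y, Complex.I * (Complex.exp ((u * y : ℝ) * Complex.I) - 1) / (y : ℂ) ∂m


lemma norm_exp_sub_sub_nonneg (x : ℝ) (hx : 0 ≤ x) :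
    ‖Complex.exp ((x : ℝ) * Complex.I) - 1 - (x : ℂ) * Complex.I‖ ≤ x ^ 2 / 2 := by
  have h := image_norm_le_of_norm_deriv_right_le_deriv_boundary (a := 0) (b := x)
    (f := fun t : ℝ => Complex.exp ((t : ℝ) * Complex.I) - 1 - (t : ℂ) * Complex.I)
    (f' := fun t : ℝ => Complex.exp ((t : ℝ) * Complex.I) * Complex.I - Complex.I)
    (B := fun t => t ^ 2 / 2) (B' := fun t => t)
    (by fun_prop) (by
      intro t ht
      apply HasDerivAt.hasDerivWithinAt
      have h1 : HasDerivAt (fun t : ℝ => (t : ℂ) * Complex.I) (Complex.I) t := by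
        simpa using (Complex.ofRealCLM.hasDerivAt (x := t)).mul_const Complex.I
      exact (h1.cexp.sub_const 1).sub h1) (by simp)
    (by intro t; refine (((hasDerivAt_id t).pow 2).div_const 2).congr_deriv ?_; simp)
    (by
      intro t ht
      rw [show Complex.exp ((t : ℝ) * Complex.I) * Complex.I - Complex.I =
        (Complex.exp (Complex.I * t) - 1) * Complex.I by ring_nf, norm_mul, Complex.norm_I, mul_one]
      have := Real.norm_exp_I_mul_ofReal_sub_one_le (x := t)
      rwa [Real.norm_of_nonneg ht.1] at this)
  exact h ⟨hx, le_rfl⟩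

lemma norm_exp_sub_sub (x : ℝ) :
    ‖Complex.exp ((x : ℝ) * Complex.I) - 1 - (x : ℂ) * Complex.I‖ ≤ x ^ 2 / 2 := by
  rcases le_total 0 x with h | h
  · exact norm_exp_sub_sub_nonneg x h
  · have := norm_exp_sub_sub_nonneg (-x) (by linarith)
    rw [← Complex.norm_conj, ← neg_sq]
    convert this using 2
    simp [← Complex.exp_conj]

lemma norm_lk (u y : ℝ) : ‖lkIntegrandC u y‖ ≤ (u * y) ^ 2 / 2 := by
  unfold lkIntegrandC
  exact norm_exp_sub_sub _

section
variable (m : Measure ℝ) [IsFiniteMeasure m]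

lemma lk_div_bound (u y : ℝ) : ‖lkIntegrandC u y / (y : ℂ) ^ 2‖ ≤ u ^ 2 / 2 := by
  rw [norm_div, norm_pow, Complex.norm_real, Real.norm_eq_abs, sq_abs]
  rcases eq_or_ne y 0 with rfl | hy
  · simp; positivity
  · rw [div_le_iff₀ (by positivity)]
    refine (norm_lk u y).trans (le_of_eq (by ring))

lemma lk_div_int (u : ℝ) : Integrable (fun y : ℝ => lkIntegrandC u y / (y : ℂ) ^ 2) m :=
  (integrable_const (u ^ 2 / 2)).mono' (by unfold lkIntegrandC; exact Measurable.aestronglyMeasurable (by fun_prop))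
    (ae_of_all _ fun y => lk_div_bound u y)

lemma Psi_bound (u : ℝ) : ‖Psi m u‖ ≤ m.real univ * (u ^ 2 / 2) := by
  unfold Psi
  refine (norm_integral_le_of_norm_le_const (ae_of_all _ fun y => lk_div_bound u y)).trans ?_
  rw [mul_comm]

lemma lk_re (u y : ℝ) : (lkIntegrandC u y / (y : ℂ) ^ 2).re = -((1 - Real.cos (u * y)) / y ^ 2) := by
  rw [show ((y : ℂ) ^ 2) = ((y ^ 2 : ℝ) : ℂ) by push_cast; rfl, Complex.div_ofReal_re]
  unfold lkIntegrandC
  simp only [Complex.sub_re, Complex.exp_ofReal_mul_I_re, Complex.one_re, Complex.re_ofReal_mul, Complex.I_re]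
  ring

lemma Psi_re (u : ℝ) : (Psi m u).re = - Om m u := by
  unfold Psi Om
  rw [← RCLike.re_eq_complex_re, ← integral_re (lk_div_int m u), ← integral_neg]
  congr 1; ext y
  exact lk_re u y

lemma Om_int (u : ℝ) : Integrable (fun y => (1 - Real.cos (u * y)) / y ^ 2) m := by
  have := (lk_div_int m u).re.neg
  refine this.congr (ae_of_all _ fun y => ?_)
  have := lk_re u y
  simp only [Pi.neg_apply, RCLike.re_eq_complex_re]
  rw [this]; ring

lemma Om_nonneg (u : ℝ) : 0 ≤ Om m u :=
  integral_nonneg fun y => div_nonneg (by linarith [Real.cos_le_one (u * y)]) (by positivity)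

lemma Om_le (u : ℝ) : Om m u ≤ m.real univ * (u ^ 2 / 2) := by
  have h1 := Psi_bound m u
  have h2 := Complex.abs_re_le_norm (Psi m u)
  rw [Psi_re, abs_neg, abs_of_nonneg (Om_nonneg m u)] at h2
  linarith

lemma norm_exp_sub_one_sq (x : ℝ) :
    ‖Complex.exp ((x : ℝ) * Complex.I) - 1‖ ^ 2 = 2 * (1 - Real.cos x) := by
  rw [← Complex.normSq_eq_norm_sq, Complex.normSq_apply]
  simp only [Complex.sub_re, Complex.exp_ofReal_mul_I_re, Complex.one_re, Complex.sub_im,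
    Complex.exp_ofReal_mul_I_im, Complex.one_im]
  nlinarith [Real.sin_sq_add_cos_sq x]

lemma Psi'_norm (u y : ℝ) : ‖Complex.I * (Complex.exp ((u * y : ℝ) * Complex.I) - 1) / (y : ℂ)‖ ^ 2
    = 2 * ((1 - Real.cos (u * y)) / y ^ 2) := by
  rw [norm_div, norm_mul, Complex.norm_I, one_mul, div_pow, norm_exp_sub_one_sq, Complex.norm_real,
    Real.norm_eq_abs, sq_abs]; ring

lemma Psi'_bd (u y : ℝ) : ‖Complex.I * (Complex.exp ((u * y : ℝ) * Complex.I) - 1) / (y : ℂ)‖ ≤ |u| := by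
  rw [norm_div, norm_mul, Complex.norm_I, one_mul, Complex.norm_real, Real.norm_eq_abs]
  rcases eq_or_ne y 0 with rfl | hy
  · simp
  · rw [div_le_iff₀ (abs_pos.2 hy), ← abs_mul, mul_comm (_ : ℂ) Complex.I]
    exact Real.norm_exp_I_mul_ofReal_sub_one_le

lemma Psi'_int (u : ℝ) : Integrable (fun y : ℝ => Complex.I * (Complex.exp ((u * y : ℝ) * Complex.I) - 1) / (y : ℂ)) m :=
  (integrable_const |u|).mono' (Measurable.aestronglyMeasurable (by fun_prop)) (ae_of_all _ fun y => Psi'_bd u y)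

lemma Psi'_sq (u : ℝ) : ‖Psi' m u‖ ^ 2 ≤ 2 * m.real univ * Om m u := by
  set f : ℝ → ℝ := fun y => ‖Complex.I * (Complex.exp ((u * y : ℝ) * Complex.I) - 1) / (y : ℂ)‖ with hf
  have hfi : Integrable f m := (Psi'_int m u).norm
  have hsq : ∀ y, f y ^ 2 = 2 * ((1 - Real.cos (u * y)) / y ^ 2) := fun y => Psi'_norm u y
  have hfi2 : Integrable (fun y => f y ^ 2) m := by
    simp_rw [hsq]; exact (Om_int m u).const_mul 2
  have h1 : ‖Psi' m u‖ ≤ ∫ y, f y ∂m := norm_integral_le_integral_norm _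
  have h2 : ∫ y, f y ^ 2 ∂m = 2 * Om m u := by
    simp_rw [hsq]; rw [integral_const_mul]; rfl
  have h3 : ∀ l : ℝ, 0 ≤ 2 * Om m u - 2 * l * ∫ y, f y ∂m + l ^ 2 * m.real univ := by
    intro l
    have : 0 ≤ ∫ y, (f y - l) ^ 2 ∂m := integral_nonneg fun y => sq_nonneg _
    have e : ∫ y, (f y - l) ^ 2 ∂m = 2 * Om m u - 2 * l * ∫ y, f y ∂m + l ^ 2 * m.real univ := by
      have e1 : ∀ y, (f y - l) ^ 2 = (f y ^ 2 - 2 * l * f y) + l ^ 2 := fun y => by ring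
      simp_rw [e1]
      have i3 : Integrable (fun y => f y ^ 2 - 2 * l * f y) m := hfi2.sub (hfi.const_mul _)
      rw [integral_add i3 (integrable_const _), integral_sub hfi2 (hfi.const_mul _), h2,
        integral_const_mul]
      simp; ring
    linarith
  set I := ∫ y, f y ∂m
  have hI : 0 ≤ I := integral_nonneg fun y => norm_nonneg _
  have h4 : ‖Psi' m u‖ ^ 2 ≤ I ^ 2 := by gcongr
  rcases eq_or_lt_of_le (measureReal_nonneg (μ := m) (s := univ)) with h | h
  · have hm : m = 0 := by
      rw [← Measure.measure_univ_eq_zero]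
      have := h.symm
      rwa [measureReal_eq_zero_iff] at this
    have : I = 0 := by simp [I, hm]
    rw [this] at h4
    have := Om_nonneg m u
    rw [← h]; nlinarith
  · have := h3 (I / m.real univ)
    have e : 2 * Om m u - 2 * (I / m.real univ) * I + (I / m.real univ) ^ 2 * m.real univ
       = (2 * m.real univ * Om m u - I ^ 2) / m.real univ := by field_simp; ring
    rw [e, le_div_iff₀ h] at this
    linarith

lemma Psi_hasDerivAt (hm : ∀ᵐ y ∂m, y ≠ 0 ∧ |y| ≤ 1) (u : ℝ) : HasDerivAt (Psi m) (Psi' m u) u := by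
  refine (hasDerivAt_integral_of_dominated_loc_of_deriv_le (μ := m) (s := Metric.ball u 1) (bound := fun _ => |u| + 1)
    (F := fun u y => lkIntegrandC u y / (y : ℂ) ^ 2)
    (F' := fun u y => Complex.I * (Complex.exp ((u * y : ℝ) * Complex.I) - 1) / (y : ℂ))
    (Metric.ball_mem_nhds u one_pos) (Eventually.of_forall fun v => (lk_div_int m v).1) (lk_div_int m u)
    (Psi'_int m u).1 ?_ (integrable_const _) ?_).2
  · refine ae_of_all _ fun y v hv => (Psi'_bd v y).trans ?_
    rw [Metric.mem_ball, Real.dist_eq] at hv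
    have := abs_sub_abs_le_abs_sub v u
    linarith
  · filter_upwards [hm] with y hy v hv
    have hy' : (y : ℂ) ≠ 0 := by exact_mod_cast hy.1
    have h1 : HasDerivAt (fun v : ℝ => ((v * y : ℝ) : ℂ) * Complex.I) ((y : ℂ) * Complex.I) v := by
      have := ((Complex.ofRealCLM.hasDerivAt (x := v)).mul_const (y : ℂ)).mul_const Complex.I
      simpa using this
    have h2 := ((h1.cexp.sub_const 1).sub h1).div_const ((y : ℂ) ^ 2)
    unfold lkIntegrandC
    refine h2.congr_deriv ?_
    field_simp
end
end

section
open MeasureTheory ProbabilityTheory Set Filter Topology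
open scoped ENNReal NNReal

lemma charFn_re (P : Measure ℝ) [IsProbabilityMeasure P] (u : ℝ) :
    (charFn P u).re = ∫ x, Real.cos (u * x) ∂P := by
  have b1 : Integrable (fun y : ℝ => Complex.exp ((u * y : ℝ) * Complex.I)) P :=
    (integrable_const (1:ℝ)).mono' (by fun_prop) (ae_of_all _ fun y => by rw [Complex.norm_exp_ofReal_mul_I])
  unfold charFn
  rw [← RCLike.re_eq_complex_re, ← integral_re b1]
  congr 1; ext y
  simp only [RCLike.re_eq_complex_re, Complex.exp_ofReal_mul_I_re]

lemma cos_int (P : Measure ℝ) [IsProbabilityMeasure P] (u : ℝ) : Integrable (fun x => Real.cos (u * x)) P :=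
  (integrable_const (1:ℝ)).mono' (by fun_prop) (ae_of_all _ fun y => by
    rw [Real.norm_eq_abs]; exact Real.abs_cos_le_one _)

lemma S_tendsto (x : ℝ) :
    Tendsto (fun n : ℕ => (2 * (1 - Real.cos ((1 / ((n:ℝ) + 1)) * x))) / (1 / ((n:ℝ) + 1)) ^ 2) atTop (𝓝 (x ^ 2)) := by
  have h0 : HasDerivAt (fun h : ℝ => 2 * Real.sin (h * x / 2)) x 0 := by
    have h1 : HasDerivAt (fun h : ℝ => h * x / 2) (x / 2) 0 := by
      simpa using ((hasDerivAt_id (0:ℝ)).mul_const x).div_const 2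
    refine (h1.sin.const_mul 2).congr_deriv ?_
    simp; ring
  have h1 := h0.tendsto_slope_zero
  have h2 : Tendsto (fun n : ℕ => 1 / ((n:ℝ) + 1)) atTop (𝓝[≠] 0) := by
    rw [tendsto_nhdsWithin_iff]
    refine ⟨tendsto_one_div_add_atTop_nhds_zero_nat, Eventually.of_forall fun n => ?_⟩
    simp only [mem_compl_iff, mem_singleton_iff]; positivity
  have h3 := ((h1.comp h2).pow 2)
  refine h3.congr fun n => ?_
  set h := 1 / ((n:ℝ) + 1) with hh
  have hp : 0 < h := by positivity
  have e : Real.cos (h * x) = 1 - 2 * Real.sin (h * x / 2) ^ 2 := by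
    rw [Real.sin_sq_eq_half_sub]; ring_nf
  simp only [Function.comp, smul_eq_mul, zero_add, zero_mul, zero_div, Real.sin_zero, mul_zero, sub_zero]
  rw [← hh, e]; clear_value h; field_simp; ring

section
variable (m : Measure ℝ) [IsFiniteMeasure m] (P : Measure ℝ) [IsProbabilityMeasure P]

lemma exp3 (z : ℂ) (hz : ‖z‖ ≤ 1) : ‖Complex.exp z - (1 + z + z ^ 2 / 2)‖ ≤ ‖z‖ ^ 3 := by
  have := Complex.exp_bound hz (n := 3) (by norm_num)
  simp only [Finset.sum_range_succ, Finset.range_zero, Finset.sum_empty] at this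
  norm_num [Nat.factorial] at this
  have h := pow_nonneg (norm_nonneg z) 3
  linarith

lemma hsmall_ev (c : ℝ) : ∀ᶠ n : ℕ in atTop, c * (1 / ((n:ℝ) + 1)) ≤ 1 := by
  have : Tendsto (fun n : ℕ => c * (1 / ((n:ℝ) + 1))) atTop (𝓝 (c * 0)) :=
    tendsto_one_div_add_atTop_nhds_zero_nat.const_mul c
  rw [mul_zero] at this
  filter_upwards [this.eventually (gt_mem_nhds one_pos)] with n hn using hn.le

lemma moment2 (hP : ∀ u, charFn P u = Complex.exp (Psi m u)) :
    Integrable (fun x => x ^ 2) P ∧ ∫ x, x ^ 2 ∂P ≤ m.real univ := by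
  set a := m.real univ with ha
  have ha0 : 0 ≤ a := measureReal_nonneg
  have lim0 : Tendsto (fun n : ℕ => a + a ^ 2 * (1 / ((n:ℝ) + 1))) atTop (𝓝 a) := by
    have : Tendsto (fun n : ℕ => a + a ^ 2 * (1 / ((n:ℝ) + 1))) atTop (𝓝 (a + a ^ 2 * 0)) :=
      (tendsto_one_div_add_atTop_nhds_zero_nat.const_mul _).const_add _
    simpa using this
  refine fatou_real P (fun n x => (2 * (1 - Real.cos ((1 / ((n:ℝ) + 1)) * x))) / (1 / ((n:ℝ) + 1)) ^ 2)
    (fun x => x ^ 2) ?_ ?_ S_tendsto (by fun_prop) (fun n => a + a ^ 2 * (1 / ((n:ℝ) + 1))) a ?_ lim0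
  · intro n x
    have := Real.cos_le_one ((1 / ((n:ℝ) + 1)) * x)
    apply div_nonneg (by linarith) (by positivity)
  · intro n
    exact (((integrable_const 1).sub (cos_int P _)).const_mul 2).div_const _
  · filter_upwards [hsmall_ev a, hsmall_ev 1] with n hn hn1
    set h := 1 / ((n:ℝ) + 1) with hh
    have hp : 0 < h := by positivity
    rw [integral_div, integral_const_mul, integral_sub (integrable_const _) (cos_int P _), ← charFn_re, hP]
    rw [div_le_iff₀ (by positivity)]
    have b := Psi_bound m h
    rw [← ha] at b
    have hb1 : ‖Psi m h‖ ≤ 1 := by nlinarith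
    have e := Complex.norm_exp_sub_one_sub_id_le hb1
    have e2 := (Complex.abs_re_le_norm _).trans e
    have e3 := Om_le m h
    rw [abs_le] at e2
    simp only [Complex.sub_re, Complex.one_re, Psi_re] at e2
    have b2 : ‖Psi m h‖ ^ 2 ≤ (a * (h ^ 2 / 2)) ^ 2 := by gcongr
    simp only [integral_const, probReal_univ, smul_eq_mul, mul_one]
    have h43 : a ^ 2 * h ^ 4 ≤ a ^ 2 * h ^ 3 := by
      apply mul_le_mul_of_nonneg_left _ (by positivity)
      have : 0 ≤ h ^ 3 := by positivity
      nlinarith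
    nlinarith [mul_nonneg (sq_nonneg a) (pow_nonneg hp.le 3)]

lemma one_sub_cos_ge (x : ℝ) (hx : |x| ≤ 1) : x ^ 2 / 2 - x ^ 4 * (5 / 96) ≤ 1 - Real.cos x := by
  have := (abs_le.1 (Real.cos_bound hx)).2
  rw [Even.pow_abs (by decide)] at this
  linarith

lemma Om_ge_small (hm : ∀ᵐ y ∂m, y ≠ 0 ∧ |y| ≤ 1) (h : ℝ) (h0 : 0 < h) (h1 : h ≤ 1) :
    m.real univ * (h ^ 2 / 2 - h ^ 4 * (5 / 96)) ≤ Om m h := by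
  unfold Om
  rw [← smul_eq_mul, ← integral_const]
  apply integral_mono_ae (integrable_const _) (Om_int m h)
  filter_upwards [hm] with y hy
  have hy2 : 0 < y ^ 2 := by have := hy.1; positivity
  have hy1 : y ^ 2 ≤ 1 := by rw [← sq_abs]; nlinarith [hy.2, abs_nonneg y]
  rw [le_div_iff₀ hy2]
  refine le_trans ?_ (one_sub_cos_ge (h * y) (by rw [abs_mul, abs_of_pos h0]; nlinarith [hy.2, abs_nonneg y]))
  have : 0 ≤ h ^ 4 * y ^ 2 * (1 - y ^ 2) := by
    have : 0 ≤ 1 - y ^ 2 := by linarith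
    positivity
  nlinarith

lemma Om_four (hm : ∀ᵐ y ∂m, y ≠ 0 ∧ |y| ≤ 1) (h : ℝ) :
    8 * Om m h - 2 * Om m (2 * h) ≤ m.real univ * h ^ 4 := by
  unfold Om
  rw [← integral_const_mul, ← integral_const_mul, ← integral_sub ((Om_int m h).const_mul _) ((Om_int m _).const_mul _)]
  rw [show m.real univ * h ^ 4 = ∫ _, h ^ 4 ∂m by simp]
  apply integral_mono_ae (((Om_int m h).const_mul _).sub ((Om_int m _).const_mul _)) (integrable_const _)
  filter_upwards [hm] with y hy
  have hy2 : 0 < y ^ 2 := by have := hy.1; positivity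
  have hy1 : y ^ 2 ≤ 1 := by rw [← sq_abs]; nlinarith [hy.2, abs_nonneg y]
  have e : 8 * ((1 - Real.cos (h * y)) / y ^ 2) - 2 * ((1 - Real.cos (2 * h * y)) / y ^ 2) =
    4 * (1 - Real.cos (h * y)) ^ 2 / y ^ 2 := by
    rw [show 2 * h * y = 2 * (h * y) by ring, Real.cos_two_mul]; ring
  simp only [Pi.sub_apply]
  rw [e, div_le_iff₀ hy2]
  have c1 := Real.one_sub_sq_div_two_le_cos (x := h * y)
  have c2 := Real.cos_le_one (h * y)
  have : (1 - Real.cos (h * y)) ^ 2 ≤ ((h * y) ^ 2 / 2) ^ 2 := by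
    apply pow_le_pow_left₀ <;> linarith
  have h3 : 0 ≤ h ^ 4 * y ^ 2 * (1 - y ^ 2) := by
    have : 0 ≤ 1 - y ^ 2 := by linarith
    positivity
  nlinarith

lemma moment4 (hm : ∀ᵐ y ∂m, y ≠ 0 ∧ |y| ≤ 1) (hP : ∀ u, charFn P u = Complex.exp (Psi m u)) :
    Integrable (fun x => x ^ 4) P ∧ ∫ x, x ^ 4 ∂P ≤ 3 * m.real univ ^ 2 + m.real univ := by
  set a := m.real univ with ha
  have ha0 : 0 ≤ a := measureReal_nonneg
  have lim0 : Tendsto (fun n : ℕ => (3 * a ^ 2 + a) + (a ^ 2 + 17 * a ^ 3) * (1 / ((n:ℝ) + 1))) atTop (𝓝 (3 * a ^ 2 + a)) := by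
    have : Tendsto (fun n : ℕ => (3 * a ^ 2 + a) + (a ^ 2 + 17 * a ^ 3) * (1 / ((n:ℝ) + 1))) atTop
       (𝓝 ((3 * a ^ 2 + a) + (a ^ 2 + 17 * a ^ 3) * 0)) :=
      (tendsto_one_div_add_atTop_nhds_zero_nat.const_mul _).const_add _
    simpa using this
  refine fatou_real P (fun n x => ((2 * (1 - Real.cos ((1 / ((n:ℝ) + 1)) * x))) / (1 / ((n:ℝ) + 1)) ^ 2) ^ 2)
    (fun x => x ^ 4) ?_ ?_ ?_ (by fun_prop) _ _ ?_ lim0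
  · intro n x; positivity
  · intro n
    refine (integrable_const ((4 / (1 / ((n:ℝ) + 1)) ^ 2) ^ 2)).mono' (by fun_prop) (ae_of_all _ fun x => ?_)
    have c1 := Real.cos_le_one ((1 / ((n:ℝ) + 1)) * x)
    have c2 := Real.neg_one_le_cos ((1 / ((n:ℝ) + 1)) * x)
    rw [Real.norm_of_nonneg (by positivity)]
    apply pow_le_pow_left₀ (div_nonneg (by linarith) (by positivity))
    gcongr; linarith
  · intro x
    have := (S_tendsto x).pow 2
    convert this using 2; ring
  · filter_upwards [hsmall_ev (2 * a), hsmall_ev 2] with n hn hn1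
    set h := 1 / ((n:ℝ) + 1) with hh
    have hp : 0 < h := by positivity
    have ex : ∀ x, (2 * (1 - Real.cos (h * x)) / h ^ 2) ^ 2 =
      (6 - 8 * Real.cos (h * x) + 2 * Real.cos ((2 * h) * x)) / h ^ 4 := by
      intro x
      rw [show 2 * h * x = 2 * (h * x) by ring, Real.cos_two_mul]; field_simp; ring
    simp_rw [ex]
    have i1 : Integrable (fun x => 6 - 8 * Real.cos (h * x)) P := (integrable_const _).sub ((cos_int P _).const_mul _)
    rw [integral_div, integral_add i1 ((cos_int P _).const_mul _),
      integral_sub (integrable_const _) ((cos_int P _).const_mul _), integral_const_mul, integral_const_mul,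
      ← charFn_re, ← charFn_re, hP, hP]
    rw [div_le_iff₀ (by positivity)]
    simp only [integral_const, probReal_univ, smul_eq_mul, one_mul]
    have b1 := Psi_bound m h
    have b2 := Psi_bound m (2 * h)
    rw [← ha] at b1 b2
    have h2 : a * h ^ 2 ≤ 1 / 4 := by nlinarith
    have r1 := (abs_le.1 ((Complex.abs_re_le_norm _).trans (exp3 (Psi m h) (by nlinarith)))).1
    have r2 := (abs_le.1 ((Complex.abs_re_le_norm _).trans (exp3 (Psi m (2 * h)) (by nlinarith)))).2
    have n1 := Complex.sq_norm (Psi m h)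
    have n2 := Complex.sq_norm (Psi m (2 * h))
    rw [Complex.normSq_apply] at n1 n2
    simp only [sq, Complex.add_re, Complex.sub_re, Complex.one_re, Complex.div_ofNat_re, Complex.mul_re] at r1 r2
    rw [Psi_re] at r1 r2 n1 n2
    have o4 := Om_four m hm h
    have os := Om_ge_small m hm h hp (by linarith)
    rw [← ha] at o4 os
    set w1 := Om m h
    set w2 := Om m (2 * h)
    set I1 := (Psi m h).im
    set I2 := (Psi m (2 * h)).im
    have q1 : ‖Psi m h‖ ^ 2 ≤ (a * (h ^ 2 / 2)) ^ 2 := by gcongr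
    have q2 : ‖Psi m (2 * h)‖ ^ 2 ≤ (a * ((2 * h) ^ 2 / 2)) ^ 2 := by gcongr
    have q3 : ‖Psi m h‖ ^ 3 ≤ (a * (h ^ 2 / 2)) ^ 3 := by gcongr
    have q4 : ‖Psi m (2 * h)‖ ^ 3 ≤ (a * ((2 * h) ^ 2 / 2)) ^ 3 := by gcongr
    have hh2 : h ^ 2 ≤ 1 / 4 := by nlinarith
    have w1sq : a ^ 2 * h ^ 4 / 4 - a ^ 2 * h ^ 6 * (5/96) ≤ w1 ^ 2 := by
      have hpos : 0 ≤ a * (h ^ 2 / 2 - h ^ 4 * (5 / 96)) := by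
        apply mul_nonneg ha0
        nlinarith [sq_nonneg h]
      have := pow_le_pow_left₀ hpos os 2
      nlinarith [sq_nonneg (a * h ^ 4)]
    have t5 : a ^ 2 * h ^ 6 ≤ a ^ 2 * h ^ 5 := by
      apply mul_le_mul_of_nonneg_left _ (by positivity)
      have : 0 ≤ h ^ 5 := by positivity
      nlinarith
    have t6 : a ^ 3 * h ^ 6 ≤ a ^ 3 * h ^ 5 := by
      apply mul_le_mul_of_nonneg_left _ (by positivity)
      have : 0 ≤ h ^ 5 := by positivity
      nlinarith
    have t7 : 0 ≤ a ^ 3 * h ^ 5 := by positivity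
    have t8 : 0 ≤ a ^ 2 * h ^ 5 := by positivity
    clear_value h w1 w2 I1 I2 a
    generalize ‖Psi m h‖ = N1 at *
    generalize ‖Psi m (2 * h)‖ = N2 at *
    have i2 := mul_self_nonneg I2
    linarith
end
end

section
open MeasureTheory ProbabilityTheory Set Filter Topology
open scoped ENNReal NNReal

lemma lintegral_even (f : ℝ → ℝ≥0∞) (hf : ∀ x, f (-x) = f x) :
    ∫⁻ x, f x = 2 * ∫⁻ x in Ioi 0, f x := by
  have h1 : ∫⁻ x in Iio 0, f x = ∫⁻ x in Ioi 0, f x := by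
    have := (Measure.measurePreserving_neg (volume : Measure ℝ)).setLIntegral_comp_preimage_emb
      (MeasurableEquiv.neg ℝ).measurableEmbedding f (Ioi 0)
    rw [← this]
    simp only [hf]
    congr 2
    ext x; simp
  rw [← lintegral_add_compl f (measurableSet_Ioi (a := (0:ℝ))), compl_Ioi,
    setLIntegral_congr (Iio_ae_eq_Iic (a := (0:ℝ))).symm, h1, two_mul]

lemma ft_neg_norm (f : ℝ → ℂ) (hf : ∀ x, (starRingEnd ℂ) (f x) = f x) (u : ℝ) : ‖ft f (-u)‖ = ‖ft f u‖ := by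
  rw [← RCLike.norm_conj (ft f u)]
  unfold ft
  rw [← integral_conj]
  congr 2
  ext x
  rw [map_mul, hf, ← Complex.exp_conj, map_mul, Complex.conj_ofReal, Complex.conj_I]
  congr 2
  push_cast; ring

section
variable (P G : Measure ℝ) [IsProbabilityMeasure P] [IsProbabilityMeasure G]

noncomputable def Kf (s u : ℝ) : ℝ := s * ‖ft (fun x => (dcdf P G x : ℂ)) u‖ ^ 2
  + ‖ft (fun x : ℝ => (x : ℂ) * (dcdf P G x : ℂ)) u‖ ^ 2 / s

lemma planch_dcdf (hP : Integrable (fun x => x ^ 4) P) (hG : Integrable (fun x => x ^ 4) G)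
    (s Q : ℝ) (hs : 0 < s) (hQ0 : 0 ≤ Q) (hQ : ∫⁻ u in Ioi 0, ENNReal.ofReal (Kf P G s u) ≤ ENNReal.ofReal Q) :
    Integrable (fun x => (s ^ 2 + x ^ 2) * dcdf P G x ^ 2) ∧
    ∫ x, (s ^ 2 + x ^ 2) * dcdf P G x ^ 2 ≤ s / Real.pi * Q := by
  obtain ⟨f1, f2, f3, f4⟩ := dcdf_facts P G hP hG
  have p1 := planch _ f1 f2
  have p2 := planch _ f3 f4
  have hm := dcdf_meas P G
  have c1 : Continuous (ft (fun x => (dcdf P G x : ℂ))) :=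
    continuous_iff_continuousAt.2 fun u => (ft_hasDerivAt _ f1 f3 u).continuousAt
  have hpi := Real.pi_pos
  have L : ENNReal.ofReal (2 * Real.pi) * ∫⁻ x, ENNReal.ofReal ((s ^ 2 + x ^ 2) * dcdf P G x ^ 2)
      ≤ ENNReal.ofReal (2 * s * Q) := by
    have e1 : ∀ x, ENNReal.ofReal ((s ^ 2 + x ^ 2) * dcdf P G x ^ 2) =
       ENNReal.ofReal (s ^ 2) * ‖(dcdf P G x : ℂ)‖ₑ ^ 2 + ‖(x : ℂ) * (dcdf P G x : ℂ)‖ₑ ^ 2 := by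
      intro x
      rw [← ofReal_norm, ← ofReal_norm, ← ENNReal.ofReal_pow (norm_nonneg _), ← ENNReal.ofReal_pow (norm_nonneg _),
        ← ENNReal.ofReal_mul (by positivity), ← ENNReal.ofReal_add (by positivity) (by positivity), norm_mul,
        Complex.norm_real, Complex.norm_real, mul_pow, Real.norm_eq_abs, Real.norm_eq_abs, sq_abs, sq_abs]
      ring_nf
    simp_rw [e1]
    rw [lintegral_add_left (by fun_prop), lintegral_const_mul _ (by fun_prop), mul_add, mul_left_comm]
    calc _ ≤ ENNReal.ofReal (s ^ 2) * (∫⁻ u, ‖ft (fun x => (dcdf P G x : ℂ)) u‖ₑ ^ 2)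
          + ∫⁻ u, ‖ft (fun x : ℝ => (x : ℂ) * (dcdf P G x : ℂ)) u‖ₑ ^ 2 :=
          add_le_add (mul_le_mul_right p1 _) p2
      _ = ∫⁻ u, ENNReal.ofReal s * ENNReal.ofReal (Kf P G s u) := by
          rw [← lintegral_const_mul _ (by fun_prop), ← lintegral_add_left (by fun_prop)]
          congr 1; ext u
          unfold Kf
          rw [← ofReal_norm, ← ofReal_norm, ← ENNReal.ofReal_pow (norm_nonneg _), ← ENNReal.ofReal_pow (norm_nonneg _),
            ← ENNReal.ofReal_mul (by positivity), ← ENNReal.ofReal_add (by positivity) (by positivity),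
            ← ENNReal.ofReal_mul (by positivity)]
          congr 1; field_simp
      _ = 2 * ∫⁻ u in Ioi 0, ENNReal.ofReal s * ENNReal.ofReal (Kf P G s u) := by
          apply lintegral_even
          intro u
          unfold Kf
          rw [ft_neg_norm _ (fun x => by simp), ft_neg_norm _ (fun x => by simp)]
      _ = 2 * (ENNReal.ofReal s * ∫⁻ u in Ioi 0, ENNReal.ofReal (Kf P G s u)) := by
          rw [lintegral_const_mul' _ _ ENNReal.ofReal_ne_top]
      _ ≤ 2 * (ENNReal.ofReal s * ENNReal.ofReal Q) := by gcongr
      _ = _ := by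
          rw [mul_assoc, ENNReal.ofReal_mul (by norm_num), ENNReal.ofReal_mul hs.le]; simp
  have L2 : ∫⁻ x, ENNReal.ofReal ((s ^ 2 + x ^ 2) * dcdf P G x ^ 2) ≤ ENNReal.ofReal (s / Real.pi * Q) := by
    have : ENNReal.ofReal (2 * s * Q) = ENNReal.ofReal (2 * Real.pi) * ENNReal.ofReal (s / Real.pi * Q) := by
      rw [← ENNReal.ofReal_mul (by positivity)]; congr 1; field_simp
    rw [this] at L
    exact (ENNReal.mul_le_mul_iff_right (by simpa using hpi) ENNReal.ofReal_ne_top).1 L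
  have meas : AEStronglyMeasurable (fun x => (s ^ 2 + x ^ 2) * dcdf P G x ^ 2) volume :=
    Measurable.aestronglyMeasurable (by fun_prop)
  have nn : ∀ x, 0 ≤ (s ^ 2 + x ^ 2) * dcdf P G x ^ 2 := fun x => by positivity
  constructor
  · refine ⟨meas, ?_⟩
    rw [hasFiniteIntegral_iff_ofReal (ae_of_all _ nn)]
    exact L2.trans_lt ENNReal.ofReal_lt_top
  · rw [integral_eq_lintegral_of_nonneg_ae (ae_of_all _ nn) meas]
    exact ENNReal.toReal_le_of_le_ofReal (by positivity) L2

lemma dcdf_cs (hP : Integrable (fun x => x ^ 4) P) (hG : Integrable (fun x => x ^ 4) G)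
    (s Q : ℝ) (hs : 0 < s) (hQ0 : 0 ≤ Q) (hQ : ∫⁻ u in Ioi 0, ENNReal.ofReal (Kf P G s u) ≤ ENNReal.ofReal Q)
    (S : Set ℝ) (hS : MeasurableSet S) (A τ : ℝ) (hτ : 0 < τ)
    (hA : ∫ x in S, (1 + x ^ 2 / s ^ 2)⁻¹ ≤ Real.pi * s * A) :
    ∫⁻ x in S, ENNReal.ofReal |dcdf P G x| ≤ ENNReal.ofReal ((τ * A + Q / τ) / 2) := by
  obtain ⟨i1, i2⟩ := planch_dcdf P G hP hG s Q hs hQ0 hQ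
  have hm := dcdf_meas P G
  have hpi := Real.pi_pos
  have j1 : Integrable (fun x : ℝ => (1 + x ^ 2 / s ^ 2)⁻¹) := by
    have := integrable_inv_one_add_sq.comp_div hs.ne'
    simpa [div_pow] using this
  have i3 : ∫ x in S, (s ^ 2 + x ^ 2) * dcdf P G x ^ 2 ≤ s / Real.pi * Q :=
    (setIntegral_le_integral i1 (ae_of_all _ fun x => by positivity)).trans i2
  have pt : ∀ x, |dcdf P G x| ≤ (τ / (Real.pi * s) / 2) * (1 + x ^ 2 / s ^ 2)⁻¹ +
     (Real.pi / (s * τ) / 2) * ((s ^ 2 + x ^ 2) * dcdf P G x ^ 2) := by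
    intro x
    have hx : 0 < s ^ 2 + x ^ 2 := by positivity
    have e : (1 + x ^ 2 / s ^ 2)⁻¹ = s ^ 2 / (s ^ 2 + x ^ 2) := by field_simp
    rw [e, ← sq_abs (dcdf P G x)]
    set d := |dcdf P G x|
    have : τ / (Real.pi * s) / 2 * (s ^ 2 / (s ^ 2 + x ^ 2)) + Real.pi / (s * τ) / 2 * ((s ^ 2 + x ^ 2) * d ^ 2) - d
      = (τ * s - Real.pi * (s ^ 2 + x ^ 2) * d) ^ 2 / (2 * Real.pi * s * τ * (s ^ 2 + x ^ 2)) := by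
      field_simp; ring
    have h2 : 0 ≤ (τ * s - Real.pi * (s ^ 2 + x ^ 2) * d) ^ 2 / (2 * Real.pi * s * τ * (s ^ 2 + x ^ 2)) := by positivity
    linarith
  have k1 := (j1.integrableOn (s := S)).const_mul (τ / (Real.pi * s) / 2)
  have k2 := (i1.integrableOn (s := S)).const_mul (Real.pi / (s * τ) / 2)
  calc ∫⁻ x in S, ENNReal.ofReal |dcdf P G x|
      ≤ ∫⁻ x in S, ENNReal.ofReal ((τ / (Real.pi * s) / 2) * (1 + x ^ 2 / s ^ 2)⁻¹ +
     (Real.pi / (s * τ) / 2) * ((s ^ 2 + x ^ 2) * dcdf P G x ^ 2)) :=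
        lintegral_mono fun x => ENNReal.ofReal_le_ofReal (pt x)
    _ = ENNReal.ofReal (∫ x in S, ((τ / (Real.pi * s) / 2) * (1 + x ^ 2 / s ^ 2)⁻¹ +
     (Real.pi / (s * τ) / 2) * ((s ^ 2 + x ^ 2) * dcdf P G x ^ 2))) := by
        refine (ofReal_integral_eq_lintegral_ofReal (k1.add k2) (ae_of_all _ fun x => ?_)).symm
        simp only [Pi.zero_apply, Pi.add_apply]
        positivity
    _ ≤ _ := by
        apply ENNReal.ofReal_le_ofReal
        rw [integral_add k1 k2, integral_const_mul, integral_const_mul]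
        have a1 := mul_le_mul_of_nonneg_left hA (show 0 ≤ τ / (Real.pi * s) / 2 by positivity)
        have a2 := mul_le_mul_of_nonneg_left i3 (show 0 ≤ Real.pi / (s * τ) / 2 by positivity)
        refine (add_le_add a1 a2).trans (le_of_eq ?_)
        field_simp

def Wset (R : ℝ) : Set (ℝ × ℝ) := {q | (R < q.1 ∧ q.1 < q.2) ∨ (q.2 ≤ q.1 ∧ q.1 < -R)}

lemma Wset_meas (R : ℝ) : MeasurableSet (Wset R) := by
  unfold Wset
  apply MeasurableSet.union
  · exact (measurableSet_lt measurable_const measurable_fst).inter (measurableSet_lt measurable_fst measurable_snd)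
  · exact (measurableSet_le measurable_snd measurable_fst).inter (measurableSet_lt measurable_fst measurable_const)

lemma W_int (R : ℝ) (hR : 0 ≤ R) : ∫⁻ x, P (Prod.mk x ⁻¹' Wset R) ≤ ∫⁻ z, ENNReal.ofReal (|z| - R) ∂P := by
  rw [← Measure.prod_apply (Wset_meas R), Measure.prod_apply_symm (Wset_meas R)]
  apply lintegral_mono
  intro z
  have : (fun x => (x, z)) ⁻¹' Wset R = Ioo R z ∪ Ico z (-R) := by
    ext x; simp [Wset]
  simp only [this]
  refine (measure_union_le _ _).trans ?_
  rw [Real.volume_Ioo, Real.volume_Ico]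
  rcases le_total 0 z with h | h
  · rw [ENNReal.ofReal_of_nonpos (p := -R - z) (by linarith), abs_of_nonneg h, add_zero]
  · rw [ENNReal.ofReal_of_nonpos (p := z - R) (by linarith), abs_of_nonpos h, zero_add]
    apply ENNReal.ofReal_le_ofReal; linarith

lemma dcdf_tail_int (R : ℝ) (hR : 0 ≤ R) : ∫⁻ x in (Icc (-R) R)ᶜ, ENNReal.ofReal |dcdf P G x| ≤
    (∫⁻ z, ENNReal.ofReal (|z| - R) ∂P) + ∫⁻ z, ENNReal.ofReal (|z| - R) ∂G := by
  refine le_trans ?_ (add_le_add (W_int P R hR) (W_int G R hR))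
  rw [← lintegral_add_left (measurable_measure_prodMk_left (Wset_meas R))]
  rw [← lintegral_indicator measurableSet_Icc.compl]
  apply lintegral_mono
  intro x
  by_cases hx : x ∈ (Icc (-R) R)ᶜ
  · simp only [hx, indicator_of_mem]
    have hx' : x < -R ∨ R < x := by
      simp only [mem_compl_iff, mem_Icc, not_and_or, not_le] at hx; exact hx
    have key : ∀ p q : ℝ≥0∞, ∀ a b : ℝ, 0 ≤ a → 0 ≤ b → p = ENNReal.ofReal a → q = ENNReal.ofReal b →
       |dcdf P G x| = |a - b| → ENNReal.ofReal |dcdf P G x| ≤ p + q := by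
      intro p q a b ha hb hp hq h
      rw [hp, hq, ← ENNReal.ofReal_add ha hb, h]
      apply ENNReal.ofReal_le_ofReal
      rw [abs_le]; constructor <;> linarith
    rcases hx' with h | h
    · have e : Prod.mk x ⁻¹' Wset R = Iic x := by
        ext z; simp only [Wset, mem_preimage, mem_ofPred_eq, mem_Iic]
        constructor
        · rintro (h' | h')
          · linarith [h'.1]
          · exact h'.1
        · intro h'; right; exact ⟨h', h⟩
      rw [e]
      exact key _ _ (cdf P x) (cdf G x) (cdf_nonneg _ _) (cdf_nonneg _ _) (by rw [ofReal_cdf]) (by rw [ofReal_cdf]) rfl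
    · have e : Prod.mk x ⁻¹' Wset R = Ioi x := by
        ext z; simp only [Wset, mem_preimage, mem_ofPred_eq, mem_Ioi]
        constructor
        · rintro (h' | h')
          · exact h'.2
          · linarith [h'.2]
        · intro h'; left; exact ⟨h, h'⟩
      rw [e]
      have c : ∀ (M : Measure ℝ) [IsProbabilityMeasure M], M (Ioi x) = ENNReal.ofReal (1 - cdf M x) := by
        intro M _
        rw [ENNReal.ofReal_sub _ (cdf_nonneg _ _), ofReal_cdf, ← compl_Iic, prob_compl_eq_one_sub measurableSet_Iic]
        simp
      refine key _ _ (1 - cdf P x) (1 - cdf G x) (by linarith [cdf_le_one P x]) (by linarith [cdf_le_one G x]) (c P) (c G) ?_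
      unfold dcdf
      rw [← abs_neg]; congr 1; ring
  · simp [hx]

lemma tail_moment (hP : Integrable (fun x => x ^ 4) P) (R M : ℝ) (hR : 0 < R) (hM : ∫ x, x ^ 4 ∂P ≤ M) :
    ∫⁻ z, ENNReal.ofReal (|z| - R) ∂P ≤ ENNReal.ofReal (27 / 256 * M / R ^ 3) := by
  calc _ ≤ ∫⁻ z, ENNReal.ofReal (27 / 256 / R ^ 3 * z ^ 4) ∂P := by
        apply lintegral_mono; intro z
        apply ENNReal.ofReal_le_ofReal
        rw [← Even.pow_abs (by decide) z]
        generalize hy : |z| = y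
        have hy0 : 0 ≤ y := hy ▸ abs_nonneg z
        have : 27 / 256 / R ^ 3 * y ^ 4 - (y - R) = (3 * y - 4 * R) ^ 2 * (3 * y ^ 2 + 8 * y * R + 16 * R ^ 2) / (256 * R ^ 3) := by
          field_simp; ring
        have h2 : 0 ≤ (3 * y - 4 * R) ^ 2 * (3 * y ^ 2 + 8 * y * R + 16 * R ^ 2) / (256 * R ^ 3) := by positivity
        linarith
    _ = ENNReal.ofReal (∫ z, 27 / 256 / R ^ 3 * z ^ 4 ∂P) := by
        rw [ofReal_integral_eq_lintegral_ofReal (hP.const_mul _) (ae_of_all _ fun x => by positivity)]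
    _ ≤ _ := by
        apply ENNReal.ofReal_le_ofReal
        rw [integral_const_mul, show 27 / 256 * M / R ^ 3 = 27 / 256 / R ^ 3 * M by ring]
        gcongr
end
end

section
open MeasureTheory ProbabilityTheory Set Filter Topology
open scoped ENNReal NNReal

lemma gauss_tail (σ : ℝ) (hσ : 0 < σ) :
    ∫⁻ z, ENNReal.ofReal (|z| - √6 * σ) ∂(gaussianReal 0 (Real.toNNReal (σ ^ 2))) ≤
      ENNReal.ofReal (σ / 3 * Real.exp (-3) / √(2 * Real.pi)) := by
  have hv : Real.toNNReal (σ ^ 2) ≠ 0 := by simpa using hσ.ne'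
  set R := √6 * σ with hR
  have hR0 : 0 < R := by positivity
  have hR2 : R ^ 2 = 6 * σ ^ 2 := by rw [hR, mul_pow, Real.sq_sqrt (by norm_num)]
  set c := (√(2 * Real.pi * σ ^ 2))⁻¹ with hc
  have hc0 : 0 < c := by positivity
  have hpdf : ∀ x, gaussianPDFReal 0 (Real.toNNReal (σ ^ 2)) x = c * Real.exp (-x ^ 2 / (2 * σ ^ 2)) := by
    intro x
    simp only [gaussianPDFReal, sub_zero, Real.coe_toNNReal _ (sq_nonneg σ)]
    rw [hc]
  rw [gaussianReal_of_var_ne_zero _ hv, lintegral_withDensity_eq_lintegral_mul _ (measurable_gaussianPDF _ _) (by fun_prop)]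
  simp only [Pi.mul_apply, gaussianPDF, hpdf]
  rw [lintegral_even _ (by intro x; simp)]
  have hd : ∀ x, HasDerivAt (fun x : ℝ => -(c * σ ^ 2 / (2 * R ^ 2)) * ((x ^ 2 - R ^ 2 + 2 * σ ^ 2) * Real.exp (-x ^ 2 / (2 * σ ^ 2))))
      (c / (2 * R ^ 2) * (x * (x ^ 2 - R ^ 2) * Real.exp (-x ^ 2 / (2 * σ ^ 2)))) x := by
    intro x
    have h1 : HasDerivAt (fun x : ℝ => x ^ 2 - R ^ 2 + 2 * σ ^ 2) (2 * x) x := by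
      simpa using ((hasDerivAt_pow 2 x).sub_const (R ^ 2)).add_const (2 * σ ^ 2)
    have h2 : HasDerivAt (fun x : ℝ => Real.exp (-x ^ 2 / (2 * σ ^ 2))) (Real.exp (-x ^ 2 / (2 * σ ^ 2)) * (-(2 * x) / (2 * σ ^ 2))) x := by
      have := ((hasDerivAt_pow 2 x).neg.div_const (2 * σ ^ 2)).exp
      simpa using this
    refine ((h1.mul h2).const_mul _).congr_deriv ?_
    field_simp
    ring
  have hpos : ∀ x ∈ Ioi R, 0 ≤ c / (2 * R ^ 2) * (x * (x ^ 2 - R ^ 2) * Real.exp (-x ^ 2 / (2 * σ ^ 2))) := by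
    intro x hx
    have hx' : R < x := hx
    have h1 : 0 ≤ x ^ 2 - R ^ 2 := by nlinarith
    have : 0 < x := hR0.trans hx'
    positivity
  have hlim : Tendsto (fun x : ℝ => -(c * σ ^ 2 / (2 * R ^ 2)) * ((x ^ 2 - R ^ 2 + 2 * σ ^ 2) * Real.exp (-x ^ 2 / (2 * σ ^ 2)))) atTop (𝓝 0) := by
    have t1 : Tendsto (fun x : ℝ => x ^ 2 / (2 * σ ^ 2)) atTop atTop :=
      (tendsto_pow_atTop two_ne_zero).atTop_div_const (by positivity)
    have t2 := (Real.tendsto_pow_mul_exp_neg_atTop_nhds_zero 1).comp t1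
    have t3 := (Real.tendsto_pow_mul_exp_neg_atTop_nhds_zero 0).comp t1
    have t4 := ((t2.const_mul (2 * σ ^ 2)).add (t3.const_mul (- R ^ 2 + 2 * σ ^ 2))).const_mul (-(c * σ ^ 2 / (2 * R ^ 2)))
    simp only [mul_zero, add_zero] at t4
    refine t4.congr fun x => ?_
    simp only [Function.comp, pow_one, pow_zero, one_mul, neg_div]
    field_simp
    ring
  have hIntg := integral_Ioi_of_hasDerivAt_of_nonneg' (a := R) (fun x _ => hd x) hpos hlim
  have hintg := integrableOn_Ioi_deriv_of_nonneg' (a := R) (fun x _ => hd x) hpos hlim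
  calc _ ≤ 2 * ∫⁻ x in Ioi R, ENNReal.ofReal (c / (2 * R ^ 2) * (x * (x ^ 2 - R ^ 2) * Real.exp (-x ^ 2 / (2 * σ ^ 2)))) := by
        gcongr 2 * ?_
        rw [← lintegral_indicator measurableSet_Ioi, ← lintegral_indicator measurableSet_Ioi]
        apply lintegral_mono; intro x
        by_cases hx : x ∈ Ioi R
        · have hx' : R < x := hx
          have hx0 : x ∈ Ioi (0:ℝ) := hR0.trans hx'
          have hx1 : 0 < x := hx0
          simp only [hx, hx0, indicator_of_mem]
          rw [← ENNReal.ofReal_mul (by positivity), abs_of_pos hx1]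
          apply ENNReal.ofReal_le_ofReal
          have : x - R ≤ x * (x ^ 2 - R ^ 2) / (2 * R ^ 2) := by
            rw [le_div_iff₀ (by positivity)]
            have : 0 ≤ (x - R) * (x * (x + R) - 2 * R ^ 2) := mul_nonneg (by linarith) (by nlinarith)
            nlinarith
          calc _ ≤ c * Real.exp (-x ^ 2 / (2 * σ ^ 2)) * (x * (x ^ 2 - R ^ 2) / (2 * R ^ 2)) := by gcongr
            _ = _ := by ring
        · simp only [hx, not_false_eq_true, indicator_of_notMem]
          by_cases hx0 : x ∈ Ioi (0:ℝ)
          · have hx1 : 0 < x := hx0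
            simp only [hx0, indicator_of_mem]
            rw [abs_of_pos hx1, ENNReal.ofReal_of_nonpos (p := x - R) (by simpa using hx)]
            simp
          · simp [hx0]
    _ = _ := by
        rw [← ofReal_integral_eq_lintegral_ofReal hintg ((ae_restrict_iff' measurableSet_Ioi).2 (ae_of_all _ hpos)), hIntg]
        rw [show (2:ℝ≥0∞) = ENNReal.ofReal 2 by simp, ← ENNReal.ofReal_mul (by norm_num)]
        congr 1
        rw [hR2, show -(6 * σ ^ 2) / (2 * σ ^ 2) = -3 by field_simp; norm_num, hc, Real.sqrt_mul (by positivity), Real.sqrt_sq hσ.le]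
        field_simp
        ring

section
variable (P : Measure ℝ) [IsProbabilityMeasure P]

lemma gauss_int4 (v : ℝ≥0) : Integrable (fun x => x ^ 4) (gaussianReal 0 v) := by
  have := (memLp_id_gaussianReal (μ := 0) (v := v) 4).integrable_norm_pow (by norm_num)
  refine this.congr (ae_of_all _ fun x => ?_)
  simp [Even.pow_abs (show Even 4 by decide)]

lemma red_untr (hP : Integrable (fun x => x ^ 4) P) (v : ℝ≥0) (s Q : ℝ) (hs : 0 < s) (hQ0 : 0 ≤ Q)
    (hQ : ∫⁻ u in Ioi 0, ENNReal.ofReal (Kf P (gaussianReal 0 v) s u) ≤ ENNReal.ofReal Q) (hQ4 : Q ≤ 1 / 4) :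
    wasserstein 1 P (gaussianReal 0 v) ≤ ENNReal.ofReal (1 / 2) := by
  refine (wasserstein_one_le_cdf P _).trans ?_
  have := dcdf_cs P (gaussianReal 0 v) hP (gauss_int4 v) s Q hs hQ0 hQ univ MeasurableSet.univ 1 (1/2) (by norm_num) ?_
  · rw [setLIntegral_univ] at this
    refine this.trans (ENNReal.ofReal_le_ofReal ?_)
    linarith
  · rw [setIntegral_univ]
    have := Measure.integral_comp_div (fun x : ℝ => (1 + x ^ 2)⁻¹) s
    rw [integral_univ_inv_one_add_sq, abs_of_pos hs] at this
    simp only [div_pow, smul_eq_mul] at this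
    rw [this]; linarith

lemma red_tr (σ : ℝ) (hσ : 0 < σ) (hP : Integrable (fun x => x ^ 4) P) (hP4 : ∫ x, x ^ 4 ∂P ≤ 3 * (σ ^ 2) ^ 2 + σ ^ 2)
    (Q T : ℝ) (hQ0 : 0 ≤ Q)
    (hQ : ∫⁻ u in Ioi 0, ENNReal.ofReal (Kf P (gaussianReal 0 (Real.toNNReal (σ ^ 2))) (√2 * σ) u) ≤ ENNReal.ofReal Q)
    (hT : 27 / 256 * (3 * σ + 1 / σ) / (6 * √6) + σ / 3 * Real.exp (-3) / √(2 * Real.pi) ≤ T) (hT2 : T < 1 / 2)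
    (hQT : Q ≤ 3 / 2 * (1 / 2 - T) ^ 2) :
    wasserstein 1 P (gaussianReal 0 (Real.toNNReal (σ ^ 2))) ≤ ENNReal.ofReal (1 / 2) := by
  refine (wasserstein_one_le_cdf P _).trans ?_
  set G := gaussianReal 0 (Real.toNNReal (σ ^ 2)) with hG
  set R := √6 * σ with hR
  have hR0 : 0 < R := by positivity
  have hs : 0 < √2 * σ := by positivity
  have hpi := Real.pi_pos
  have h1 := dcdf_cs P G hP (gauss_int4 _) (√2 * σ) Q hs hQ0 hQ (Icc (-R) R) measurableSet_Icc (2 / 3) (3 / 2 * (1 / 2 - T)) (by linarith) ?_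
  · have h2 := dcdf_tail_int P G R hR0.le
    have h3 := tail_moment P hP R _ hR0 hP4
    have h4 := gauss_tail σ hσ
    rw [← hR, ← hG] at h4
    rw [← lintegral_add_compl _ (measurableSet_Icc (a := -R) (b := R))]
    have h5 : 27 / 256 * (3 * (σ ^ 2) ^ 2 + σ ^ 2) / R ^ 3 = 27 / 256 * (3 * σ + 1 / σ) / (6 * √6) := by
      have : R ^ 3 = 6 * √6 * σ ^ 3 := by
        rw [hR, mul_pow, show √6 ^ 3 = √6 ^ 2 * √6 by ring, Real.sq_sqrt (by norm_num)]
      rw [this]; field_simp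
    rw [h5] at h3
    refine (add_le_add h1 (h2.trans (add_le_add h3 h4))).trans ?_
    rw [← ENNReal.ofReal_add (by positivity) (by positivity), ← ENNReal.ofReal_add (by
      have : 0 < 1 / 2 - T := by linarith
      positivity) (by positivity)]
    apply ENNReal.ofReal_le_ofReal
    have : Q / (3 / 2 * (1 / 2 - T)) ≤ 1 / 2 - T := by
      rw [div_le_iff₀ (by linarith)]; nlinarith
    linarith
  · rw [integral_Icc_eq_integral_Ioc, ← intervalIntegral.integral_of_le (by linarith)]
    have := intervalIntegral.integral_comp_div (a := -R) (b := R) (fun x : ℝ => (1 + x ^ 2)⁻¹) hs.ne'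
    simp only [div_pow, smul_eq_mul] at this
    rw [this, integral_inv_one_add_sq]
    have e : R / (√2 * σ) = √3 := by
      rw [hR, show (6:ℝ) = 2 * 3 by norm_num, Real.sqrt_mul (by norm_num)]; field_simp
    rw [neg_div, e, Real.arctan_neg, Real.arctan_sqrt_three]
    apply le_of_eq; ring
end
end

section
open MeasureTheory ProbabilityTheory Set Filter Topology
open scoped ENNReal NNReal

lemma charFn_gauss (σ u : ℝ) :
    charFn (gaussianReal 0 (Real.toNNReal (σ ^ 2))) u = (Real.exp (-(σ ^ 2 * u ^ 2) / 2) : ℂ) := by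
  have := charFun_gaussianReal (μ := 0) (v := Real.toNNReal (σ ^ 2)) u
  rw [charFun_apply_real] at this
  unfold charFn
  have e : ∀ x : ℝ, Complex.exp ((u * x : ℝ) * Complex.I) = Complex.exp (u * x * Complex.I) := by intro x; push_cast; rfl
  simp_rw [e]
  rw [this]
  rw [Real.coe_toNNReal _ (sq_nonneg σ)]
  push_cast; congr 1; ring

noncomputable def cg (σ u : ℝ) : ℝ := Real.exp (-(σ ^ 2 * u ^ 2) / 2)

lemma cg_pos (σ u : ℝ) : 0 < cg σ u := Real.exp_pos _

lemma cg_deriv (σ u : ℝ) : HasDerivAt (cg σ) (-(σ ^ 2 * u) * cg σ u) u := by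
  have h : HasDerivAt (fun u : ℝ => -(σ ^ 2 * u ^ 2) / 2) (-(σ ^ 2 * u)) u := by
    have := (((hasDerivAt_pow 2 u).const_mul (σ ^ 2)).neg.div_const 2)
    refine this.congr_deriv ?_
    simp; ring
  refine h.exp.congr_deriv ?_
  unfold cg; ring

section
variable (m : Measure ℝ) [IsFiniteMeasure m] (P : Measure ℝ) [IsProbabilityMeasure P]

noncomputable def Xr (σ u : ℝ) : ℝ := (Complex.exp (Psi m u)).re - cg σ u
noncomputable def Yr (u : ℝ) : ℝ := (Complex.exp (Psi m u)).im

lemma XY_norm (u : ℝ) (σ : ℝ) : (Xr m σ u + cg σ u) ^ 2 + Yr m u ^ 2 = Real.exp (-Om m u) ^ 2 := by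
  have := Complex.norm_exp (Psi m u)
  rw [Psi_re] at this
  rw [← this, Complex.sq_norm, Complex.normSq_apply]
  unfold Xr Yr; ring

noncomputable def Bf (σ u : ℝ) : ℝ := -(Xr m σ u ^ 2 + Yr m u ^ 2) / (√2 * σ * u ^ 3)
  + 2 * σ ^ 2 * cg σ u * Xr m σ u / (√2 * σ * u)

/-- derivative of the boundary term, with the main upper bound -/
lemma K_bound (hm : ∀ᵐ y ∂m, y ≠ 0 ∧ |y| ≤ 1) (hP : ∀ u, charFn P u = Complex.exp (Psi m u))
    (hP4 : Integrable (fun x => x ^ 4) P)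
    (σ : ℝ) (hσ : 0 < σ) (ha : m.real univ = σ ^ 2) (u : ℝ) (hu : 0 < u) :
    ∃ B', HasDerivAt (Bf m σ) B' u ∧ Kf P (gaussianReal 0 (Real.toNNReal (σ ^ 2))) (√2 * σ) u ≤
      B' + 1 / (√2 * σ * u ^ 4) * ((2 * (σ * u) ^ 2 - 2 + 2 * (σ * u) ^ 2 * Om m u) * Real.exp (-Om m u) ^ 2
        - (2 + 3 * (σ * u) ^ 4) * cg σ u ^ 2
        + 2 * (2 - (σ * u) ^ 2 + (σ * u) ^ 4) * cg σ u * Real.exp (-Om m u)) := by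
  set G := gaussianReal 0 (Real.toNNReal (σ ^ 2)) with hG
  have iP1 : Integrable (fun x : ℝ => x) P := by
    refine ((integrable_const (1:ℝ)).add hP4).mono' (by fun_prop) (ae_of_all _ fun x => ?_)
    simp only [Pi.add_apply, Real.norm_eq_abs]
    rw [abs_le]; constructor <;> nlinarith [sq_nonneg (x ^ 2 - 1), sq_nonneg (x ^ 2), sq_nonneg (x-1), sq_nonneg (x+1)]
  have iG1 : Integrable (fun x : ℝ => x) G := by
    refine ((integrable_const (1:ℝ)).add (gauss_int4 (Real.toNNReal (σ ^ 2)))).mono' (by fun_prop) (ae_of_all _ fun x => ?_)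
    simp only [Pi.add_apply, Real.norm_eq_abs]
    rw [abs_le]; constructor <;> nlinarith [sq_nonneg (x ^ 2 - 1), sq_nonneg (x ^ 2), sq_nonneg (x-1), sq_nonneg (x+1)]
  obtain ⟨f1, f2, f3, f4⟩ := dcdf_facts P G hP4 (gauss_int4 _)
  have hft : ∀ w : ℝ, w ≠ 0 → ft (fun x => (dcdf P G x : ℂ)) w = ((cg σ w : ℂ) - Complex.exp (Psi m w)) / (Complex.I * w) := by
    intro w hw
    rw [ft_dcdf P G iP1 iG1 w hw, hP, hG, charFn_gauss]; rfl
  have hψ : HasDerivAt (fun u => Complex.exp (Psi m u)) (Complex.exp (Psi m u) * Psi' m u) u := (Psi_hasDerivAt m hm u).cexp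
  set ψ := Complex.exp (Psi m u) with hψd
  set D := ψ * Psi' m u with hD
  have hcC : HasDerivAt (fun u => (cg σ u : ℂ)) ((-(σ ^ 2 * u) * cg σ u : ℝ) : ℂ) u := (cg_deriv σ u).ofReal_comp
  have hu' : (u : ℂ) ≠ 0 := by exact_mod_cast hu.ne'
  have hd1 : HasDerivAt (fun w : ℝ => ((cg σ w : ℂ) - Complex.exp (Psi m w)) / (Complex.I * w))
      (((((-(σ ^ 2 * u) * cg σ u : ℝ) : ℂ) - D) * (Complex.I * u) - ((cg σ u : ℂ) - ψ) * (Complex.I * 1)) / (Complex.I * u) ^ 2) u := by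
    have h3 : HasDerivAt (fun w : ℝ => Complex.I * (w : ℂ)) (Complex.I * 1) u :=
      ((hasDerivAt_id u).ofReal_comp).const_mul Complex.I
    exact (hcC.sub hψ).div h3 (mul_ne_zero Complex.I_ne_zero hu')
  have hd2 := ft_hasDerivAt _ f1 f3 u
  have hev : (fun w : ℝ => ((cg σ w : ℂ) - Complex.exp (Psi m w)) / (Complex.I * w)) =ᶠ[𝓝 u] ft (fun x => (dcdf P G x : ℂ)) := by
    filter_upwards [lt_mem_nhds hu] with w hw
    rw [hft w hw.ne']
  have huniq := (hd2.congr_of_eventuallyEq hev).unique hd1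
  -- norms
  have n1 : ‖ft (fun x => (dcdf P G x : ℂ)) u‖ ^ 2 = (Xr m σ u ^ 2 + Yr m u ^ 2) / u ^ 2 := by
    rw [hft u hu.ne', norm_div, norm_mul, Complex.norm_I, one_mul, Complex.norm_real, Real.norm_eq_abs, abs_of_pos hu, div_pow]
    congr 1
    rw [Complex.sq_norm, Complex.normSq_apply]
    simp only [Complex.sub_re, Complex.sub_im, Complex.ofReal_re, Complex.ofReal_im]
    unfold Xr Yr; ring
  set c := cg σ u with hc
  set X := Xr m σ u with hX
  set Y := Yr m u with hY
  have eX : ψ.re = X + c := by rw [hX]; unfold Xr; ring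
  have eY : ψ.im = Y := rfl
  have n2 : ‖ft (fun x : ℝ => (x : ℂ) * (dcdf P G x : ℂ)) u‖ ^ 2 =
     ((D.re + σ ^ 2 * u * c) * u - X) ^ 2 / u ^ 4 + (D.im * u - Y) ^ 2 / u ^ 4 := by
    rw [← one_mul ‖ft (fun x : ℝ => (x : ℂ) * (dcdf P G x : ℂ)) u‖, ← Complex.norm_I, ← norm_mul, huniq]
    have e : (((-(σ ^ 2 * u) * c : ℝ) : ℂ) - D) * (Complex.I * u) - ((c : ℂ) - ψ) * (Complex.I * 1) =
       -(Complex.I * (((((D.re + σ ^ 2 * u * c) * u - X : ℝ)) : ℂ) + ((D.im * u - Y : ℝ) : ℂ) * Complex.I)) := by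
      apply Complex.ext <;> simp [eX, eY] <;> ring
    rw [e, norm_div, norm_neg, norm_mul, norm_pow, norm_mul, Complex.norm_I, one_mul, one_mul, Complex.norm_real, Real.norm_eq_abs,
      abs_of_pos hu, div_pow, Complex.sq_norm, Complex.normSq_add_mul_I]
    rw [← pow_mul]; ring
  have hDn : D.re ^ 2 + D.im ^ 2 ≤ Real.exp (-Om m u) ^ 2 * (2 * σ ^ 2 * Om m u) := by
    have h1 := Complex.norm_exp (Psi m u)
    rw [Psi_re] at h1
    have h2 := Psi'_sq m u
    rw [ha] at h2
    have : D.re ^ 2 + D.im ^ 2 = ‖D‖ ^ 2 := by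
      rw [Complex.sq_norm, Complex.normSq_apply]; ring
    rw [this, hD, norm_mul, hψd, h1, mul_pow]
    gcongr
  have hXY := XY_norm m u σ
  rw [← hX, ← hY, ← hc] at hXY
  set E := Real.exp (-Om m u) with hE
  have hE0 : 0 < E := Real.exp_pos _
  have hXle : X ≤ E - c := by
    have : (X + c) ^ 2 ≤ E ^ 2 := by nlinarith [sq_nonneg Y]
    have := abs_le_of_sq_le_sq' this hE0.le
    linarith [this.2]
  -- derivative of B
  have dX : HasDerivAt (Xr m σ) (D.re - (-(σ ^ 2 * u) * c)) u := by
    have := (Complex.reCLM.hasFDerivAt.comp_hasDerivAt u hψ)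
    exact this.sub (cg_deriv σ u)
  have dY : HasDerivAt (Yr m) D.im u := (Complex.imCLM.hasFDerivAt.comp_hasDerivAt u hψ)
  have hs : 0 < √2 * σ := by positivity
  have dB1 := ((dX.pow 2).add (dY.pow 2)).neg.div ((hasDerivAt_pow 3 u).const_mul (√2 * σ)) (by positivity)
  have dB2 := (((cg_deriv σ u).const_mul (2 * σ ^ 2)).mul dX).div ((hasDerivAt_id u).const_mul (√2 * σ)) (mul_pos hs hu).ne'
  have dB := dB1.add dB2
  refine ⟨_, dB, ?_⟩
  unfold Kf
  rw [n1, n2]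
  simp only [Pi.add_apply, Pi.pow_apply, Pi.neg_apply, Pi.mul_apply, id, ← hX, ← hY, ← hc]
  have hc0 : 0 < c := cg_pos σ u
  set ω := Om m u with hω
  have hs2 : (√2) ^ 2 = 2 := Real.sq_sqrt (by norm_num)
  have hr : 0 < √2 := by positivity
  generalize √2 = r at *
  clear_value c X Y E ω D
  have key1 : 0 ≤ (E ^ 2 * (2 * σ ^ 2 * ω) - (D.re ^ 2 + D.im ^ 2)) / (r * σ * u ^ 2) := by
    apply div_nonneg (by linarith) (by positivity)
  have key2 : 0 ≤ (2 * c / (r * σ * u ^ 4)) * (2 - (σ * u) ^ 2 + (σ * u) ^ 4) * (E - c - X) := by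
    apply mul_nonneg (mul_nonneg (by positivity) _) (by linarith)
    nlinarith [sq_nonneg ((σ * u) ^ 2 - 1 / 2)]
  have hY2 : Y ^ 2 = E ^ 2 - (X + c) ^ 2 := by linarith
  rw [← sub_nonneg]
  refine (add_nonneg key1 key2).trans (le_of_eq ?_)
  generalize D.re = D1 at *
  generalize D.im = D2 at *
  have hr2 : r ^ 2 = 2 := hs2
  have hr0 := hr.ne'
  have hσ0 := hσ.ne'
  have hu0 := hu.ne'
  clear huniq hd1 hd2 hev hψ hcC dB dB1 dB2 dX dY
  linear_combination (norm := (field_simp; ring)) ((2 * (σ * u) ^ 2 - 2) / (r * σ * u ^ 4)) * hXY + (σ / (r * u ^ 2) * (X ^ 2 + Y ^ 2)) * hr2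
end
end

section
open MeasureTheory ProbabilityTheory Set Filter Topology
open scoped ENNReal NNReal FourierTransform

noncomputable def brack (m : Measure ℝ) (σ u : ℝ) : ℝ :=
  1 / (√2 * σ * u ^ 4) * ((2 * (σ * u) ^ 2 - 2 + 2 * (σ * u) ^ 2 * Om m u) * Real.exp (-Om m u) ^ 2
        - (2 + 3 * (σ * u) ^ 4) * cg σ u ^ 2
        + 2 * (2 - (σ * u) ^ 2 + (σ * u) ^ 4) * cg σ u * Real.exp (-Om m u))

noncomputable def lowf (m : Measure ℝ) (σ u : ℝ) : ℝ := √2 * σ ^ 3 * (Real.exp (-Om m u) ^ 2 - cg σ u ^ 2)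
noncomputable def gam (σ u : ℝ) : ℝ := √2 * σ ^ 3 * cg σ u * (1 + 2 / (σ * u) ^ 4 - 1 / (σ * u) ^ 2)
noncomputable def FF (σ w : ℝ) : ℝ := √2 * σ * ((1 + w) * Real.exp (-w) ^ 2)
noncomputable def highf (m : Measure ℝ) (σ u : ℝ) : ℝ := FF σ (Om m u) / u ^ 2 + gam σ u * Real.exp (-Om m u)

lemma brack_low (m : Measure ℝ) (σ u : ℝ) (hσ : 0 < σ) (hu : 0 < u) : brack m σ u ≤ lowf m σ u := by
  unfold brack lowf
  set ω := Om m u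
  set ζ := σ ^ 2 * u ^ 2 / 2 - ω with hζ
  set c := cg σ u with hc
  have hc0 : 0 < c := cg_pos _ _
  set E := Real.exp ζ with hE
  have hE0 : 0 < E := Real.exp_pos _
  have e1 : Real.exp (-ω) = c * E := by
    rw [hc, hE, cg, ← Real.exp_add]; congr 1; rw [hζ]; ring
  have hEζ : 0 ≤ ζ * E - E + 1 := by
    have h1 := Real.add_one_le_exp (-ζ)
    have h2 : Real.exp (-ζ) * E = 1 := by rw [hE, ← Real.exp_add]; simp
    nlinarith
  have hω : ω = (σ * u) ^ 2 / 2 - ζ := by rw [hζ]; ring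
  rw [e1, hω]
  clear_value ζ E c ω
  have hr : 0 < √2 := by positivity
  have hs2 : (√2) ^ 2 = 2 := Real.sq_sqrt (by norm_num)
  generalize √2 = r at *
  have e : r * σ ^ 3 = 1 / (r * σ * u ^ 4) * (2 * (σ * u) ^ 4) := by
    field_simp; linarith
  rw [e, mul_assoc (1 / (r * σ * u ^ 4))]
  apply mul_le_mul_of_nonneg_left _ (by positivity)
  have k1 : 0 ≤ c ^ 2 * (((σ * u) ^ 4 + 2) * (E - 1) ^ 2 + 2 * (σ * u) ^ 2 * E * (ζ * E - E + 1)) := by positivity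
  generalize σ * u = v at *
  nlinarith

lemma brack_high (m : Measure ℝ) (σ u : ℝ) (hσ : 0 < σ) (hu : 0 < u) : brack m σ u ≤ highf m σ u := by
  unfold brack highf FF gam
  set ω := Om m u
  set E := Real.exp (-ω)
  set c := cg σ u with hc
  have hc0 : 0 < c := cg_pos _ _
  have hr : 0 < √2 := by positivity
  have hs2 : (√2) ^ 2 = 2 := Real.sq_sqrt (by norm_num)
  generalize √2 = r at *
  clear_value c E
  have k : 0 ≤ 1 / (r * σ * u ^ 4) * (2 * E ^ 2 + (2 + 3 * (σ * u) ^ 4) * c ^ 2) := by positivity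
  have e : r * σ * ((1 + ω) * E ^ 2) / u ^ 2 + r * σ ^ 3 * c * (1 + 2 / (σ * u) ^ 4 - 1 / (σ * u) ^ 2) * E
    = 1 / (r * σ * u ^ 4) * ((2 * (σ * u) ^ 2 + 2 * (σ * u) ^ 2 * ω) * E ^ 2 + 2 * (2 - (σ * u) ^ 2 + (σ * u) ^ 4) * c * E) := by
    linear_combination (norm := (field_simp; ring)) (σ * ((1 + ω) * E ^ 2) / (r * u ^ 2) + σ ^ 3 * c * (1 + 2 / (σ * u) ^ 4 - 1 / (σ * u) ^ 2) * E / r) * hs2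
  rw [e]
  linarith

section
variable (m : Measure ℝ) [IsFiniteMeasure m] (P : Measure ℝ) [IsProbabilityMeasure P]

lemma Om_cont (hm : ∀ᵐ y ∂m, y ≠ 0 ∧ |y| ≤ 1) : Continuous (Om m) := by
  have h : Continuous (Psi m) := continuous_iff_continuousAt.2 fun u => (Psi_hasDerivAt m hm u).continuousAt
  have e : Om m = fun u => -(Psi m u).re := by ext u; rw [Psi_re]; ring
  rw [e]; exact (Complex.continuous_re.comp h).neg

lemma cg_cont (σ : ℝ) : Continuous (cg σ) := by unfold cg; fun_prop

lemma lowf_cont (hm : ∀ᵐ y ∂m, y ≠ 0 ∧ |y| ≤ 1) (σ : ℝ) : Continuous (lowf m σ) := by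
  have := Om_cont m hm; have := cg_cont σ
  unfold lowf; fun_prop

lemma gam_cont (σ : ℝ) (hσ : 0 < σ) : ContinuousOn (gam σ) (Ioi 0) := by
  have := cg_cont σ
  unfold gam
  refine ContinuousOn.mul (by fun_prop) (ContinuousOn.sub (ContinuousOn.add (by fun_prop) ?_) ?_)
  · refine ContinuousOn.div (by fun_prop) (by fun_prop) fun x hx => ?_
    have : (0:ℝ) < x := hx
    positivity
  · refine ContinuousOn.div (by fun_prop) (by fun_prop) fun x hx => ?_
    have : (0:ℝ) < x := hx
    positivity

lemma highf_cont (hm : ∀ᵐ y ∂m, y ≠ 0 ∧ |y| ≤ 1) (σ : ℝ) (hσ : 0 < σ) : ContinuousOn (highf m σ) (Ioi 0) := by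
  have h1 := Om_cont m hm
  unfold highf FF
  refine ContinuousOn.add ?_ ((gam_cont σ hσ).mul (by fun_prop))
  refine ContinuousOn.div (by fun_prop) (by fun_prop) fun x hx => ?_
  have : (0:ℝ) < x := hx
  positivity

lemma Kf_cont (hP4 : Integrable (fun x => x ^ 4) P) (v : ℝ≥0) (s : ℝ) : Continuous (Kf P (gaussianReal 0 v) s) := by
  obtain ⟨f1, f2, f3, f4⟩ := dcdf_facts P (gaussianReal 0 v) hP4 (gauss_int4 _)
  have c1 : Continuous (ft (fun x => (dcdf P (gaussianReal 0 v) x : ℂ))) :=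
    continuous_iff_continuousAt.2 fun u => (ft_hasDerivAt _ f1 f3 u).continuousAt
  have c2 : Continuous (ft (fun x : ℝ => (x : ℂ) * (dcdf P (gaussianReal 0 v) x : ℂ))) := by
    have e : ft (fun x : ℝ => (x : ℂ) * (dcdf P (gaussianReal 0 v) x : ℂ)) =
       fun u => 𝓕 (fun x : ℝ => (x : ℂ) * (dcdf P (gaussianReal 0 v) x : ℂ)) (-u / (2 * Real.pi)) := by
      ext u; exact ft_eq _ u
    rw [e]
    have : Continuous (𝓕 (fun x : ℝ => (x : ℂ) * (dcdf P (gaussianReal 0 v) x : ℂ))) :=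
      VectorFourier.fourierIntegral_continuous Real.continuous_fourierChar (L := innerₗ ℝ) continuous_inner f3
    fun_prop
  unfold Kf
  fun_prop

lemma int_piece (hm : ∀ᵐ y ∂m, y ≠ 0 ∧ |y| ≤ 1) (hP : ∀ u, charFn P u = Complex.exp (Psi m u))
    (hP4 : Integrable (fun x => x ^ 4) P)
    (σ : ℝ) (hσ : 0 < σ) (ha : m.real univ = σ ^ 2) (h : ℝ → ℝ) (hh : ContinuousOn h (Ioi 0))
    (hb : ∀ u, 0 < u → brack m σ u ≤ h u) (η M : ℝ) (hη : 0 < η) (hM : η ≤ M) :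
    ∫ u in η..M, Kf P (gaussianReal 0 (Real.toNNReal (σ ^ 2))) (√2 * σ) u ≤
      Bf m σ M - Bf m σ η + ∫ u in η..M, h u := by
  have hsub : Icc η M ⊆ Ioi 0 := fun x hx => lt_of_lt_of_le hη hx.1
  have hKc := Kf_cont P hP4 (Real.toNNReal (σ ^ 2)) (√2 * σ)
  have hhc : ContinuousOn h (Icc η M) := hh.mono hsub
  have := intervalIntegral.integral_le_sub_of_hasDeriv_right_of_le (g := Bf m σ) (g' := deriv (Bf m σ))
    (φ := fun u => Kf P (gaussianReal 0 (Real.toNNReal (σ ^ 2))) (√2 * σ) u - h u) hM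
    (fun u hu => by
      obtain ⟨B', hB, _⟩ := K_bound m P hm hP hP4 σ hσ ha u (hsub hu)
      exact hB.continuousAt.continuousWithinAt)
    (fun u hu => by
      obtain ⟨B', hB, _⟩ := K_bound m P hm hP hP4 σ hσ ha u (hsub (Ioo_subset_Icc_self hu))
      rw [hB.deriv]; exact hB.hasDerivWithinAt)
    ((hKc.continuousOn.sub hhc).integrableOn_compact isCompact_Icc)
    (fun u hu => by
      obtain ⟨B', hB, hle⟩ := K_bound m P hm hP hP4 σ hσ ha u (hsub (Ioo_subset_Icc_self hu))
      have := hb u (hsub (Ioo_subset_Icc_self hu))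
      unfold brack at this
      rw [hB.deriv]; linarith)
  rw [intervalIntegral.integral_sub (hKc.intervalIntegrable _ _) (hhc.intervalIntegrable_of_Icc hM)] at this
  linarith

lemma cg_le_one (σ u : ℝ) : cg σ u ≤ 1 := by
  unfold cg; rw [Real.exp_le_one_iff]; nlinarith [mul_nonneg (sq_nonneg σ) (sq_nonneg u)]

lemma B_top (σ M : ℝ) (hσ : 0 < σ) (hM : 0 < M) : Bf m σ M ≤ 2 * σ ^ 2 / (√2 * σ) / M := by
  have h1 := XY_norm m M σ
  have h2 : Real.exp (-Om m M) ≤ 1 := by rw [Real.exp_le_one_iff]; linarith [Om_nonneg m M]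
  have h3 : 0 < Real.exp (-Om m M) := Real.exp_pos _
  have hc := cg_le_one σ M
  have hc0 := cg_pos σ M
  have hX : Xr m σ M ≤ 1 := by
    have : (Xr m σ M + cg σ M) ^ 2 ≤ 1 ^ 2 := by nlinarith [sq_nonneg (Yr m M)]
    have := (abs_le_of_sq_le_sq' this (by norm_num)).2
    linarith
  unfold Bf
  have k1 : 0 ≤ (Xr m σ M ^ 2 + Yr m M ^ 2) / (√2 * σ * M ^ 3) := by positivity
  have k2 : 2 * σ ^ 2 * cg σ M * Xr m σ M / (√2 * σ * M) ≤ 2 * σ ^ 2 / (√2 * σ) / M := by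
    rw [div_div]
    have : cg σ M * Xr m σ M ≤ 1 := by nlinarith
    apply div_le_div_of_nonneg_right _ (by positivity)
    nlinarith [sq_nonneg σ]
  rw [neg_div]; linarith

lemma B_bot (σ η : ℝ) (hσ : 0 < σ) (ha : m.real univ = σ ^ 2) (hη : 0 < η) (hη1 : σ ^ 2 * η ^ 2 ≤ 1) :
    -Bf m σ η ≤ 10 * σ ^ 4 / (√2 * σ) * η := by
  have b := Psi_bound m η
  rw [ha] at b
  have h1 : ‖Complex.exp (Psi m η) - 1‖ ≤ σ ^ 2 * η ^ 2 := by
    have := Complex.norm_exp_sub_one_le (x := Psi m η) (by linarith)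
    linarith
  have hc : 1 - cg σ η ≤ σ ^ 2 * η ^ 2 := by
    unfold cg
    have := Real.add_one_le_exp (-(σ ^ 2 * η ^ 2) / 2)
    nlinarith [mul_nonneg (sq_nonneg σ) (sq_nonneg η)]
  have hc1 := cg_le_one σ η
  have hc0 := cg_pos σ η
  have hre := abs_le.1 ((Complex.abs_re_le_norm _).trans h1)
  have him := abs_le.1 ((Complex.abs_im_le_norm _).trans h1)
  simp only [Complex.sub_re, Complex.one_re, Complex.sub_im, Complex.one_im, sub_zero] at hre him
  have hY2 : Yr m η ^ 2 ≤ (σ ^ 2 * η ^ 2) ^ 2 := by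
    unfold Yr; exact sq_le_sq' him.1 him.2
  have hX : |Xr m σ η| ≤ 2 * (σ ^ 2 * η ^ 2) := by
    unfold Xr; rw [abs_le]; constructor <;> linarith [hre.1, hre.2]
  have hX2 : Xr m σ η ^ 2 ≤ (2 * (σ ^ 2 * η ^ 2)) ^ 2 := sq_le_sq' (abs_le.1 hX).1 (abs_le.1 hX).2
  unfold Bf
  have k1 : (Xr m σ η ^ 2 + Yr m η ^ 2) / (√2 * σ * η ^ 3) ≤ 5 * σ ^ 4 / (√2 * σ) * η := by
    rw [div_le_iff₀ (by positivity)]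
    have : 5 * σ ^ 4 / (√2 * σ) * η * (√2 * σ * η ^ 3) = 5 * (σ ^ 2 * η ^ 2) ^ 2 := by field_simp
    rw [this]; nlinarith
  have k2 : -(4 * σ ^ 4 / (√2 * σ) * η) ≤ 2 * σ ^ 2 * cg σ η * Xr m σ η / (√2 * σ * η) := by
    rw [le_div_iff₀ (by positivity)]
    have : -(4 * σ ^ 4 / (√2 * σ) * η) * (√2 * σ * η) = - (2 * σ ^ 2 * (2 * (σ ^ 2 * η ^ 2))) := by field_simp; ring
    rw [this, mul_assoc (2 * σ ^ 2), ← mul_neg]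
    apply mul_le_mul_of_nonneg_left _ (by positivity)
    nlinarith [(abs_le.1 hX).1, abs_nonneg (Xr m σ η), neg_abs_le (Xr m σ η)]
  have k3 : 0 ≤ σ ^ 4 / (√2 * σ) * η := by positivity
  rw [neg_div]
  have e1 : 10 * σ ^ 4 / (√2 * σ) * η = 10 * (σ ^ 4 / (√2 * σ) * η) := by ring
  have e2 : 5 * σ ^ 4 / (√2 * σ) * η = 5 * (σ ^ 4 / (√2 * σ) * η) := by ring
  have e3 : 4 * σ ^ 4 / (√2 * σ) * η = 4 * (σ ^ 4 / (√2 * σ) * η) := by ring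
  rw [e1]; rw [e2] at k1; rw [e3] at k2; linarith

lemma K_total (hm : ∀ᵐ y ∂m, y ≠ 0 ∧ |y| ≤ 1) (hP : ∀ u, charFn P u = Complex.exp (Psi m u))
    (hP4 : Integrable (fun x => x ^ 4) P)
    (σ : ℝ) (hσ : 0 < σ) (ha : m.real univ = σ ^ 2) (QL QH : ℝ)
    (hL : ∀ η, 0 < η → η ≤ Real.pi → ∫ u in η..Real.pi, lowf m σ u ≤ QL)
    (hH : ∀ M, Real.pi ≤ M → ∫ u in Real.pi..M, highf m σ u ≤ QH) :
    ∫⁻ u in Ioi 0, ENNReal.ofReal (Kf P (gaussianReal 0 (Real.toNNReal (σ ^ 2))) (√2 * σ) u) ≤ ENNReal.ofReal (QL + QH) := by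
  set K := Kf P (gaussianReal 0 (Real.toNNReal (σ ^ 2))) (√2 * σ) with hK
  have hKc : Continuous K := Kf_cont P hP4 _ _
  have hK0 : ∀ u, 0 ≤ K u := fun u => by rw [hK]; unfold Kf; positivity
  have hpi := Real.pi_pos
  have hpi3 := Real.pi_gt_three
  have hpi4 := Real.pi_le_four
  have ta : Tendsto (fun n : ℕ => 1 / ((n : ℝ) + 1)) atTop (𝓝 0) := tendsto_one_div_add_atTop_nhds_zero_nat
  have tb : Tendsto (fun n : ℕ => ((n : ℝ) + 4)) atTop atTop :=
    tendsto_atTop_add_const_right _ _ tendsto_natCast_atTop_atTop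
  have cov := (aecover_Ioi_of_Ioi (μ := volume) ta).inter ((aecover_Iic (μ := volume) tb).restrict (s := Ioi 0))
  have lim := cov.lintegral_tendsto_of_countably_generated (f := fun u => ENNReal.ofReal (K u)) (by fun_prop)
  have lim2 : Tendsto (fun n : ℕ => ENNReal.ofReal (QL + QH + 2 * σ ^ 2 / (√2 * σ) / ((n:ℝ) + 4) + 10 * σ ^ 4 / (√2 * σ) * (1 / ((n : ℝ) + 1))))
      atTop (𝓝 (ENNReal.ofReal (QL + QH))) := by
    apply ENNReal.tendsto_ofReal
    have := ((tb.const_div_atTop (2 * σ ^ 2 / (√2 * σ))).const_add (QL + QH)).add (ta.const_mul (10 * σ ^ 4 / (√2 * σ)))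
    simpa using this
  refine le_of_tendsto_of_tendsto lim lim2 ?_
  filter_upwards [hsmall_ev (σ ^ 2)] with n hn
  have hset : Ioi (1 / ((n:ℝ) + 1)) ∩ Iic ((n:ℝ) + 4) = Ioc (1 / ((n:ℝ) + 1)) ((n:ℝ) + 4) := rfl
  set η := 1 / ((n:ℝ) + 1) with hη
  have hη0 : 0 < η := by positivity
  have hη1 : η ≤ 1 := by rw [hη, div_le_one (by positivity)]; linarith [n.cast_nonneg (α := ℝ)]
  set M := (n:ℝ) + 4 with hM
  have hM4 : 4 ≤ M := by rw [hM]; linarith [n.cast_nonneg (α := ℝ)]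
  have hss : Ioc η M ∩ Ioi 0 = Ioc η M := inter_eq_left.2 (fun x hx => (hη0.trans hx.1 : (0:ℝ) < x))
  rw [hset, Measure.restrict_restrict measurableSet_Ioc, hss,
    ← ofReal_integral_eq_lintegral_ofReal ((hKc.continuousOn.integrableOn_compact isCompact_Icc).mono_set Ioc_subset_Icc_self)
    (ae_of_all _ hK0), ← intervalIntegral.integral_of_le (by linarith)]
  apply ENNReal.ofReal_le_ofReal
  rw [← intervalIntegral.integral_add_adjacent_intervals (hKc.intervalIntegrable η Real.pi) (hKc.intervalIntegrable Real.pi M)]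
  have i1 := int_piece m P hm hP hP4 σ hσ ha (lowf m σ) (lowf_cont m hm σ).continuousOn (fun u hu => brack_low m σ u hσ hu) η Real.pi hη0 (by linarith)
  have i2 := int_piece m P hm hP hP4 σ hσ ha (highf m σ) (highf_cont m hm σ hσ) (fun u hu => brack_high m σ u hσ hu) Real.pi M hpi (by linarith)
  have i3 := hL η hη0 (by linarith)
  have i4 := hH M (by linarith)
  have i5 := B_top m σ M hσ (by linarith)
  have i6 := B_bot m σ η hσ ha hη0 (by nlinarith [sq_nonneg σ])
  rw [← hK] at i1 i2
  linarith
end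
end

section
open MeasureTheory ProbabilityTheory Set Filter Topology
open scoped ENNReal NNReal

lemma one_sub_cos_eq (x : ℝ) : 1 - Real.cos x = 2 * Real.sin (x / 2) ^ 2 := by
  have h : Real.cos x = Real.cos (2 * (x / 2)) := by congr 1; ring
  rw [h, Real.cos_two_mul]; nlinarith [Real.sin_sq_add_cos_sq (x / 2)]

lemma cos_conc_nonneg (u y : ℝ) (hu0 : 0 ≤ u) (hu : u ≤ 2 * Real.pi) (hy : 0 < y) (hy1 : y ≤ 1) :
    1 - Real.cos u ≤ (1 - Real.cos (u * y)) / y ^ 2 := by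
  rw [le_div_iff₀ (by positivity), one_sub_cos_eq, one_sub_cos_eq]
  have hpi := Real.pi_pos
  have h := strictConcaveOn_sin_Icc.concaveOn.2 (x := u / 2) (y := 0) ⟨by linarith, by linarith⟩ ⟨le_refl _, hpi.le⟩
    hy.le (sub_nonneg.2 hy1) (by ring)
  simp only [smul_eq_mul, Real.sin_zero, mul_zero, add_zero] at h
  have h0 : 0 ≤ Real.sin (u / 2) := Real.sin_nonneg_of_nonneg_of_le_pi (by linarith) (by linarith)
  rw [show y * (u / 2) = u * y / 2 by ring] at h
  have : (y * Real.sin (u / 2)) ^ 2 ≤ Real.sin (u * y / 2) ^ 2 := pow_le_pow_left₀ (by positivity) h 2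
  nlinarith

lemma cos_conc (u y : ℝ) (hu0 : 0 ≤ u) (hu : u ≤ 2 * Real.pi) (hy : y ≠ 0) (hy1 : |y| ≤ 1) :
    1 - Real.cos u ≤ (1 - Real.cos (u * y)) / y ^ 2 := by
  have := cos_conc_nonneg u |y| hu0 hu (abs_pos.2 hy) hy1
  rw [sq_abs] at this
  have e : Real.cos (u * |y|) = Real.cos (u * y) := by
    rcases abs_choice y with h | h <;> rw [h]
    rw [mul_neg, Real.cos_neg]
  rwa [e] at this

noncomputable def QLf (σ : ℝ) : ℝ :=
  √2 * σ ^ 3 * ∫ u in (0:ℝ)..Real.pi, (Real.exp (-(σ ^ 2 * (1 - Real.cos u))) ^ 2 - cg σ u ^ 2)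

section
variable (m : Measure ℝ) [IsFiniteMeasure m]

lemma Om_ge (hm : ∀ᵐ y ∂m, y ≠ 0 ∧ |y| ≤ 1) (u : ℝ) (hu0 : 0 ≤ u) (hu : u ≤ 2 * Real.pi) :
    m.real univ * (1 - Real.cos u) ≤ Om m u := by
  unfold Om
  have : m.real univ * (1 - Real.cos u) = ∫ y, (1 - Real.cos u) ∂m := by simp
  rw [this]
  apply integral_mono_ae (integrable_const _) (Om_int m u)
  filter_upwards [hm] with y hy
  exact cos_conc u y hu0 hu hy.1 hy.2

lemma low_bound (hm : ∀ᵐ y ∂m, y ≠ 0 ∧ |y| ≤ 1) (σ : ℝ) (hσ : 0 < σ) (ha : m.real univ = σ ^ 2)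
    (η : ℝ) (hη : 0 < η) (hη1 : η ≤ Real.pi) : ∫ u in η..Real.pi, lowf m σ u ≤ QLf σ := by
  have hpi := Real.pi_pos
  set g : ℝ → ℝ := fun u => √2 * σ ^ 3 * (Real.exp (-(σ ^ 2 * (1 - Real.cos u))) ^ 2 - cg σ u ^ 2) with hg
  have hc := cg_cont σ
  have hgc : Continuous g := by rw [hg]; fun_prop
  have h1 : ∫ u in η..Real.pi, lowf m σ u ≤ ∫ u in η..Real.pi, g u := by
    apply intervalIntegral.integral_mono_on hη1 ((lowf_cont m hm σ).intervalIntegrable _ _) (hgc.intervalIntegrable _ _)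
    intro u hu
    simp only [hg, lowf]
    have := Om_ge m hm u (by linarith [hu.1]) (by linarith [hu.2])
    rw [ha] at this
    gcongr
  have h2 : ∫ u in η..Real.pi, g u ≤ ∫ u in (0:ℝ)..Real.pi, g u := by
    apply intervalIntegral.integral_mono_interval hη.le hη1 le_rfl _ (hgc.intervalIntegrable _ _)
    refine ae_of_all _ fun u => ?_
    simp only [hg, Pi.zero_apply]
    apply mul_nonneg (by positivity)
    rw [sub_nonneg]
    apply pow_le_pow_left₀ (cg_pos _ _).le
    unfold cg
    apply Real.exp_le_exp.2
    nlinarith [Real.one_sub_sq_div_two_le_cos (x := u), sq_nonneg σ]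
  have h3 : ∫ u in (0:ℝ)..Real.pi, g u = QLf σ := by
    rw [hg, intervalIntegral.integral_const_mul]; rfl
  linarith
end
end

section
open MeasureTheory ProbabilityTheory Set Filter Topology
open scoped ENNReal NNReal

lemma cheb (L : ℝ) (hL : 0 < L) (h b : ℝ → ℝ) (hh : AntitoneOn h (Icc 0 L)) (hb : MonotoneOn b (Icc 0 L))
    (hhc : Continuous h) (hbc : ContinuousOn b (Icc 0 L)) :
    ∫ d in (0:ℝ)..L, h d * b d ≤ (1 / L * ∫ d in (0:ℝ)..L, h d) * ∫ d in (0:ℝ)..L, b d := by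
  have hi : IntervalIntegrable h volume 0 L := hhc.intervalIntegrable _ _
  have bi : IntervalIntegrable b volume 0 L := hbc.intervalIntegrable_of_Icc hL.le
  have hbi : IntervalIntegrable (fun d => h d * b d) volume 0 L :=
    (hhc.continuousOn.mul hbc).intervalIntegrable_of_Icc hL.le
  set H := ∫ d in (0:ℝ)..L, h d with hH
  set B := ∫ d in (0:ℝ)..L, b d with hB
  set HB := ∫ d in (0:ℝ)..L, h d * b d with hHB
  have key : ∀ d ∈ Icc 0 L, ∀ d' ∈ Icc 0 L, h d * b d + h d' * b d' - h d' * b d - b d' * h d ≤ 0 := by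
    intro d hd d' hd'
    rcases le_total d d' with hl | hl
    · nlinarith [hh hd hd' hl, hb hd hd' hl]
    · nlinarith [hh hd' hd hl, hb hd' hd hl]
  have k1 : ∀ d' ∈ Icc 0 L, HB + L * (h d' * b d') - h d' * B - b d' * H ≤ 0 := by
    intro d' hd'
    have e : ∫ d in (0:ℝ)..L, (h d * b d + h d' * b d' - h d' * b d - b d' * h d) = HB + L * (h d' * b d') - h d' * B - b d' * H := by
      rw [intervalIntegral.integral_sub ((hbi.add intervalIntegrable_const).sub (bi.const_mul _)) (hi.const_mul _),
        intervalIntegral.integral_sub (hbi.add intervalIntegrable_const) (bi.const_mul _),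
        intervalIntegral.integral_add hbi intervalIntegrable_const, intervalIntegral.integral_const_mul,
        intervalIntegral.integral_const_mul, intervalIntegral.integral_const]
      simp; rw [← hH, ← hB, ← hHB]; ring
    rw [← e]
    have := intervalIntegral.integral_mono_on hL.le (((hbi.add intervalIntegrable_const).sub (bi.const_mul _)).sub (hi.const_mul _))
      (intervalIntegrable_const (c := (0:ℝ))) (fun d hd => key d hd d' hd')
    simpa using this
  have k2 : ∫ d' in (0:ℝ)..L, (HB + L * (h d' * b d') - B * h d' - H * b d') = L * HB + L * HB - B * H - H * B := by
    rw [intervalIntegral.integral_sub ((intervalIntegrable_const.add (hbi.const_mul _)).sub (hi.const_mul _)) (bi.const_mul _),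
        intervalIntegral.integral_sub (intervalIntegrable_const.add (hbi.const_mul _)) (hi.const_mul _),
        intervalIntegral.integral_add intervalIntegrable_const (hbi.const_mul _), intervalIntegral.integral_const_mul,
        intervalIntegral.integral_const_mul, intervalIntegral.integral_const_mul, intervalIntegral.integral_const, ← hH, ← hB, ← hHB]
    simp
  have k3 := intervalIntegral.integral_mono_on hL.le (((intervalIntegrable_const.add (hbi.const_mul _)).sub (hi.const_mul _)).sub (bi.const_mul _))
      (intervalIntegrable_const (c := (0:ℝ))) (fun d' hd' => by have := k1 d' hd'; linarith : ∀ d' ∈ Icc 0 L, HB + L * (h d' * b d') - B * h d' - H * b d' ≤ 0)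
  rw [k2] at k3
  simp at k3
  rw [show 1 / L * H * B = (H * B) / L by ring, le_div_iff₀ hL]
  linarith

lemma int_inv_sq (x y : ℝ) (hx : 0 < x) (hxy : x ≤ y) : ∫ r in x..y, 1 / r ^ 2 = 1 / x - 1 / y := by
  have : ∫ r in x..y, 1 / r ^ 2 = -(1 / y) - -(1 / x) := by
    apply intervalIntegral.integral_eq_sub_of_hasDerivAt (f := fun r => -(1 / r))
    · intro r hr
      rw [uIcc_of_le hxy] at hr
      have hr0 : r ≠ 0 := by linarith [hr.1]
      have := (hasDerivAt_inv hr0).neg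
      have e : (fun r : ℝ => -(1 / r)) = -fun y => y⁻¹ := by ext; simp
      rw [e]
      simpa using this
    · apply ContinuousOn.intervalIntegrable
      rw [uIcc_of_le hxy]
      refine ContinuousOn.div (by fun_prop) (by fun_prop) fun r hr => ?_
      have hr0 : 0 < r := by linarith [hr.1]
      positivity
  rw [this]; ring

section

lemma period_step (h : ℝ → ℝ) (hhc : Continuous h) (hper : Function.Periodic h (2 * Real.pi)) (hev : ∀ x, h (-x) = h x)
    (hanti : AntitoneOn h (Icc 0 Real.pi)) (k : ℕ) (hk : 1 ≤ k) :
    ∫ r in ((2 * (k:ℝ) - 1) * Real.pi)..((2 * (k:ℝ) + 1) * Real.pi), h r / r ^ 2 ≤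
      (1 / Real.pi * ∫ d in (0:ℝ)..Real.pi, h d) * (1 / ((2 * (k:ℝ) - 1) * Real.pi) - 1 / ((2 * (k:ℝ) + 1) * Real.pi)) := by
  have hpi := Real.pi_pos
  have hk' : (1:ℝ) ≤ k := by exact_mod_cast hk
  set c := 2 * (k:ℝ) * Real.pi with hc
  have hcpi : Real.pi < c := by nlinarith
  have hhk : ∀ d, h (c + d) = h d := fun d => by
    have := hper.nat_mul k d
    rw [← this]; congr 1; rw [hc]; ring
  have hhk' : ∀ d, h (c - d) = h d := fun d => by
    rw [sub_eq_add_neg, hhk, hev]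
  have hcont : ContinuousOn (fun r => h r / r ^ 2) (Ioi 0) :=
    ContinuousOn.div (by fun_prop) (by fun_prop) fun r hr => by have : (0:ℝ) < r := hr; positivity
  have hcont1 : ContinuousOn (fun r : ℝ => 1 / r ^ 2) (Ioi 0) :=
    ContinuousOn.div (by fun_prop) (by fun_prop) fun r hr => by have : (0:ℝ) < r := hr; positivity
  have ii : ∀ f : ℝ → ℝ, ContinuousOn f (Ioi 0) → ∀ x y, 0 < x → x ≤ y → IntervalIntegrable f volume x y := fun f hf x y hx hxy =>
    (hf.mono (fun r hr => lt_of_lt_of_le hx hr.1)).intervalIntegrable_of_Icc hxy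
  set b : ℝ → ℝ := fun d => 1 / (c + d) ^ 2 + 1 / (c - d) ^ 2 with hb
  have split : ∀ f : ℝ → ℝ, ContinuousOn f (Ioi 0) →
      ∫ r in (c - Real.pi)..(c + Real.pi), f r = ∫ d in (0:ℝ)..Real.pi, (f (c + d) + f (c - d)) := by
    intro f hf
    rw [intervalIntegral.integral_add]
    · rw [intervalIntegral.integral_comp_add_left (fun d => f d), intervalIntegral.integral_comp_sub_left (fun d => f d), add_zero, sub_zero,
        add_comm (∫ x in c..(c + Real.pi), f x), intervalIntegral.integral_add_adjacent_intervals (ii f hf _ _ (by linarith) (by linarith)) (ii f hf _ _ (by linarith) (by linarith))]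
    · apply ContinuousOn.intervalIntegrable_of_Icc hpi.le
      exact hf.comp (by fun_prop) fun d hd => by have := hd.1; simp only [mem_Ioi]; linarith
    · apply ContinuousOn.intervalIntegrable_of_Icc hpi.le
      exact hf.comp (by fun_prop) fun d hd => by have := hd.2; simp only [mem_Ioi]; linarith
  have e1 : (2 * (k:ℝ) - 1) * Real.pi = c - Real.pi := by rw [hc]; ring
  have e2 : (2 * (k:ℝ) + 1) * Real.pi = c + Real.pi := by rw [hc]; ring
  rw [e1, e2, ← int_inv_sq _ _ (by linarith) (by linarith), split _ hcont, split _ hcont1]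
  have hbc : ContinuousOn b (Icc 0 Real.pi) := by
    rw [hb]
    refine ContinuousOn.add (ContinuousOn.div (by fun_prop) (by fun_prop) fun d hd => ?_) (ContinuousOn.div (by fun_prop) (by fun_prop) fun d hd => ?_)
    · have : 0 < c + d := by linarith [hd.1]
      positivity
    · have : 0 < c - d := by linarith [hd.2]
      positivity
  have hbm : MonotoneOn b (Icc 0 Real.pi) := by
    apply monotoneOn_of_deriv_nonneg (convex_Icc _ _) hbc
    all_goals
      have hd : ∀ d ∈ interior (Icc 0 Real.pi), HasDerivAt b (-2 / (c + d) ^ 3 + 2 / (c - d) ^ 3) d := by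
        intro d hd
        rw [interior_Icc] at hd
        have p1 : c + d ≠ 0 := by linarith [hd.1]
        have p2 : c - d ≠ 0 := by linarith [hd.2]
        have q1 := (((hasDerivAt_id d).const_add c).pow 2).inv (by simpa using p1)
        have q2 := (((hasDerivAt_id d).const_sub c).pow 2).inv (by simpa using p2)
        have q3 := q1.add q2
        have e : b = ((fun x => c + id x) ^ 2)⁻¹ + ((fun x => c - id x) ^ 2)⁻¹ := by
          ext x; simp [hb]
        rw [e]
        refine q3.congr_deriv ?_
        simp only [id, Pi.pow_apply]
        field_simp
        norm_num
        ring
    · intro d hd'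
      exact (hd d hd').differentiableAt.differentiableWithinAt
    · intro d hd'
      rw [(hd d hd').deriv]
      rw [interior_Icc] at hd'
      have p2 : 0 < c - d := by linarith [hd'.2]
      have p3 : c - d ≤ c + d := by linarith [hd'.1]
      have : 2 / (c + d) ^ 3 ≤ 2 / (c - d) ^ 3 := by gcongr
      rw [neg_div]; linarith
  have := cheb Real.pi hpi h b hanti hbm hhc hbc
  refine le_trans (le_of_eq ?_) this
  congr 1; ext d
  rw [hhk, hhk', hb]; ring

lemma period_sum (h : ℝ → ℝ) (hhc : Continuous h) (hper : Function.Periodic h (2 * Real.pi)) (hev : ∀ x, h (-x) = h x)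
    (hanti : AntitoneOn h (Icc 0 Real.pi)) (N : ℕ) :
    ∫ r in Real.pi..((2 * (N:ℝ) + 1) * Real.pi), h r / r ^ 2 ≤
      (1 / Real.pi * ∫ d in (0:ℝ)..Real.pi, h d) * (1 / Real.pi - 1 / ((2 * (N:ℝ) + 1) * Real.pi)) := by
  have hpi := Real.pi_pos
  have hcont : ContinuousOn (fun r => h r / r ^ 2) (Ioi 0) :=
    ContinuousOn.div (by fun_prop) (by fun_prop) fun r hr => by have : (0:ℝ) < r := hr; positivity
  have ii : ∀ x y, 0 < x → x ≤ y → IntervalIntegrable (fun r => h r / r ^ 2) volume x y := fun x y hx hxy =>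
    (hcont.mono (fun r hr => lt_of_lt_of_le hx hr.1)).intervalIntegrable_of_Icc hxy
  induction N with
  | zero => simp
  | succ n ih =>
    have st := period_step h hhc hper hev hanti (n + 1) (by omega)
    have e : (2 * ((n + 1 : ℕ):ℝ) - 1) * Real.pi = (2 * (n:ℝ) + 1) * Real.pi := by push_cast; ring
    have hn : (0:ℝ) ≤ n := n.cast_nonneg
    rw [e] at st
    rw [← intervalIntegral.integral_add_adjacent_intervals (ii Real.pi ((2 * (n:ℝ) + 1) * Real.pi) hpi (by nlinarith))
      (ii _ _ (by positivity) (by push_cast; nlinarith))]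
    linarith

lemma period_bd (h : ℝ → ℝ) (hhc : Continuous h) (hper : Function.Periodic h (2 * Real.pi)) (hev : ∀ x, h (-x) = h x)
    (hanti : AntitoneOn h (Icc 0 Real.pi)) (h0 : ∀ x, 0 ≤ h x) (X : ℝ) (hX : Real.pi ≤ X) :
    ∫ r in Real.pi..X, h r / r ^ 2 ≤ 1 / Real.pi ^ 2 * ∫ d in (0:ℝ)..Real.pi, h d := by
  have hpi := Real.pi_pos
  obtain ⟨N, hN⟩ := exists_nat_gt X
  have hcont : ContinuousOn (fun r => h r / r ^ 2) (Ioi 0) :=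
    ContinuousOn.div (by fun_prop) (by fun_prop) fun r hr => by have : (0:ℝ) < r := hr; positivity
  have ii : ∀ x y, 0 < x → x ≤ y → IntervalIntegrable (fun r => h r / r ^ 2) volume x y := fun x y hx hxy =>
    (hcont.mono (fun r hr => lt_of_lt_of_le hx hr.1)).intervalIntegrable_of_Icc hxy
  have hXN : X ≤ (2 * (N:ℝ) + 1) * Real.pi := by nlinarith [Real.pi_gt_three]
  have h1 : ∫ r in Real.pi..X, h r / r ^ 2 ≤ ∫ r in Real.pi..((2 * (N:ℝ) + 1) * Real.pi), h r / r ^ 2 := by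
    apply intervalIntegral.integral_mono_interval le_rfl hX hXN _ (ii _ _ hpi (by linarith))
    exact ae_of_all _ fun r => div_nonneg (h0 r) (by positivity)
  have h2 := period_sum h hhc hper hev hanti N
  have hH : 0 ≤ ∫ d in (0:ℝ)..Real.pi, h d := intervalIntegral.integral_nonneg hpi.le fun d _ => h0 d
  have h3 : 0 ≤ (1 / Real.pi * ∫ d in (0:ℝ)..Real.pi, h d) * (1 / ((2 * (N:ℝ) + 1) * Real.pi)) := by positivity
  have h4 : 1 / Real.pi ^ 2 * ∫ d in (0:ℝ)..Real.pi, h d = (1 / Real.pi * ∫ d in (0:ℝ)..Real.pi, h d) * (1 / Real.pi) := by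
    field_simp
  rw [h4]
  linarith
end
end

section
open MeasureTheory ProbabilityTheory Set Filter Topology
open scoped ENNReal NNReal

lemma FF_hasDeriv (σ w : ℝ) : HasDerivAt (FF σ) (√2 * σ * (-(1 + 2 * w) * Real.exp (-w) ^ 2)) w := by
  unfold FF
  have h1 : HasDerivAt (fun w : ℝ => Real.exp (-w)) (-Real.exp (-w)) w := by
    simpa using (hasDerivAt_neg w).exp
  have h2 := (((hasDerivAt_id w).const_add 1).mul (h1.pow 2)).const_mul (√2 * σ)
  refine h2.congr_deriv ?_
  simp only [id, Pi.pow_apply, Pi.neg_apply]; push_cast; ring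

lemma FF_hasDeriv2 (σ w : ℝ) : HasDerivAt (fun w => √2 * σ * (-(1 + 2 * w) * Real.exp (-w) ^ 2)) (√2 * σ * (4 * w * Real.exp (-w) ^ 2)) w := by
  have h1 : HasDerivAt (fun w : ℝ => Real.exp (-w)) (-Real.exp (-w)) w := by
    simpa using (hasDerivAt_neg w).exp
  have h2 := (((((hasDerivAt_id w).const_mul 2).const_add 1).neg).mul (h1.pow 2)).const_mul (√2 * σ)
  refine h2.congr_deriv ?_
  simp only [id, Pi.pow_apply, Pi.neg_apply]; push_cast; ring

lemma FF_cont (σ : ℝ) : Continuous (FF σ) := by unfold FF; fun_prop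

lemma FF_anti (σ : ℝ) (hσ : 0 < σ) : AntitoneOn (FF σ) (Ici 0) := by
  apply antitoneOn_of_deriv_nonpos (convex_Ici 0) (FF_cont σ).continuousOn
  · intro w _; exact (FF_hasDeriv σ w).differentiableAt.differentiableWithinAt
  · intro w hw
    rw [interior_Ici] at hw
    have hw' : 0 < w := hw
    rw [(FF_hasDeriv σ w).deriv]
    have : 0 ≤ √2 * σ * ((1 + 2 * w) * Real.exp (-w) ^ 2) := by positivity
    linarith

lemma FF_convex (σ : ℝ) (hσ : 0 < σ) : ConvexOn ℝ (Ici 0) (FF σ) := by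
  have e : deriv (FF σ) = fun w => √2 * σ * (-(1 + 2 * w) * Real.exp (-w) ^ 2) := by
    ext w; exact (FF_hasDeriv σ w).deriv
  apply convexOn_of_deriv2_nonneg (convex_Ici 0) (FF_cont σ).continuousOn
  · intro w _; exact (FF_hasDeriv σ w).differentiableAt.differentiableWithinAt
  · intro w _; rw [e]; exact (FF_hasDeriv2 σ w).differentiableAt.differentiableWithinAt
  · intro w hw
    rw [interior_Ici] at hw
    have hw' : 0 < w := hw
    simp only [Function.iterate_succ, Function.iterate_zero, Function.comp_apply, id]
    rw [e, (FF_hasDeriv2 σ w).deriv]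
    positivity

lemma FF_nonneg (σ w : ℝ) (hσ : 0 < σ) (hw : 0 ≤ w) : 0 ≤ FF σ w := by unfold FF; positivity

lemma FF_zero_le (σ w : ℝ) (hσ : 0 < σ) (hw : 0 ≤ w) : FF σ w ≤ √2 * σ := by
  have := FF_anti σ hσ (mem_Ici.2 le_rfl) (mem_Ici.2 hw) hw
  simpa [FF] using this

noncomputable def hh (σ d : ℝ) : ℝ := FF σ (σ ^ 2 * (1 - Real.cos d))

lemma hh_arg (σ d : ℝ) : 0 ≤ σ ^ 2 * (1 - Real.cos d) :=
  mul_nonneg (sq_nonneg _) (by linarith [Real.cos_le_one d])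

noncomputable def QJ (σ : ℝ) : ℝ := 1 / Real.pi ^ 2 * ∫ d in (0:ℝ)..Real.pi, hh σ d

noncomputable def wy (y u : ℝ) : ℝ := (1 - Real.cos (u * y)) / y ^ 2
lemma wy_nonneg (y u : ℝ) : 0 ≤ wy y u := div_nonneg (by linarith [Real.cos_le_one (u * y)]) (by positivity)
lemma wy_abs (y u : ℝ) : wy |y| u = wy y u := by
  unfold wy; rw [sq_abs]
  rcases abs_choice y with h | h <;> rw [h]
  rw [mul_neg, Real.cos_neg]

lemma hh_cont (σ : ℝ) : Continuous (hh σ) := by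
  have := FF_cont σ
  unfold hh; fun_prop

lemma hh_anti (σ : ℝ) (hσ : 0 < σ) : AntitoneOn (hh σ) (Icc 0 Real.pi) := by
  intro x hx y hy hxy
  have := Real.strictAntiOn_cos.antitoneOn hx hy hxy
  exact FF_anti σ hσ (hh_arg _ _) (hh_arg _ _) (by gcongr)

lemma hh_ge (σ : ℝ) (hσ : 0 < σ) (x : ℝ) : hh σ Real.pi ≤ hh σ x := by
  refine FF_anti σ hσ (hh_arg _ _) (hh_arg _ _) ?_
  rw [Real.cos_pi]; gcongr
  linarith [Real.neg_one_le_cos x]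

lemma hh_nonneg (σ : ℝ) (hσ : 0 < σ) (x : ℝ) : 0 ≤ hh σ x := FF_nonneg σ _ hσ (hh_arg _ _)

lemma hh_per (σ : ℝ) : Function.Periodic (hh σ) (2 * Real.pi) := fun x => by unfold hh; rw [Real.cos_add_two_pi]
lemma hh_even (σ x : ℝ) : hh σ (-x) = hh σ x := by unfold hh; rw [Real.cos_neg]

lemma y_bound_pos (σ : ℝ) (hσ : 0 < σ) (y : ℝ) (hy : 0 < y) (hy1 : y ≤ 1) (M : ℝ) (hM : Real.pi ≤ M) :
    ∫ u in Real.pi..M, FF σ (σ ^ 2 * wy y u) / u ^ 2 ≤ QJ σ := by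
  have hpi := Real.pi_pos
  set f : ℝ → ℝ := fun u => FF σ (σ ^ 2 * wy y u) / u ^ 2 with hf
  have hFc := FF_cont σ
  have hhc := hh_cont σ
  have hfc : ContinuousOn f (Ioi 0) := by
    refine ContinuousOn.div (by unfold wy; fun_prop) (by fun_prop) fun r hr => ?_
    have : (0:ℝ) < r := hr
    positivity
  have ii : ∀ f : ℝ → ℝ, ContinuousOn f (Ioi 0) → ∀ x y, 0 < x → x ≤ y → IntervalIntegrable f volume x y := fun f hf x y hx hxy =>
    (hf.mono (fun r hr => lt_of_lt_of_le hx hr.1)).intervalIntegrable_of_Icc hxy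
  set X := max M (Real.pi / y) with hX
  have hpy : Real.pi ≤ Real.pi / y := by rw [le_div_iff₀ hy]; nlinarith
  have hXy : Real.pi / y ≤ X := le_max_right _ _
  have h1 : ∫ u in Real.pi..M, f u ≤ ∫ u in Real.pi..X, f u := by
    apply intervalIntegral.integral_mono_interval le_rfl hM (le_max_left _ _) _ (ii f hfc _ _ hpi (by linarith))
    refine ae_of_all _ fun r => ?_
    simp only [hf, Pi.zero_apply]
    exact div_nonneg (FF_nonneg σ _ hσ (mul_nonneg (sq_nonneg _) (wy_nonneg _ _))) (by positivity)
  rw [← intervalIntegral.integral_add_adjacent_intervals (ii f hfc _ _ hpi hpy) (ii f hfc _ _ (by positivity) hXy)] at h1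
  have h2 : ∫ u in Real.pi..(Real.pi / y), f u ≤ ∫ u in Real.pi..(Real.pi / y), hh σ Real.pi * (1 / u ^ 2) := by
    have c1 : ContinuousOn (fun u : ℝ => hh σ Real.pi * (1 / u ^ 2)) (Ioi 0) := by
      refine ContinuousOn.mul (by fun_prop) (ContinuousOn.div (by fun_prop) (by fun_prop) fun r hr => ?_)
      have : (0:ℝ) < r := hr
      positivity
    apply intervalIntegral.integral_mono_on hpy (ii f hfc _ _ hpi hpy) (ii _ c1 _ _ hpi hpy)
    intro u hu
    have hu0 : 0 < u := by linarith [hu.1]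
    rw [mul_one_div]
    simp only [hf]
    gcongr
    unfold hh
    refine FF_anti σ hσ (hh_arg _ _) (mul_nonneg (sq_nonneg _) (wy_nonneg _ _)) ?_
    gcongr
    have k1 := cos_conc_nonneg Real.pi y hpi.le (by linarith) hy hy1
    refine k1.trans ?_
    unfold wy
    have huy : u * y ≤ Real.pi := by rw [← le_div_iff₀ hy]; exact hu.2
    have := Real.strictAntiOn_cos.antitoneOn (a := Real.pi * y) (b := u * y) ⟨by positivity, by nlinarith⟩ ⟨by positivity, huy⟩ (by nlinarith [hu.1])
    gcongr
  rw [intervalIntegral.integral_const_mul, int_inv_sq _ _ hpi hpy] at h2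
  have h3 : ∫ u in (Real.pi / y)..X, f u ≤ ∫ u in (Real.pi / y)..X, y ^ 2 * (hh σ (u * y) / (u * y) ^ 2) := by
    have c1 : ContinuousOn (fun u : ℝ => y ^ 2 * (hh σ (u * y) / (u * y) ^ 2)) (Ioi 0) := by
      refine ContinuousOn.mul (by fun_prop) (ContinuousOn.div (by fun_prop) (by fun_prop) fun r hr => ?_)
      have : (0:ℝ) < r := hr
      positivity
    apply intervalIntegral.integral_mono_on hXy (ii f hfc _ _ (by positivity) hXy) (ii _ c1 _ _ (by positivity) hXy)
    intro u hu
    have hu0 : 0 < u := by linarith [hu.1]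
    have e : y ^ 2 * (hh σ (u * y) / (u * y) ^ 2) = hh σ (u * y) / u ^ 2 := by field_simp
    rw [e]
    simp only [hf]
    gcongr
    refine FF_anti σ hσ (hh_arg _ _) (mul_nonneg (sq_nonneg _) (wy_nonneg _ _)) ?_
    gcongr
    unfold wy
    rw [le_div_iff₀ (by positivity)]
    have : 0 ≤ 1 - Real.cos (u * y) := by linarith [Real.cos_le_one (u * y)]
    exact mul_le_of_le_one_right this (pow_le_one₀ hy.le hy1)
  have e4 : ∫ u in (Real.pi / y)..X, y ^ 2 * (hh σ (u * y) / (u * y) ^ 2) = y * ∫ r in Real.pi..(X * y), hh σ r / r ^ 2 := by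
    rw [intervalIntegral.integral_const_mul, intervalIntegral.integral_comp_mul_right (fun r => hh σ r / r ^ 2) hy.ne', smul_eq_mul,
      div_mul_cancel₀ _ hy.ne']
    field_simp
  rw [e4] at h3
  have h5 := period_bd (hh σ) hhc (hh_per σ) (hh_even σ) (hh_anti σ hσ) (hh_nonneg σ hσ) (X * y) (by rwa [← div_le_iff₀ hy])
  have h6 : hh σ Real.pi * Real.pi ≤ ∫ d in (0:ℝ)..Real.pi, hh σ d := by
    have := intervalIntegral.integral_mono_on hpi.le (intervalIntegrable_const (c := hh σ Real.pi) (μ := volume)) (hhc.intervalIntegrable _ _)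
      (fun x _ => hh_ge σ hσ x)
    simpa [mul_comm] using this
  have h7 : hh σ Real.pi * (1 / Real.pi - 1 / (Real.pi / y)) ≤ (1 - y) * QJ σ := by
    have : hh σ Real.pi * (1 / Real.pi - 1 / (Real.pi / y)) = (1 - y) * (1 / Real.pi ^ 2 * (hh σ Real.pi * Real.pi)) := by
      field_simp
    rw [this, QJ]
    have : 0 ≤ 1 - y := by linarith
    gcongr
  have h8 : y * ∫ r in Real.pi..(X * y), hh σ r / r ^ 2 ≤ y * QJ σ := by
    unfold QJ; gcongr
  linarith

lemma y_bound (σ : ℝ) (hσ : 0 < σ) (y : ℝ) (hy : y ≠ 0) (hy1 : |y| ≤ 1) (M : ℝ) (hM : Real.pi ≤ M) :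
    ∫ u in Real.pi..M, FF σ (σ ^ 2 * wy y u) / u ^ 2 ≤ QJ σ := by
  have := y_bound_pos σ hσ |y| (abs_pos.2 hy) hy1 M hM
  simpa only [wy_abs] using this
end

section
open MeasureTheory ProbabilityTheory Set Filter Topology
open scoped ENNReal NNReal

section
variable (m : Measure ℝ) [IsFiniteMeasure m]

lemma jensen_FF (σ : ℝ) (hσ : 0 < σ) (ha : m.real univ = σ ^ 2) (u : ℝ) :
    FF σ (Om m u) ≤ (σ ^ 2)⁻¹ * ∫ y, FF σ (σ ^ 2 * wy y u) ∂m := by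
  have hne : NeZero m := ⟨by rintro rfl; simp at ha; nlinarith [pow_pos hσ 2]⟩
  have hFc := FF_cont σ
  have hi : Integrable (fun y => σ ^ 2 * wy y u) m := (Om_int m u).const_mul _
  have hFi : Integrable (FF σ ∘ fun y => σ ^ 2 * wy y u) m := by
    refine (integrable_const (√2 * σ)).mono' (hFc.comp_aestronglyMeasurable hi.1) (ae_of_all _ fun y => ?_)
    have h0 : 0 ≤ σ ^ 2 * wy y u := mul_nonneg (sq_nonneg _) (wy_nonneg _ _)
    simp only [Function.comp_apply]
    rw [Real.norm_of_nonneg (FF_nonneg σ _ hσ h0)]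
    exact FF_zero_le σ _ hσ h0
  have := (FF_convex σ hσ).map_average_le hFc.continuousOn isClosed_Ici
    (ae_of_all m fun y => mem_Ici.2 (mul_nonneg (sq_nonneg σ) (wy_nonneg y u))) hi hFi
  rw [average_eq, average_eq, ha, integral_const_mul] at this
  simp only [smul_eq_mul] at this
  rw [inv_mul_cancel_left₀ (by positivity)] at this
  exact this

lemma J_bound (hm : ∀ᵐ y ∂m, y ≠ 0 ∧ |y| ≤ 1) (σ : ℝ) (hσ : 0 < σ) (ha : m.real univ = σ ^ 2) (M : ℝ) (hM : Real.pi ≤ M) :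
    ∫ u in Real.pi..M, FF σ (Om m u) / u ^ 2 ≤ QJ σ := by
  have hpi := Real.pi_pos
  have hFc := FF_cont σ
  have hOc := Om_cont m hm
  set k : ℝ → ℝ → ℝ := fun u y => FF σ (σ ^ 2 * wy y u) / u ^ 2 with hk
  have kmeas : Measurable (Function.uncurry k) := by
    have := hFc.measurable
    unfold Function.uncurry
    simp only [hk, wy]
    fun_prop
  have kb : ∀ u y, Real.pi < u → ‖k u y‖ ≤ √2 * σ := by
    intro u y hu
    have h0 : 0 ≤ σ ^ 2 * wy y u := mul_nonneg (sq_nonneg _) (wy_nonneg _ _)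
    have h1 := FF_nonneg σ _ hσ h0
    have h2 := FF_zero_le σ _ hσ h0
    have h3 : 1 ≤ u ^ 2 := by nlinarith [Real.pi_gt_three]
    simp only [hk]
    rw [Real.norm_of_nonneg (by positivity)]
    exact (div_le_self h1 h3).trans h2
  have kint : Integrable (Function.uncurry k) ((volume.restrict (Ioc Real.pi M)).prod m) := by
    refine (integrable_const (√2 * σ)).mono' kmeas.aestronglyMeasurable ?_
    have : ∀ᵐ z ∂((volume.restrict (Ioc Real.pi M)).prod m), Real.pi < z.1 := by
      have h : ∀ᵐ u ∂(volume.restrict (Ioc Real.pi M)), Real.pi < u := by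
        filter_upwards [ae_restrict_mem measurableSet_Ioc] with u hu using hu.1
      exact Measure.quasiMeasurePreserving_fst.ae h
    filter_upwards [this] with z hz
    exact kb z.1 z.2 hz
  have h1 : ∫ u in Real.pi..M, FF σ (Om m u) / u ^ 2 ≤ ∫ u in Real.pi..M, (σ ^ 2)⁻¹ * ∫ y, k u y ∂m := by
    apply intervalIntegral.integral_mono_on hM
    · apply ContinuousOn.intervalIntegrable_of_Icc hM
      refine ContinuousOn.div (by fun_prop) (by fun_prop) fun r hr => ?_
      have : (0:ℝ) < r := by linarith [hr.1]
      positivity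
    · apply IntervalIntegrable.const_mul
      rw [intervalIntegrable_iff_integrableOn_Ioc_of_le hM]
      exact kint.integral_prod_left
    · intro u hu
      have : (0:ℝ) < u := by linarith [hu.1]
      have j := jensen_FF m σ hσ ha u
      simp only [hk]
      rw [integral_div, ← mul_div_assoc]
      gcongr
  rw [intervalIntegral.integral_const_mul, intervalIntegral.integral_of_le hM (f := fun u => ∫ y, k u y ∂m), integral_integral_swap kint] at h1
  refine h1.trans ?_
  rw [inv_mul_le_iff₀ (by positivity)]
  have h2 : ∫ y, (∫ u in Ioc Real.pi M, k u y) ∂m ≤ ∫ y, QJ σ ∂m := by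
    apply integral_mono_ae kint.integral_prod_right (integrable_const _)
    filter_upwards [hm] with y hy
    have := y_bound σ hσ y hy.1 hy.2 M hM
    rwa [intervalIntegral.integral_of_le hM] at this
  simpa [ha] using h2

noncomputable def QC (σ Mx : ℝ) : ℝ :=
  √2 * σ * Mx * Real.exp (-(σ ^ 2)) * Real.exp (-(σ ^ 2 * Real.pi ^ 2) / 2) / Real.pi
    + √2 * σ * Real.exp (-(σ ^ 2 * (3 / 2 * Real.pi) ^ 2) / 2) / (3 / 2 * Real.pi)

lemma gauss_piece (σ : ℝ) (hσ : 0 < σ) (u0 M : ℝ) (hu0 : 0 < u0) (hM : u0 ≤ M) :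
    ∫ u in u0..M, √2 * σ ^ 3 * cg σ u ≤ √2 * σ * cg σ u0 / u0 := by
  have hc := cg_cont σ
  have h1 : ∫ u in u0..M, √2 * σ ^ 3 * cg σ u ≤ ∫ u in u0..M, (√2 * σ / u0) * (σ ^ 2 * u * cg σ u) := by
    apply intervalIntegral.integral_mono_on hM ((by fun_prop : Continuous fun u => √2 * σ ^ 3 * cg σ u).intervalIntegrable _ _)
      ((by fun_prop : Continuous fun u => (√2 * σ / u0) * (σ ^ 2 * u * cg σ u)).intervalIntegrable _ _)
    intro u hu
    have hcu := cg_pos σ u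
    have e : (√2 * σ / u0) * (σ ^ 2 * u * cg σ u) = √2 * σ ^ 3 * cg σ u * (u / u0) := by ring
    rw [e]
    apply le_mul_of_one_le_right (by positivity)
    rw [one_le_div hu0]; exact hu.1
  have h2 : ∫ u in u0..M, σ ^ 2 * u * cg σ u = -cg σ M - -cg σ u0 := by
    apply intervalIntegral.integral_eq_sub_of_hasDerivAt (f := fun u => -cg σ u)
    · intro u _
      have := (cg_deriv σ u).neg
      refine this.congr_deriv ?_
      ring
    · exact (by fun_prop : Continuous fun u => σ ^ 2 * u * cg σ u).intervalIntegrable _ _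
  refine h1.trans ?_
  rw [intervalIntegral.integral_const_mul, h2]
  have := cg_pos σ M
  rw [show √2 * σ * cg σ u0 / u0 = √2 * σ / u0 * cg σ u0 by ring]
  gcongr
  linarith

lemma gam_fac (x x0 Mx : ℝ) (hx : 0 ≤ x) (hx0 : x ≤ x0) (h1 : 1 ≤ Mx) (h2 : 1 + 2 * x0 ^ 2 - x0 ≤ Mx) : 1 + 2 * x ^ 2 - x ≤ Mx := by
  rcases le_total x (1 / 2) with h | h
  · nlinarith
  · nlinarith

lemma gam_le (σ : ℝ) (hσ : 0 < σ) (u0 u Mx : ℝ) (hu0 : 0 < u0) (hu : u0 ≤ u) (h1 : 1 ≤ Mx)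
    (h2 : 1 + 2 * (1 / (σ * u0) ^ 2) ^ 2 - 1 / (σ * u0) ^ 2 ≤ Mx) : gam σ u ≤ √2 * σ ^ 3 * cg σ u * Mx := by
  unfold gam
  have hc := cg_pos σ u
  have hu' : 0 < u := by linarith
  gcongr
  have e : (2 : ℝ) / (σ * u) ^ 4 = 2 * (1 / (σ * u) ^ 2) ^ 2 := by field_simp
  rw [e]
  apply gam_fac _ _ _ (by positivity) _ h1 h2
  gcongr

lemma gam_nonneg (σ : ℝ) (hσ : 0 < σ) (u : ℝ) : 0 ≤ gam σ u := by
  unfold gam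
  have hc := cg_pos σ u
  have e : (2 : ℝ) / (σ * u) ^ 4 = 2 * (1 / (σ * u) ^ 2) ^ 2 := by
    rw [div_pow, one_pow, ← pow_mul, mul_one_div]
  apply mul_nonneg (by positivity)
  rw [e]
  nlinarith [sq_nonneg (1 / (σ * u) ^ 2 - 1 / 2)]

lemma C_bound (hm : ∀ᵐ y ∂m, y ≠ 0 ∧ |y| ≤ 1) (σ : ℝ) (hσ : 0 < σ) (ha : m.real univ = σ ^ 2) (Mx : ℝ) (h1 : 1 ≤ Mx)
    (h2 : 1 + 2 * (1 / (σ * Real.pi) ^ 2) ^ 2 - 1 / (σ * Real.pi) ^ 2 ≤ Mx) (h3 : 1 / (σ * (3 / 2 * Real.pi)) ^ 2 ≤ 1 / 2)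
    (M : ℝ) (hM : Real.pi ≤ M) :
    ∫ u in Real.pi..M, gam σ u * Real.exp (-Om m u) ≤ QC σ Mx := by
  have hpi := Real.pi_pos
  have hOc := Om_cont m hm
  have hc := cg_cont σ
  set f : ℝ → ℝ := fun u => gam σ u * Real.exp (-Om m u) with hf
  have hfc : ContinuousOn f (Ioi 0) := (gam_cont σ hσ).mul (by fun_prop)
  have ii : ∀ x y, 0 < x → x ≤ y → IntervalIntegrable f volume x y := fun x y hx hxy =>
    (hfc.mono (fun r hr => lt_of_lt_of_le hx hr.1)).intervalIntegrable_of_Icc hxy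
  set X := max M (3 / 2 * Real.pi) with hX
  set z := 3 / 2 * Real.pi with hz
  have hz0 : 0 < z := by positivity
  have hpz : Real.pi ≤ z := by linarith
  have hzX : z ≤ X := le_max_right _ _
  have k1 : ∫ u in Real.pi..M, f u ≤ ∫ u in Real.pi..X, f u := by
    apply intervalIntegral.integral_mono_interval le_rfl hM (le_max_left _ _) _ (ii _ _ hpi (by linarith))
    exact ae_of_all _ fun u => mul_nonneg (gam_nonneg σ hσ u) (Real.exp_pos _).le
  rw [← intervalIntegral.integral_add_adjacent_intervals (ii _ _ hpi hpz) (ii _ _ hz0 hzX)] at k1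
  have k2 : ∫ u in Real.pi..z, f u ≤ ∫ u in Real.pi..z, (Mx * Real.exp (-(σ ^ 2))) * (√2 * σ ^ 3 * cg σ u) := by
    apply intervalIntegral.integral_mono_on hpz (ii _ _ hpi hpz)
      ((by fun_prop : Continuous fun u => (Mx * Real.exp (-(σ ^ 2))) * (√2 * σ ^ 3 * cg σ u)).intervalIntegrable _ _)
    intro u hu
    have g1 := gam_le σ hσ Real.pi u Mx hpi hu.1 h1 h2
    have hcu := cg_pos σ u
    have g2 : Real.exp (-Om m u) ≤ Real.exp (-(σ ^ 2)) := by
      apply Real.exp_le_exp.2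
      have := Om_ge m hm u (by linarith [hu.1]) (by linarith [hu.2])
      rw [ha] at this
      have hcos : Real.cos u ≤ 0 := Real.cos_nonpos_of_pi_div_two_le_of_le (by linarith [hu.1]) (by linarith [hu.2])
      nlinarith [sq_nonneg σ]
    have := mul_le_mul g1 g2 (Real.exp_pos _).le (by positivity)
    simp only [hf]; linarith
  have k3 : ∫ u in z..X, f u ≤ ∫ u in z..X, √2 * σ ^ 3 * cg σ u := by
    apply intervalIntegral.integral_mono_on hzX (ii _ _ hz0 hzX)
      ((by fun_prop : Continuous fun u => (√2 * σ ^ 3 * cg σ u)).intervalIntegrable _ _)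
    intro u hu
    have g1 := gam_le σ hσ z u 1 hz0 hu.1 le_rfl (by
      have : 0 ≤ 1 / (σ * z) ^ 2 := by positivity
      nlinarith)
    have g2 : Real.exp (-Om m u) ≤ 1 := by rw [Real.exp_le_one_iff]; linarith [Om_nonneg m u]
    have := mul_le_mul g1 g2 (Real.exp_pos _).le (by have := cg_pos σ u; positivity)
    simp only [hf]; linarith
  have k4 := gauss_piece σ hσ Real.pi z hpi hpz
  have k5 := gauss_piece σ hσ z X hz0 hzX
  rw [intervalIntegral.integral_const_mul] at k2
  have k6 := mul_le_mul_of_nonneg_left k4 (by positivity : 0 ≤ Mx * Real.exp (-(σ ^ 2)))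
  have e : QC σ Mx = Mx * Real.exp (-(σ ^ 2)) * (√2 * σ * cg σ Real.pi / Real.pi) + √2 * σ * cg σ z / z := by
    unfold QC cg; ring
  rw [e]; linarith

lemma high_bound (hm : ∀ᵐ y ∂m, y ≠ 0 ∧ |y| ≤ 1) (σ : ℝ) (hσ : 0 < σ) (ha : m.real univ = σ ^ 2) (Mx : ℝ) (h1 : 1 ≤ Mx)
    (h2 : 1 + 2 * (1 / (σ * Real.pi) ^ 2) ^ 2 - 1 / (σ * Real.pi) ^ 2 ≤ Mx) (h3 : 1 / (σ * (3 / 2 * Real.pi)) ^ 2 ≤ 1 / 2)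
    (M : ℝ) (hM : Real.pi ≤ M) :
    ∫ u in Real.pi..M, highf m σ u ≤ QJ σ + QC σ Mx := by
  have hpi := Real.pi_pos
  have hOc := Om_cont m hm
  have hFc := FF_cont σ
  unfold highf
  rw [intervalIntegral.integral_add]
  · linarith [J_bound m hm σ hσ ha M hM, C_bound m hm σ hσ ha Mx h1 h2 h3 M hM]
  · apply ContinuousOn.intervalIntegrable_of_Icc hM
    refine ContinuousOn.div (by fun_prop) (by fun_prop) fun r hr => ?_
    have : (0:ℝ) < r := by linarith [hr.1]
    positivity
  · apply ContinuousOn.intervalIntegrable_of_Icc hM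
    exact ((gam_cont σ hσ).mono fun r hr => (lt_of_lt_of_le hpi hr.1 : (0:ℝ) < r)).mul (by fun_prop)
end
end

section
open MeasureTheory ProbabilityTheory Set Filter Topology
open scoped ENNReal NNReal

lemma exp_tay_nonneg (y : ℝ) (hy : 0 ≤ y) (n : ℕ) :
    Real.exp y ≤ ∑ k ∈ Finset.range n, y ^ k / (k.factorial : ℝ) + y ^ n / (n.factorial : ℝ) * Real.exp y := by
  have h : HasSum (fun k : ℕ => y ^ k / (k.factorial : ℝ)) (Real.exp y) := by
    rw [Real.exp_eq_exp_ℝ]; exact NormedSpace.expSeries_div_hasSum_exp y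
  have h1 := (hasSum_nat_add_iff' n).2 h
  have h2 := h.mul_left (y ^ n / (n.factorial : ℝ))
  have := hasSum_le (fun k => ?_) h1 h2
  · linarith
  · have hf : ((k.factorial * n.factorial : ℕ) : ℝ) ≤ ((k + n).factorial : ℕ) := by
      exact_mod_cast Nat.le_of_dvd (Nat.factorial_pos _) (Nat.factorial_mul_factorial_dvd_factorial_add k n)
    have e : y ^ n / (n.factorial : ℝ) * (y ^ k / (k.factorial : ℝ)) = y ^ (k + n) / ((k.factorial * n.factorial : ℕ) : ℝ) := by
      push_cast; rw [pow_add]; field_simp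
    rw [e]
    have : (0:ℝ) < ((k.factorial * n.factorial : ℕ) : ℝ) := by
      exact_mod_cast Nat.mul_pos (Nat.factorial_pos _) (Nat.factorial_pos _)
    gcongr

lemma exp_tay (x : ℝ) (n : ℕ) :
    Real.exp x ≤ ∑ k ∈ Finset.range n, x ^ k / (k.factorial : ℝ) + |x| ^ n / (n.factorial : ℝ) * Real.exp |x| := by
  have h := Complex.norm_exp_sub_sum_le_exp_norm_sub_sum (x : ℂ) n
  have e : Complex.exp (x : ℂ) - ∑ m ∈ Finset.range n, (x : ℂ) ^ m / (m.factorial : ℂ) =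
      ((Real.exp x - ∑ m ∈ Finset.range n, x ^ m / (m.factorial : ℝ) : ℝ) : ℂ) := by push_cast; rfl
  rw [e, Complex.norm_real, Complex.norm_real, Real.norm_eq_abs, Real.norm_eq_abs] at h
  have h2 := exp_tay_nonneg |x| (abs_nonneg x) n
  have h3 := le_abs_self (Real.exp x - ∑ m ∈ Finset.range n, x ^ m / (m.factorial : ℝ))
  linarith

-- moments of the cosine
noncomputable def wc (n : ℕ) : ℝ := ∫ u in (0:ℝ)..Real.pi, Real.cos u ^ n

lemma wc_succ (n : ℕ) : wc (n + 2) = (n + 1) / (n + 2) * wc n := by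
  unfold wc; rw [integral_cos_pow]; simp
lemma wc_zero : wc 0 = Real.pi := by simp [wc]
lemma wc_one : wc 1 = 0 := by simp [wc]

lemma wc_odd (n : ℕ) : wc (2 * n + 1) = 0 := by
  induction n with
  | zero => exact wc_one
  | succ k ih => rw [show 2 * (k + 1) + 1 = (2 * k + 1) + 2 by ring, wc_succ, ih, mul_zero]

lemma wc_even (n : ℕ) : wc (2 * n) = Real.pi * ((2 * n).factorial / (4 ^ n * (n.factorial : ℝ) ^ 2)) := by
  induction n with
  | zero => simp [wc_zero]
  | succ k ih =>
    rw [show 2 * (k + 1) = 2 * k + 2 by ring, wc_succ, ih, Nat.factorial_succ, Nat.factorial_succ, Nat.factorial_succ]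
    push_cast
    have : (k.factorial : ℝ) ≠ 0 := by positivity
    field_simp
    ring

noncomputable def i0s (x : ℝ) : ℝ := ∑ k ∈ Finset.range 10, x ^ k / (k.factorial : ℝ) ^ 2
noncomputable def i1s (x : ℝ) : ℝ := ∑ k ∈ Finset.range 10, x ^ k / ((k.factorial : ℝ) * ((k + 1).factorial : ℝ))
noncomputable def remB (a : ℝ) : ℝ := (2 * a) ^ 20 / (Nat.factorial 20 : ℝ)
noncomputable def pw (a c : ℝ) : ℝ := ∑ k ∈ Finset.range 20, (2 * a * c) ^ k / (k.factorial : ℝ)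

lemma sum_range_double (f : ℕ → ℝ) (n : ℕ) :
    ∑ k ∈ Finset.range (2 * n), f k = ∑ k ∈ Finset.range n, (f (2 * k) + f (2 * k + 1)) := by
  induction n with
  | zero => simp
  | succ k ih => rw [show 2 * (k + 1) = 2 * k + 1 + 1 by ring, Finset.sum_range_succ, Finset.sum_range_succ, ih, Finset.sum_range_succ]; ring

lemma pw_cont (a : ℝ) : Continuous fun u => pw a (Real.cos u) := by unfold pw; fun_prop

lemma int_pw (a : ℝ) : ∫ u in (0:ℝ)..Real.pi, pw a (Real.cos u) = Real.pi * i0s (a ^ 2) := by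
  have h : ∀ u, pw a (Real.cos u) = ∑ k ∈ Finset.range 20, (2 * a) ^ k / (k.factorial : ℝ) * Real.cos u ^ k := by
    intro u; unfold pw; apply Finset.sum_congr rfl; intro k _; rw [mul_pow]; ring
  simp_rw [h]
  rw [intervalIntegral.integral_finsetSum]
  · simp_rw [intervalIntegral.integral_const_mul]
    change ∑ k ∈ Finset.range (2 * 10), (2 * a) ^ k / (k.factorial : ℝ) * wc k = _
    rw [sum_range_double, i0s, Finset.mul_sum]
    apply Finset.sum_congr rfl; intro k _
    rw [wc_odd, wc_even]
    have e : (2 * a) ^ (2 * k) = 4 ^ k * (a ^ 2) ^ k := by rw [pow_mul, mul_pow, mul_pow]; norm_num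
    rw [e]
    have : ((2 * k).factorial : ℝ) ≠ 0 := by positivity
    field_simp
    ring
  · intro k _; exact (by fun_prop : Continuous fun u => (2 * a) ^ k / (k.factorial : ℝ) * Real.cos u ^ k).intervalIntegrable _ _

lemma int_pw1 (a : ℝ) : ∫ u in (0:ℝ)..Real.pi, pw a (Real.cos u) * Real.cos u = Real.pi * (a * i1s (a ^ 2)) := by
  have h : ∀ u, pw a (Real.cos u) * Real.cos u = ∑ k ∈ Finset.range 20, (2 * a) ^ k / (k.factorial : ℝ) * Real.cos u ^ (k + 1) := by
    intro u; unfold pw; rw [Finset.sum_mul]; apply Finset.sum_congr rfl; intro k _; rw [mul_pow]; ring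
  simp_rw [h]
  rw [intervalIntegral.integral_finsetSum]
  · simp_rw [intervalIntegral.integral_const_mul]
    change ∑ k ∈ Finset.range (2 * 10), (2 * a) ^ k / (k.factorial : ℝ) * wc (k + 1) = _
    rw [sum_range_double, i1s, Finset.mul_sum, Finset.mul_sum]
    apply Finset.sum_congr rfl; intro k _
    rw [wc_odd, show 2 * k + 1 + 1 = 2 * (k + 1) by ring, wc_even, show 2 * (k + 1) = 2 * k + 1 + 1 by ring,
      Nat.factorial_succ (2 * k + 1), Nat.factorial_succ k]
    have e : (2 * a) ^ (2 * k + 1) = 2 * a * (4 ^ k * (a ^ 2) ^ k) := by rw [pow_succ, pow_mul, mul_pow, mul_pow]; norm_num; ring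
    rw [e]
    have : ((2 * k + 1).factorial : ℝ) ≠ 0 := by positivity
    have : (k.factorial : ℝ) ≠ 0 := by positivity
    push_cast
    field_simp
    ring
  · intro k _; exact (by fun_prop : Continuous fun u => (2 * a) ^ k / (k.factorial : ℝ) * Real.cos u ^ (k + 1)).intervalIntegrable _ _

lemma exp_cos_le (a u : ℝ) (ha : 0 ≤ a) : Real.exp (-(a * (1 - Real.cos u))) ^ 2 ≤ Real.exp (-(2 * a)) * pw a (Real.cos u) + remB a := by
  have e : Real.exp (-(a * (1 - Real.cos u))) ^ 2 = Real.exp (-(2 * a)) * Real.exp (2 * a * Real.cos u) := by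
    rw [← Real.exp_nat_mul, ← Real.exp_add]; congr 1; push_cast; ring
  rw [e]
  have h := exp_tay (2 * a * Real.cos u) 20
  have hc : |2 * a * Real.cos u| ≤ 2 * a := by
    rw [abs_mul, abs_of_nonneg (by positivity : 0 ≤ 2 * a)]
    exact mul_le_of_le_one_right (by positivity) (Real.abs_cos_le_one u)
  have h2 : |2 * a * Real.cos u| ^ 20 / (Nat.factorial 20 : ℝ) * Real.exp |2 * a * Real.cos u| ≤ remB a * Real.exp (2 * a) := by
    unfold remB; gcongr
  have h3 : Real.exp (2 * a * Real.cos u) ≤ pw a (Real.cos u) + remB a * Real.exp (2 * a) := by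
    unfold pw; linarith
  have h4 := mul_le_mul_of_nonneg_left h3 (Real.exp_pos (-(2 * a))).le
  have h5 : Real.exp (-(2 * a)) * Real.exp (2 * a) = 1 := by rw [← Real.exp_add]; simp
  calc _ ≤ _ := h4
    _ = Real.exp (-(2 * a)) * pw a (Real.cos u) + remB a * (Real.exp (-(2 * a)) * Real.exp (2 * a)) := by ring
    _ = _ := by rw [h5, mul_one]

lemma I0_le (a : ℝ) (ha : 0 ≤ a) : ∫ u in (0:ℝ)..Real.pi, Real.exp (-(a * (1 - Real.cos u))) ^ 2 ≤
    Real.pi * (Real.exp (-(2 * a)) * i0s (a ^ 2) + remB a) := by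
  have hc := pw_cont a
  calc _ ≤ ∫ u in (0:ℝ)..Real.pi, (Real.exp (-(2 * a)) * pw a (Real.cos u) + remB a) := by
        apply intervalIntegral.integral_mono_on Real.pi_pos.le (Continuous.intervalIntegrable (by fun_prop) _ _) (Continuous.intervalIntegrable (by fun_prop) _ _)
        intro u _; exact exp_cos_le a u ha
    _ = _ := by
        rw [intervalIntegral.integral_add (Continuous.intervalIntegrable (by fun_prop) _ _) (by simp), intervalIntegral.integral_const_mul, int_pw]
        simp; ring

lemma I01_le (a : ℝ) (ha : 0 ≤ a) : ∫ u in (0:ℝ)..Real.pi, (1 + a * (1 - Real.cos u)) * Real.exp (-(a * (1 - Real.cos u))) ^ 2 ≤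
    Real.pi * (Real.exp (-(2 * a)) * ((1 + a) * i0s (a ^ 2) - a * (a * i1s (a ^ 2))) + (1 + 2 * a) * remB a) := by
  have hc := pw_cont a
  have hr : 0 ≤ remB a := by unfold remB; positivity
  calc _ ≤ ∫ u in (0:ℝ)..Real.pi, (Real.exp (-(2 * a)) * (1 + a) * pw a (Real.cos u) - Real.exp (-(2 * a)) * a * (pw a (Real.cos u) * Real.cos u)
          + (1 + 2 * a) * remB a) := by
        apply intervalIntegral.integral_mono_on Real.pi_pos.le (Continuous.intervalIntegrable (by fun_prop) _ _) (Continuous.intervalIntegrable (by fun_prop) _ _)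
        intro u _
        have h := exp_cos_le a u ha
        have c1 := Real.cos_le_one u
        have c2 := Real.neg_one_le_cos u
        have p : 0 ≤ 1 + a * (1 - Real.cos u) := by nlinarith
        have h2 := mul_le_mul_of_nonneg_left h p
        have h3 : (1 + a * (1 - Real.cos u)) * remB a ≤ (1 + 2 * a) * remB a := by
          apply mul_le_mul_of_nonneg_right _ hr; nlinarith
        linarith
    _ = _ := by
        rw [intervalIntegral.integral_add (Continuous.intervalIntegrable (by fun_prop) _ _) (by simp),
          intervalIntegral.integral_sub (Continuous.intervalIntegrable (by fun_prop) _ _) (Continuous.intervalIntegrable (by fun_prop) _ _),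
          intervalIntegral.integral_const_mul, intervalIntegral.integral_const_mul, int_pw, int_pw1]
        simp; ring

lemma gauss_low (σ : ℝ) (hσ : 0 < σ) : √Real.pi / (2 * σ) - Real.exp (-(σ ^ 2 * Real.pi ^ 2)) / (2 * Real.pi * σ ^ 2) ≤
    ∫ u in (0:ℝ)..Real.pi, cg σ u ^ 2 := by
  have hpi := Real.pi_pos
  have hsq : 0 < σ ^ 2 := by positivity
  have e : ∀ u, cg σ u ^ 2 = Real.exp (-σ ^ 2 * u ^ 2) := by
    intro u; unfold cg; rw [← Real.exp_nat_mul]; congr 1; push_cast; ring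
  have hIntg : Integrable (fun u : ℝ => Real.exp (-σ ^ 2 * u ^ 2)) := integrable_exp_neg_mul_sq hsq
  have h0 := integral_gaussian_Ioi (σ ^ 2)
  have h1 : ∫ u in Ioi (0:ℝ), Real.exp (-σ ^ 2 * u ^ 2) = (∫ u in (0:ℝ)..Real.pi, Real.exp (-σ ^ 2 * u ^ 2)) + ∫ u in Ioi Real.pi, Real.exp (-σ ^ 2 * u ^ 2) :=
    (intervalIntegral.integral_interval_add_Ioi hIntg.integrableOn hIntg.integrableOn).symm
  have hd : ∀ u : ℝ, HasDerivAt (fun u => -Real.exp (-σ ^ 2 * u ^ 2) / (2 * Real.pi * σ ^ 2)) (u / Real.pi * Real.exp (-σ ^ 2 * u ^ 2)) u := by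
    intro u
    have := (((hasDerivAt_id u).pow 2).const_mul (-σ ^ 2)).exp.neg.div_const (2 * Real.pi * σ ^ 2)
    refine this.congr_deriv ?_
    simp; field_simp
  have ht : Tendsto (fun u : ℝ => -Real.exp (-σ ^ 2 * u ^ 2) / (2 * Real.pi * σ ^ 2)) atTop (𝓝 0) := by
    have : Tendsto (fun u : ℝ => Real.exp (-(σ ^ 2 * u ^ 2))) atTop (𝓝 0) :=
      Real.tendsto_exp_neg_atTop_nhds_zero.comp (Tendsto.const_mul_atTop hsq (tendsto_pow_atTop (by norm_num)))
    have h2 := this.neg.div_const (2 * Real.pi * σ ^ 2)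
    simpa [neg_mul] using h2
  have hnn : ∀ x ∈ Ioi Real.pi, 0 ≤ x / Real.pi * Real.exp (-σ ^ 2 * x ^ 2) := fun x hx => by
    have : 0 < x := hpi.trans hx
    positivity
  have h2 := integral_Ioi_of_hasDerivAt_of_nonneg' (a := Real.pi) (fun x _ => hd x) hnn ht
  have h2i := integrableOn_Ioi_deriv_of_nonneg' (a := Real.pi) (fun x _ => hd x) hnn ht
  have h3 : ∫ u in Ioi Real.pi, Real.exp (-σ ^ 2 * u ^ 2) ≤ ∫ u in Ioi Real.pi, u / Real.pi * Real.exp (-σ ^ 2 * u ^ 2) := by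
    apply setIntegral_mono_on hIntg.integrableOn h2i measurableSet_Ioi
    intro u hu
    apply le_mul_of_one_le_left (Real.exp_pos _).le
    rw [one_le_div hpi]; exact (le_of_lt hu)
  rw [h2] at h3
  rw [h0] at h1
  have e2 : √(Real.pi / σ ^ 2) / 2 = √Real.pi / (2 * σ) := by
    rw [Real.sqrt_div hpi.le, Real.sqrt_sq hσ.le]; field_simp
  rw [e2] at h1
  simp_rw [e]
  rw [neg_mul, neg_div] at h3
  linarith

lemma QLf_le (σ : ℝ) (hσ : 0 < σ) (I : ℝ) (hI : ∫ u in (0:ℝ)..Real.pi, Real.exp (-(σ ^ 2 * (1 - Real.cos u))) ^ 2 ≤ I) :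
    QLf σ ≤ √2 * σ ^ 3 * I - √2 * √Real.pi / 2 * σ ^ 2 + √2 * σ * Real.exp (-(σ ^ 2 * Real.pi ^ 2)) / (2 * Real.pi) := by
  have hc := cg_cont σ
  have h := gauss_low σ hσ
  unfold QLf
  rw [intervalIntegral.integral_sub (Continuous.intervalIntegrable (by fun_prop) _ _) (Continuous.intervalIntegrable (by fun_prop) _ _)]
  have h2 := mul_le_mul_of_nonneg_left (sub_le_sub hI h) (by positivity : 0 ≤ √2 * σ ^ 3)
  refine h2.trans (le_of_eq ?_)
  have := Real.pi_pos
  field_simp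
  ring

lemma QJ_le (σ : ℝ) (hσ : 0 < σ) (J : ℝ)
    (hJ : ∫ u in (0:ℝ)..Real.pi, (1 + σ ^ 2 * (1 - Real.cos u)) * Real.exp (-(σ ^ 2 * (1 - Real.cos u))) ^ 2 ≤ J) :
    QJ σ ≤ √2 * σ / Real.pi ^ 2 * J := by
  unfold QJ hh FF
  rw [intervalIntegral.integral_const_mul]
  have := mul_le_mul_of_nonneg_left hJ (by positivity : 0 ≤ √2 * σ / Real.pi ^ 2)
  refine le_trans (le_of_eq ?_) this
  ring
end

section
open MeasureTheory ProbabilityTheory Set Filter Topology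
open scoped ENNReal NNReal

lemma I0_anti (a0 a : ℝ) (h : a0 ≤ a) : ∫ u in (0:ℝ)..Real.pi, Real.exp (-(a * (1 - Real.cos u))) ^ 2 ≤
    ∫ u in (0:ℝ)..Real.pi, Real.exp (-(a0 * (1 - Real.cos u))) ^ 2 := by
  apply intervalIntegral.integral_mono_on Real.pi_pos.le (Continuous.intervalIntegrable (by fun_prop) _ _) (Continuous.intervalIntegrable (by fun_prop) _ _)
  intro u _
  have : 0 ≤ 1 - Real.cos u := by linarith [Real.cos_le_one u]
  gcongr

lemma I01_anti (a0 a : ℝ) (h0 : 0 ≤ a0) (h : a0 ≤ a) :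
    ∫ u in (0:ℝ)..Real.pi, (1 + a * (1 - Real.cos u)) * Real.exp (-(a * (1 - Real.cos u))) ^ 2 ≤
    ∫ u in (0:ℝ)..Real.pi, (1 + a0 * (1 - Real.cos u)) * Real.exp (-(a0 * (1 - Real.cos u))) ^ 2 := by
  apply intervalIntegral.integral_mono_on Real.pi_pos.le (Continuous.intervalIntegrable (by fun_prop) _ _) (Continuous.intervalIntegrable (by fun_prop) _ _)
  intro u _
  have hc : 0 ≤ 1 - Real.cos u := by linarith [Real.cos_le_one u]
  have h1 := FF_anti 1 one_pos (a := a0 * (1 - Real.cos u)) (b := a * (1 - Real.cos u)) (mul_nonneg h0 hc)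
    (mul_nonneg (h0.trans h) hc) (by gcongr)
  unfold FF at h1
  exact le_of_mul_le_mul_left h1 (by positivity)

lemma pi_sq_ge : (9869 / 1000 : ℝ) ≤ Real.pi ^ 2 := by nlinarith [Real.pi_gt_d6]
lemma sqrt2_le : √2 ≤ (141422 / 100000 : ℝ) := by rw [Real.sqrt_le_left (by norm_num)]; norm_num
lemma pi_ge' : (314159 / 100000 : ℝ) ≤ Real.pi := by linarith [Real.pi_gt_d6]
lemma pi_le' : Real.pi ≤ (31416 / 10000 : ℝ) := by linarith [Real.pi_lt_d6]
lemma sqrtpi2_ge : (125331 / 100000 : ℝ) ≤ √2 * √Real.pi / 2 := by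
  rw [← Real.sqrt_mul (by norm_num), le_div_iff₀ (by norm_num)]
  apply Real.le_sqrt_of_sq_le
  linarith [Real.pi_gt_d6]

lemma QL_cell (σ s0 s1 E I0 R D1 : ℝ) (h0 : 0 < s0) (h0σ : s0 ≤ σ) (hσ1 : σ ≤ s1)
    (hE : Real.exp (-(2 * s0 ^ 2)) ≤ E) (hI0 : i0s ((s0 ^ 2) ^ 2) = I0) (hI0n : 0 ≤ I0) (hR : remB (s0 ^ 2) = R)
    (hD1 : Real.exp (-(9869 / 1000 * s0 ^ 2)) ≤ D1) :
    QLf σ ≤ s1 ^ 2 * max 0 (141422 / 100000 * s1 * (31416 / 10000 * (E * I0 + R)) - 125331 / 100000) +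
      141422 / 100000 * s1 * D1 / (2 * (314159 / 100000)) := by
  have hσ : 0 < σ := h0.trans_le h0σ
  have hs1 : 0 < s1 := hσ.trans_le hσ1
  have hpi := Real.pi_pos
  have haa : s0 ^ 2 ≤ σ ^ 2 := by gcongr
  have hR0 : 0 ≤ R := by rw [← hR]; unfold remB; positivity
  have hE0 : 0 < E := (Real.exp_pos _).trans_le hE
  have hD0 : 0 < D1 := (Real.exp_pos _).trans_le hD1
  have k := QLf_le σ hσ (31416 / 10000 * (E * I0 + R)) (by
    refine ((I0_anti _ _ haa).trans (I0_le _ (sq_nonneg _))).trans ?_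
    rw [hI0, hR]
    have := pi_le'
    gcongr)
  set I := 31416 / 10000 * (E * I0 + R) with hI
  have hIn : 0 ≤ I := by positivity
  have k1 : √2 * σ ^ 3 * I - √2 * √Real.pi / 2 * σ ^ 2 ≤ s1 ^ 2 * max 0 (141422 / 100000 * s1 * I - 125331 / 100000) := by
    have a1 : √2 * σ * I ≤ 141422 / 100000 * s1 * I := by
      have := sqrt2_le; gcongr
    have a2 := sqrtpi2_ge
    calc √2 * σ ^ 3 * I - √2 * √Real.pi / 2 * σ ^ 2 = σ ^ 2 * (√2 * σ * I - √2 * √Real.pi / 2) := by ring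
      _ ≤ σ ^ 2 * max 0 (141422 / 100000 * s1 * I - 125331 / 100000) := by
        apply mul_le_mul_of_nonneg_left _ (sq_nonneg _)
        exact le_max_of_le_right (by linarith)
      _ ≤ _ := by gcongr
  have k2 : √2 * σ * Real.exp (-(σ ^ 2 * Real.pi ^ 2)) / (2 * Real.pi) ≤ 141422 / 100000 * s1 * D1 / (2 * (314159 / 100000)) := by
    have a1 : Real.exp (-(σ ^ 2 * Real.pi ^ 2)) ≤ D1 := by
      refine le_trans (Real.exp_le_exp.2 ?_) hD1
      have := pi_sq_ge
      nlinarith [mul_le_mul haa this (by norm_num) (by positivity)]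
    have := sqrt2_le
    have := pi_ge'
    gcongr
  linarith

lemma QJ_cell (σ s0 s1 E I0 I1 R : ℝ) (h0 : 0 < s0) (h0σ : s0 ≤ σ) (hσ1 : σ ≤ s1)
    (hE : Real.exp (-(2 * s0 ^ 2)) ≤ E) (hI0 : i0s ((s0 ^ 2) ^ 2) = I0) (hI1 : i1s ((s0 ^ 2) ^ 2) = I1) (hR : remB (s0 ^ 2) = R) :
    QJ σ ≤ 141422 / 100000 * s1 / (314159 / 100000) * (E * max 0 ((1 + s0 ^ 2) * I0 - s0 ^ 2 * (s0 ^ 2 * I1)) + (1 + 2 * s0 ^ 2) * R) := by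
  have hσ : 0 < σ := h0.trans_le h0σ
  have hs1 : 0 < s1 := hσ.trans_le hσ1
  have hpi := Real.pi_pos
  have haa : s0 ^ 2 ≤ σ ^ 2 := by gcongr
  have hR0 : 0 ≤ R := by rw [← hR]; unfold remB; positivity
  have hE0 : 0 < E := (Real.exp_pos _).trans_le hE
  have k := QJ_le σ hσ (Real.pi * (E * max 0 ((1 + s0 ^ 2) * I0 - s0 ^ 2 * (s0 ^ 2 * I1)) + (1 + 2 * s0 ^ 2) * R)) (by
    refine ((I01_anti _ _ (sq_nonneg _) haa).trans (I01_le _ (sq_nonneg _))).trans ?_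
    rw [hI0, hI1, hR]
    have hX : 0 ≤ max 0 ((1 + s0 ^ 2) * I0 - s0 ^ 2 * (s0 ^ 2 * I1)) := le_max_left _ _
    have hX2 : (1 + s0 ^ 2) * I0 - s0 ^ 2 * (s0 ^ 2 * I1) ≤ max 0 ((1 + s0 ^ 2) * I0 - s0 ^ 2 * (s0 ^ 2 * I1)) := le_max_right _ _
    have := mul_le_mul_of_nonneg_left hX2 (Real.exp_pos (-(2 * s0 ^ 2))).le
    have := mul_le_mul_of_nonneg_right hE hX
    apply mul_le_mul_of_nonneg_left _ hpi.le
    linarith)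
  refine k.trans ?_
  rw [show √2 * σ / Real.pi ^ 2 * (Real.pi * (E * max 0 ((1 + s0 ^ 2) * I0 - s0 ^ 2 * (s0 ^ 2 * I1)) + (1 + 2 * s0 ^ 2) * R)) =
    √2 * σ / Real.pi * (E * max 0 ((1 + s0 ^ 2) * I0 - s0 ^ 2 * (s0 ^ 2 * I1)) + (1 + 2 * s0 ^ 2) * R) by field_simp]
  have := sqrt2_le
  have := pi_ge'
  have : 0 ≤ max 0 ((1 + s0 ^ 2) * I0 - s0 ^ 2 * (s0 ^ 2 * I1)) := le_max_left _ _
  gcongr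

lemma QC_cell (σ s0 s1 Mx D2 D3 : ℝ) (h0 : 0 < s0) (h0σ : s0 ≤ σ) (hσ1 : σ ≤ s1) (hMx : 1 ≤ Mx)
    (hD2 : Real.exp (-((9869 / 2000 + 1) * s0 ^ 2)) ≤ D2) (hD3 : Real.exp (-(9 / 8 * (9869 / 1000) * s0 ^ 2)) ≤ D3) :
    QC σ Mx ≤ 141422 / 100000 * s1 * Mx * D2 / (314159 / 100000) + 141422 / 100000 * s1 * D3 / (3 / 2 * (314159 / 100000)) := by
  have hσ : 0 < σ := h0.trans_le h0σ
  have hs1 : 0 < s1 := hσ.trans_le hσ1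
  have hpi := Real.pi_pos
  have haa : s0 ^ 2 ≤ σ ^ 2 := by gcongr
  have hp := pi_sq_ge
  have hpp := mul_le_mul haa hp (by norm_num) (by positivity)
  have hD20 : 0 < D2 := (Real.exp_pos _).trans_le hD2
  have hD30 : 0 < D3 := (Real.exp_pos _).trans_le hD3
  have e1 : Real.exp (-(σ ^ 2)) * Real.exp (-(σ ^ 2 * Real.pi ^ 2) / 2) ≤ D2 := by
    rw [← Real.exp_add]
    refine le_trans (Real.exp_le_exp.2 ?_) hD2
    linarith
  have e2 : Real.exp (-(σ ^ 2 * (3 / 2 * Real.pi) ^ 2) / 2) ≤ D3 := by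
    refine le_trans (Real.exp_le_exp.2 ?_) hD3
    nlinarith
  unfold QC
  have := sqrt2_le
  have := pi_ge'
  rw [show √2 * σ * Mx * Real.exp (-(σ ^ 2)) * Real.exp (-(σ ^ 2 * Real.pi ^ 2) / 2) = √2 * σ * Mx * (Real.exp (-(σ ^ 2)) * Real.exp (-(σ ^ 2 * Real.pi ^ 2) / 2)) by ring]
  gcongr

-- rational evaluation
def hor (l : List ℚ) (x : ℚ) : ℚ := l.foldr (fun c r => 1 + x * c * r) 1
def lE : List ℚ := [1,1/2,1/3,1/4,1/5,1/6,1/7,1/8,1/9,1/10,1/11,1/12,1/13,1/14]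
def lE8 : List ℚ := [1,1/2,1/3,1/4,1/5,1/6,1/7,1/8]
def l0 : List ℚ := [1,1/4,1/9,1/16,1/25,1/36,1/49,1/64,1/81]
def l1 : List ℚ := [1/2,1/6,1/12,1/20,1/30,1/42,1/56,1/72,1/90]

lemma hor_E (x : ℚ) (hx : 0 ≤ x) : Real.exp (-(x : ℝ)) ≤ 1 / ((hor lE x : ℚ) : ℝ) := by
  have h := Real.sum_le_exp_of_nonneg (x := (x : ℝ)) (by exact_mod_cast hx) 15
  have e : ((hor lE x : ℚ) : ℝ) = ∑ i ∈ Finset.range 15, (x : ℝ) ^ i / (i.factorial : ℝ) := by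
    simp [hor, lE, Finset.sum_range_succ, Nat.factorial]; ring
  have hx' : (0:ℝ) ≤ x := by exact_mod_cast hx
  have hp : (0:ℝ) < ((hor lE x : ℚ) : ℝ) := by
    simp only [hor, lE, List.foldr]; push_cast; positivity
  rw [Real.exp_neg, inv_eq_one_div]
  rw [← e] at h
  gcongr

lemma hor_E8 (x : ℚ) (hx : 0 ≤ x) : Real.exp (-(x : ℝ)) ≤ 1 / ((hor lE8 x : ℚ) : ℝ) := by
  have h := Real.sum_le_exp_of_nonneg (x := (x : ℝ)) (by exact_mod_cast hx) 9
  have e : ((hor lE8 x : ℚ) : ℝ) = ∑ i ∈ Finset.range 9, (x : ℝ) ^ i / (i.factorial : ℝ) := by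
    simp [hor, lE8, Finset.sum_range_succ, Nat.factorial]; ring
  have hx' : (0:ℝ) ≤ x := by exact_mod_cast hx
  have hp : (0:ℝ) < ((hor lE8 x : ℚ) : ℝ) := by
    simp only [hor, lE8, List.foldr]; push_cast; positivity
  rw [Real.exp_neg, inv_eq_one_div]
  rw [← e] at h
  gcongr

lemma hor_0 (x : ℚ) : i0s (x : ℝ) = ((hor l0 x : ℚ) : ℝ) := by
  simp [hor, l0, i0s, Finset.sum_range_succ, Nat.factorial]; ring
lemma hor_1 (x : ℚ) : i1s (x : ℝ) = ((hor l1 x : ℚ) : ℝ) := by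
  simp [hor, l1, i1s, Finset.sum_range_succ, Nat.factorial]; ring
lemma hor_0_nonneg (x : ℚ) (hx : 0 ≤ x) : 0 ≤ hor l0 x := by
  simp only [hor, l0, List.foldr]; positivity

def ULc (s0 s1 : ℚ) : ℚ :=
  s1 ^ 2 * max 0 (141422 / 100000 * s1 * (31416 / 10000 * (1 / hor lE (2 * s0 ^ 2) * hor l0 ((s0 ^ 2) ^ 2) + (2 * s0 ^ 2) ^ 20 / 2432902008176640000)) - 125331 / 100000) +
      141422 / 100000 * s1 * (1 / hor lE8 (9869 / 1000 * s0 ^ 2)) / (2 * (314159 / 100000))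
def UJc (s0 s1 : ℚ) : ℚ :=
  141422 / 100000 * s1 / (314159 / 100000) * (1 / hor lE (2 * s0 ^ 2) * max 0 ((1 + s0 ^ 2) * hor l0 ((s0 ^ 2) ^ 2) - s0 ^ 2 * (s0 ^ 2 * hor l1 ((s0 ^ 2) ^ 2)))
    + (1 + 2 * s0 ^ 2) * ((2 * s0 ^ 2) ^ 20 / 2432902008176640000))
def Mxc (s0 : ℚ) : ℚ := max 1 (1 + 2 * (1 / (9869 / 1000 * s0 ^ 2)) ^ 2 - 1 / (9869 / 1000 * s0 ^ 2))
def UCc (s0 s1 : ℚ) : ℚ :=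
  141422 / 100000 * s1 * Mxc s0 * (1 / hor lE8 ((9869 / 2000 + 1) * s0 ^ 2)) / (314159 / 100000) +
    141422 / 100000 * s1 * (1 / hor lE8 (9 / 8 * (9869 / 1000) * s0 ^ 2)) / (3 / 2 * (314159 / 100000))
def Tc (s0 s1 : ℚ) : ℚ := 71764 / 10000000 * (3 * s1 + 1 / s0) + 663 / 100000 * s1
def cellOK (s0 s1 : ℚ) : Prop := ULc s0 s1 + UJc s0 s1 + UCc s0 s1 ≤ 3 / 2 * (1 / 2 - Tc s0 s1) ^ 2 ∧ Tc s0 s1 < 1 / 2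
instance (s0 s1 : ℚ) : Decidable (cellOK s0 s1) := by unfold cellOK; infer_instance

lemma cells : ∀ k : Fin 133, cellOK ((k.val + 44) / 125) ((k.val + 45) / 125) := by decide +kernel

lemma T_le (σ s0 s1 : ℝ) (h0 : 0 < s0) (h0σ : s0 ≤ σ) (hσ1 : σ ≤ s1) :
    27 / 256 * (3 * σ + 1 / σ) / (6 * √6) + σ / 3 * Real.exp (-3) / √(2 * Real.pi) ≤ 71764 / 10000000 * (3 * s1 + 1 / s0) + 663 / 100000 * s1 := by
  have hσ : 0 < σ := h0.trans_le h0σ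
  have hs1 : 0 < s1 := hσ.trans_le hσ1
  have h6 : (244948 / 100000 : ℝ) ≤ √6 := Real.le_sqrt_of_sq_le (by norm_num)
  have h2p : (2506 / 1000 : ℝ) ≤ √(2 * Real.pi) := Real.le_sqrt_of_sq_le (by linarith [Real.pi_gt_d6])
  have he : Real.exp (-3) ≤ 1 / 20.08 := by
    rw [Real.exp_neg, inv_eq_one_div]
    apply one_div_le_one_div_of_le (by norm_num)
    have : Real.exp 3 = Real.exp 1 ^ 3 := by rw [← Real.exp_nat_mul]; norm_num
    rw [this]
    have := Real.exp_one_gt_d9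
    calc (20.08:ℝ) ≤ 2.7182818283 ^ 3 := by norm_num
      _ ≤ _ := by gcongr
  have a1 : 27 / 256 * (3 * σ + 1 / σ) / (6 * √6) ≤ 27 / 256 * (3 * s1 + 1 / s0) / (6 * (244948 / 100000)) := by
    gcongr
  have a2 : σ / 3 * Real.exp (-3) / √(2 * Real.pi) ≤ s1 / 3 * (1 / 20.08) / (2506 / 1000) := by
    gcongr
  have hp : 0 < 3 * s1 + 1 / s0 := by have : 0 < s1 := by linarith
                                      positivity
  have a3 : 27 / 256 * (3 * s1 + 1 / s0) / (6 * (244948 / 100000)) ≤ 71764 / 10000000 * (3 * s1 + 1 / s0) := by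
    rw [div_le_iff₀ (by norm_num)]; linarith
  have a4 : s1 / 3 * (1 / 20.08) / (2506 / 1000) ≤ 663 / 100000 * s1 := by
    rw [div_le_iff₀ (by norm_num)]; norm_num; linarith
  linarith

lemma num_cell (σ : ℝ) (s0 s1 : ℚ) (h0 : 0 < s0) (h0σ : (s0 : ℝ) ≤ σ) (hσ1 : σ ≤ s1) (hk : cellOK s0 s1) :
    ∃ Mx T : ℝ, 1 ≤ Mx ∧ 1 + 2 * (1 / (σ * Real.pi) ^ 2) ^ 2 - 1 / (σ * Real.pi) ^ 2 ≤ Mx ∧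
      27 / 256 * (3 * σ + 1 / σ) / (6 * √6) + σ / 3 * Real.exp (-3) / √(2 * Real.pi) ≤ T ∧ T < 1 / 2 ∧
      QLf σ + QJ σ + QC σ Mx ≤ 3 / 2 * (1 / 2 - T) ^ 2 := by
  have h0' : (0:ℝ) < s0 := by exact_mod_cast h0
  have hσ : 0 < σ := h0'.trans_le h0σ
  have hpi := Real.pi_pos
  have hE : Real.exp (-(2 * (s0:ℝ) ^ 2)) ≤ 1 / ((hor lE (2 * s0 ^ 2) : ℚ) : ℝ) := by
    have := hor_E (2 * s0 ^ 2) (by positivity); push_cast at this; exact this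
  have hI0 : i0s (((s0:ℝ) ^ 2) ^ 2) = ((hor l0 ((s0 ^ 2) ^ 2) : ℚ) : ℝ) := by
    rw [← hor_0]; push_cast; rfl
  have hI1 : i1s (((s0:ℝ) ^ 2) ^ 2) = ((hor l1 ((s0 ^ 2) ^ 2) : ℚ) : ℝ) := by
    rw [← hor_1]; push_cast; rfl
  have hI0n : (0:ℝ) ≤ ((hor l0 ((s0 ^ 2) ^ 2) : ℚ) : ℝ) := by exact_mod_cast hor_0_nonneg _ (by positivity)
  have hR : remB ((s0:ℝ) ^ 2) = (2 * (s0:ℝ) ^ 2) ^ 20 / 2432902008176640000 := by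
    unfold remB; norm_num [Nat.factorial]
  have hD1 : Real.exp (-(9869 / 1000 * (s0:ℝ) ^ 2)) ≤ 1 / ((hor lE8 (9869 / 1000 * s0 ^ 2) : ℚ) : ℝ) := by
    have := hor_E8 (9869 / 1000 * s0 ^ 2) (by positivity); push_cast at this; exact this
  have hD2 : Real.exp (-((9869 / 2000 + 1) * (s0:ℝ) ^ 2)) ≤ 1 / ((hor lE8 ((9869 / 2000 + 1) * s0 ^ 2) : ℚ) : ℝ) := by
    have := hor_E8 ((9869 / 2000 + 1) * s0 ^ 2) (by positivity); push_cast at this; exact this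
  have hD3 : Real.exp (-(9 / 8 * (9869 / 1000) * (s0:ℝ) ^ 2)) ≤ 1 / ((hor lE8 (9 / 8 * (9869 / 1000) * s0 ^ 2) : ℚ) : ℝ) := by
    have := hor_E8 (9 / 8 * (9869 / 1000) * s0 ^ 2) (by positivity); push_cast at this; exact this
  have hMc : ((Mxc s0 : ℚ) : ℝ) = max 1 (1 + 2 * (1 / (9869 / 1000 * (s0:ℝ) ^ 2)) ^ 2 - 1 / (9869 / 1000 * (s0:ℝ) ^ 2)) := by
    unfold Mxc; push_cast; rfl
  have hM1 : (1:ℝ) ≤ ((Mxc s0 : ℚ) : ℝ) := by rw [hMc]; exact le_max_left _ _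
  have q1 := QL_cell σ s0 s1 _ _ _ _ h0' h0σ hσ1 hE hI0 hI0n hR hD1
  have q2 := QJ_cell σ s0 s1 _ _ _ _ h0' h0σ hσ1 hE hI0 hI1 hR
  have q3 := QC_cell σ s0 s1 _ _ _ h0' h0σ hσ1 hM1 hD2 hD3
  have q4 := T_le σ s0 s1 h0' h0σ hσ1
  have c1 : ((ULc s0 s1 + UJc s0 s1 + UCc s0 s1 : ℚ) : ℝ) ≤ ((3 / 2 * (1 / 2 - Tc s0 s1) ^ 2 : ℚ) : ℝ) := by exact_mod_cast hk.1
  have c2 : ((Tc s0 s1 : ℚ) : ℝ) < ((1 / 2 : ℚ) : ℝ) := by exact_mod_cast hk.2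
  refine ⟨((Mxc s0 : ℚ) : ℝ), ((Tc s0 s1 : ℚ) : ℝ), hM1, ?_, ?_, ?_, ?_⟩
  · apply gam_fac _ (1 / (9869 / 1000 * (s0:ℝ) ^ 2)) _ (by positivity) _ hM1
    · rw [hMc]; exact le_max_right _ _
    · rw [mul_pow]
      apply one_div_le_one_div_of_le (by positivity)
      have := pi_sq_ge
      have haa : (s0:ℝ) ^ 2 ≤ σ ^ 2 := by gcongr
      nlinarith [mul_le_mul haa this (by norm_num) (by positivity)]
  · unfold Tc; push_cast; exact q4
  · push_cast at c2; exact c2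
  · unfold ULc UJc UCc at c1
    push_cast at c1
    linarith

lemma num_mid (σ : ℝ) (h1 : 1 / 8 ≤ σ ^ 2) (hσ : 0 < σ) (h2 : σ < 177 / 125) :
    ∃ Mx T : ℝ, 1 ≤ Mx ∧ 1 + 2 * (1 / (σ * Real.pi) ^ 2) ^ 2 - 1 / (σ * Real.pi) ^ 2 ≤ Mx ∧
      27 / 256 * (3 * σ + 1 / σ) / (6 * √6) + σ / 3 * Real.exp (-3) / √(2 * Real.pi) ≤ T ∧ T < 1 / 2 ∧
      QLf σ + QJ σ + QC σ Mx ≤ 3 / 2 * (1 / 2 - T) ^ 2 := by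
  have hl : 44 / 125 ≤ σ := by nlinarith
  have hf0 : (0:ℝ) ≤ 125 * σ := by positivity
  have f1 := Nat.floor_le hf0
  have f2 := Nat.lt_floor_add_one (125 * σ)
  have f3 : 44 ≤ ⌊125 * σ⌋₊ := Nat.le_floor (by push_cast; linarith)
  have f4 : ⌊125 * σ⌋₊ < 177 := by rw [Nat.floor_lt hf0]; push_cast; linarith
  obtain ⟨k, hk⟩ : ∃ k, ⌊125 * σ⌋₊ = k + 44 := ⟨⌊125 * σ⌋₊ - 44, by omega⟩
  rw [hk] at f1 f2 f4
  have hc := cells ⟨k, by omega⟩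
  push_cast at f1 f2
  refine num_cell σ _ _ ?_ ?_ ?_ hc
  · positivity
  · push_cast; linarith
  · push_cast; linarith
end

section
open MeasureTheory ProbabilityTheory Set Filter Topology
open scoped ENNReal NNReal

-- moments of the truncated Gaussian
noncomputable def gm (b S : ℝ) (n : ℕ) : ℝ := ∫ s in (0:ℝ)..S, s ^ n * Real.exp (-b * s ^ 2)

lemma gm_step (b S : ℝ) (hb : 0 < b) (hS : 0 ≤ S) (n : ℕ) : gm b S (n + 2) ≤ (n + 1) / (2 * b) * gm b S n := by
  have hd : ∀ s ∈ uIcc 0 S, HasDerivAt (fun s : ℝ => s ^ (n + 1) * Real.exp (-b * s ^ 2))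
      ((n + 1) * (s ^ n * Real.exp (-b * s ^ 2)) - 2 * b * (s ^ (n + 2) * Real.exp (-b * s ^ 2))) s := by
    intro s _
    have h1 := (hasDerivAt_pow (n + 1) s).mul (((hasDerivAt_pow 2 s).const_mul (-b)).exp)
    refine h1.congr_deriv ?_
    simp; ring
  have h := intervalIntegral.integral_eq_sub_of_hasDerivAt hd (Continuous.intervalIntegrable (by fun_prop) _ _)
  rw [intervalIntegral.integral_sub (Continuous.intervalIntegrable (by fun_prop) _ _) (Continuous.intervalIntegrable (by fun_prop) _ _),
    intervalIntegral.integral_const_mul, intervalIntegral.integral_const_mul] at h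
  have hp : 0 ≤ S ^ (n + 1) * Real.exp (-b * S ^ 2) := by positivity
  unfold gm
  rw [div_mul_eq_mul_div, le_div_iff₀ (by positivity)]
  simp at h
  simp only [neg_mul] at hp ⊢
  linarith

lemma gm_zero (b S : ℝ) (hb : 0 < b) (hS : 0 ≤ S) : gm b S 0 ≤ √(Real.pi / b) / 2 := by
  unfold gm
  simp only [pow_zero, one_mul]
  rw [intervalIntegral.integral_of_le hS, ← integral_gaussian_Ioi]
  apply setIntegral_mono_set (integrable_exp_neg_mul_sq hb).integrableOn
  · exact ae_of_all _ fun _ => (Real.exp_pos _).le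
  · exact Ioc_subset_Ioi_self.eventuallyLE

lemma gm_nonneg (b S : ℝ) (hS : 0 ≤ S) (n : ℕ) : 0 ≤ gm b S n := by
  apply intervalIntegral.integral_nonneg hS
  intro s hs
  have := hs.1
  positivity

lemma sec_bound (θ : ℝ) (hc : 0 ≤ Real.cos θ) (hx : Real.sin θ ^ 2 ≤ 3 / 4) :
    1 ≤ Real.cos θ * (1 + Real.sin θ ^ 2 / 2 + 11112 / 10000 * Real.sin θ ^ 4) := by
  set x := Real.sin θ ^ 2 with hxd
  have hx0 : 0 ≤ x := sq_nonneg _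
  have h4 : Real.sin θ ^ 4 = x ^ 2 := by rw [hxd]; ring
  have hcs : Real.cos θ ^ 2 = 1 - x := by linarith [Real.sin_sq_add_cos_sq θ]
  rw [h4]
  set Y := 1 + x / 2 + 11112 / 10000 * x ^ 2 with hY
  have hY0 : 0 ≤ Y := by positivity
  have : 1 ≤ (Real.cos θ * Y) ^ 2 := by
    rw [mul_pow, hcs]
    have e : (1 - x) * Y ^ 2 - 1 = x ^ 2 * (14724 / 10000 - 13612 / 10000 * x + (1.1112 ^ 2 - 1.1112) * x ^ 2 - 1.1112 ^ 2 * x ^ 3) := by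
      rw [hY]; ring
    have p : 0 ≤ 14724 / 10000 - 13612 / 10000 * x + (1.1112 ^ 2 - 1.1112) * x ^ 2 - 1.1112 ^ 2 * x ^ 3 := by
      have q : 0 ≤ (3 / 4 - x) * (1.96 + 0.8 * x + 1.23 * x ^ 2) := mul_nonneg (by linarith) (by positivity)
      nlinarith [pow_nonneg hx0 3, pow_nonneg hx0 2, mul_nonneg hx0 (sub_nonneg.2 hx), mul_nonneg (pow_nonneg hx0 2) (sub_nonneg.2 hx)]
    have := mul_nonneg (sq_nonneg x) p
    linarith
  have h0 : 0 ≤ Real.cos θ * Y := mul_nonneg hc hY0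
  nlinarith

-- the part of the integral near 0, after the substitution s = sin (u/2)
lemma near_part (a : ℝ) (p : ℝ → ℝ) (hpc : Continuous p) (hp : ∀ s, 0 ≤ p s) :
    ∫ u in (0:ℝ)..(2 * Real.pi / 3), p (Real.sin (u / 2)) * Real.exp (-(4 * a) * Real.sin (u / 2) ^ 2) ≤
    2 * ∫ s in (0:ℝ)..(√3 / 2), p s * (1 + s ^ 2 / 2 + 11112 / 10000 * s ^ 4) * Real.exp (-(4 * a) * s ^ 2) := by
  have hpi := Real.pi_pos
  set g : ℝ → ℝ := fun s => p s * (1 + s ^ 2 / 2 + 11112 / 10000 * s ^ 4) * Real.exp (-(4 * a) * s ^ 2) with hg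
  have hgc : Continuous g := by rw [hg]; fun_prop
  have hs := intervalIntegral.integral_comp_mul_deriv (a := 0) (b := 2 * Real.pi / 3) (f := fun u : ℝ => Real.sin (u / 2))
    (f' := fun u => Real.cos (u / 2) / 2) (g := g) (fun u _ => by
      have := ((hasDerivAt_id u).div_const 2).sin
      refine this.congr_deriv ?_
      simp; ring) (by fun_prop) hgc
  have e1 : Real.sin (2 * Real.pi / 3 / 2) = √3 / 2 := by rw [← Real.sin_pi_div_three]; congr 1; ring
  simp only [e1, zero_div, Real.sin_zero] at hs
  rw [← hs, ← intervalIntegral.integral_const_mul]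
  apply intervalIntegral.integral_mono_on (by positivity) (Continuous.intervalIntegrable (by fun_prop) _ _) (Continuous.intervalIntegrable (by simp only [Function.comp_def]; fun_prop) _ _)
  intro u hu
  simp only [Function.comp, hg]
  have hc : 0 ≤ Real.cos (u / 2) := Real.cos_nonneg_of_neg_pi_div_two_le_of_le (by linarith [hu.1]) (by linarith [hu.2])
  have hsin : Real.sin (u / 2) ^ 2 ≤ 3 / 4 := by
    have h0 : 0 ≤ Real.sin (u / 2) := Real.sin_nonneg_of_nonneg_of_le_pi (by linarith [hu.1]) (by linarith [hu.2])
    have h1 : Real.sin (u / 2) ≤ √3 / 2 := by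
      rw [← Real.sin_pi_div_three]
      exact Real.sin_le_sin_of_le_of_le_pi_div_two (by linarith [hu.1]) (by linarith) (by linarith [hu.2])
    calc Real.sin (u / 2) ^ 2 ≤ (√3 / 2) ^ 2 := by gcongr
      _ = 3 / 4 := by rw [div_pow, Real.sq_sqrt (by norm_num)]; norm_num
  have h := sec_bound (u / 2) hc hsin
  have hq : 0 ≤ p (Real.sin (u / 2)) * Real.exp (-(4 * a) * Real.sin (u / 2) ^ 2) := mul_nonneg (hp _) (Real.exp_pos _).le
  have := mul_le_mul_of_nonneg_left h hq
  refine le_trans (by linarith) (le_trans this (le_of_eq ?_))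
  ring

lemma exp_half (a u : ℝ) : Real.exp (-(a * (1 - Real.cos u))) ^ 2 = Real.exp (-(4 * a) * Real.sin (u / 2) ^ 2) := by
  rw [one_sub_cos_eq, ← Real.exp_nat_mul]; congr 1; push_cast; ring

lemma far_cos (u : ℝ) (h1 : 2 * Real.pi / 3 ≤ u) (h2 : u ≤ Real.pi) : 3 / 2 ≤ 1 - Real.cos u := by
  have := Real.cos_le_cos_of_nonneg_of_le_pi (by positivity) h2 h1
  have e : Real.cos (2 * Real.pi / 3) = -(1 / 2) := by
    rw [show 2 * Real.pi / 3 = Real.pi - Real.pi / 3 by ring, Real.cos_pi_sub, Real.cos_pi_div_three]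
  linarith

lemma I0_ana (a : ℝ) (ha : 0 < a) (M0 : ℝ) (hM0 : √(Real.pi / (4 * a)) / 2 ≤ M0) :
    ∫ u in (0:ℝ)..Real.pi, Real.exp (-(a * (1 - Real.cos u))) ^ 2 ≤
    2 * M0 * (1 + 1 / (16 * a) + 3 * (11112 / 10000) / (64 * a ^ 2)) + Real.pi / 3 * Real.exp (-(3 * a)) := by
  have hpi := Real.pi_pos
  have hS : (0:ℝ) ≤ √3 / 2 := by positivity
  have hb : 0 < 4 * a := by positivity
  rw [← intervalIntegral.integral_add_adjacent_intervals (b := 2 * Real.pi / 3) (Continuous.intervalIntegrable (by fun_prop) _ _) (Continuous.intervalIntegrable (by fun_prop) _ _)]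
  have h1 := near_part a (fun _ => 1) continuous_const (fun _ => zero_le_one)
  simp only [one_mul] at h1
  simp_rw [← exp_half] at h1
  have h2 : ∫ s in (0:ℝ)..(√3 / 2), (1 + s ^ 2 / 2 + 11112 / 10000 * s ^ 4) * Real.exp (-(4 * a) * s ^ 2) =
      gm (4 * a) (√3 / 2) 0 + 1 / 2 * gm (4 * a) (√3 / 2) 2 + 11112 / 10000 * gm (4 * a) (√3 / 2) 4 := by
    unfold gm
    rw [← intervalIntegral.integral_const_mul, ← intervalIntegral.integral_const_mul, ← intervalIntegral.integral_add, ← intervalIntegral.integral_add]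
    · congr 1; ext s; ring
    all_goals exact Continuous.intervalIntegrable (by fun_prop) _ _
  have g0 := gm_zero (4 * a) (√3 / 2) hb hS
  have g2 := gm_step (4 * a) (√3 / 2) hb hS 0
  have g4 := gm_step (4 * a) (√3 / 2) hb hS 2
  have g0n := gm_nonneg (4 * a) (√3 / 2) hS 0
  have g0' := g0.trans hM0
  have g2' : gm (4 * a) (√3 / 2) 2 ≤ 1 / (8 * a) * M0 := by
    refine g2.trans ?_
    calc _ = 1 / (8 * a) * gm (4 * a) (√3 / 2) 0 := by push_cast; ring
      _ ≤ _ := by gcongr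
  have g4' : gm (4 * a) (√3 / 2) 4 ≤ 3 / (64 * a ^ 2) * M0 := by
    refine g4.trans ?_
    calc _ = 3 / (8 * a) * gm (4 * a) (√3 / 2) 2 := by push_cast; ring
      _ ≤ 3 / (8 * a) * (1 / (8 * a) * M0) := by gcongr
      _ = _ := by field_simp; ring
  have h3 : ∫ u in (2 * Real.pi / 3)..Real.pi, Real.exp (-(a * (1 - Real.cos u))) ^ 2 ≤ Real.pi / 3 * Real.exp (-(3 * a)) := by
    calc _ ≤ ∫ u in (2 * Real.pi / 3)..Real.pi, Real.exp (-(3 * a)) := by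
          apply intervalIntegral.integral_mono_on (by linarith) (Continuous.intervalIntegrable (by fun_prop) _ _) (by simp)
          intro u hu
          rw [← Real.exp_nat_mul]
          apply Real.exp_le_exp.2
          have := mul_le_mul_of_nonneg_left (far_cos u hu.1 hu.2) ha.le
          push_cast; linarith
      _ = _ := by simp; ring
  rw [h2] at h1
  have e : 2 * M0 * (1 + 1 / (16 * a) + 3 * (11112 / 10000) / (64 * a ^ 2)) =
    2 * (M0 + 1 / 2 * (1 / (8 * a) * M0) + 11112 / 10000 * (3 / (64 * a ^ 2) * M0)) := by field_simp; ring
  rw [e]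
  linarith

lemma I01_ana (a : ℝ) (ha : 0 < a) (M0 : ℝ) (hM0 : √(Real.pi / (4 * a)) / 2 ≤ M0) :
    ∫ u in (0:ℝ)..Real.pi, (1 + a * (1 - Real.cos u)) * Real.exp (-(a * (1 - Real.cos u))) ^ 2 ≤
    2 * M0 * (5 / 4 + 7 / (64 * a) + (3 * (11112 / 10000) / 64 + 15 * (11112 / 10000) / 256) / a ^ 2) + Real.pi / 3 * ((1 + 3 / 2 * a) * Real.exp (-(3 * a))) := by
  have hpi := Real.pi_pos
  have hS : (0:ℝ) ≤ √3 / 2 := by positivity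
  have hb : 0 < 4 * a := by positivity
  rw [← intervalIntegral.integral_add_adjacent_intervals (b := 2 * Real.pi / 3) (Continuous.intervalIntegrable (by fun_prop) _ _) (Continuous.intervalIntegrable (by fun_prop) _ _)]
  have h1 := near_part a (fun s => 1 + 2 * a * s ^ 2) (by fun_prop) (fun _ => by positivity)
  have ee : ∀ u : ℝ, (1 + a * (1 - Real.cos u)) * Real.exp (-(a * (1 - Real.cos u))) ^ 2 =
      (1 + 2 * a * Real.sin (u / 2) ^ 2) * Real.exp (-(4 * a) * Real.sin (u / 2) ^ 2) := by
    intro u; rw [exp_half, one_sub_cos_eq]; ring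
  simp_rw [← ee] at h1
  have h2 : ∫ s in (0:ℝ)..(√3 / 2), (1 + 2 * a * s ^ 2) * (1 + s ^ 2 / 2 + 11112 / 10000 * s ^ 4) * Real.exp (-(4 * a) * s ^ 2) =
      gm (4 * a) (√3 / 2) 0 + (1 / 2 + 2 * a) * gm (4 * a) (√3 / 2) 2 + (11112 / 10000 + a) * gm (4 * a) (√3 / 2) 4
        + 2 * a * (11112 / 10000) * gm (4 * a) (√3 / 2) 6 := by
    unfold gm
    rw [← intervalIntegral.integral_const_mul, ← intervalIntegral.integral_const_mul, ← intervalIntegral.integral_const_mul,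
      ← intervalIntegral.integral_add, ← intervalIntegral.integral_add, ← intervalIntegral.integral_add]
    · congr 1; ext s; ring
    all_goals exact Continuous.intervalIntegrable (by fun_prop) _ _
  have g0 := gm_zero (4 * a) (√3 / 2) hb hS
  have g2 := gm_step (4 * a) (√3 / 2) hb hS 0
  have g4 := gm_step (4 * a) (√3 / 2) hb hS 2
  have g6 := gm_step (4 * a) (√3 / 2) hb hS 4
  have g0n := gm_nonneg (4 * a) (√3 / 2) hS 0
  have g0' := g0.trans hM0
  have g2' : gm (4 * a) (√3 / 2) 2 ≤ 1 / (8 * a) * M0 := by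
    refine g2.trans ?_
    calc _ = 1 / (8 * a) * gm (4 * a) (√3 / 2) 0 := by push_cast; ring
      _ ≤ _ := by gcongr
  have g4' : gm (4 * a) (√3 / 2) 4 ≤ 3 / (64 * a ^ 2) * M0 := by
    refine g4.trans ?_
    calc _ = 3 / (8 * a) * gm (4 * a) (√3 / 2) 2 := by push_cast; ring
      _ ≤ 3 / (8 * a) * (1 / (8 * a) * M0) := by gcongr
      _ = _ := by field_simp; ring
  have g6' : gm (4 * a) (√3 / 2) 6 ≤ 15 / (512 * a ^ 3) * M0 := by
    refine g6.trans ?_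
    calc _ = 5 / (8 * a) * gm (4 * a) (√3 / 2) 4 := by push_cast; ring
      _ ≤ 5 / (8 * a) * (3 / (64 * a ^ 2) * M0) := by gcongr
      _ = _ := by field_simp; ring
  have h3 : ∫ u in (2 * Real.pi / 3)..Real.pi, (1 + a * (1 - Real.cos u)) * Real.exp (-(a * (1 - Real.cos u))) ^ 2 ≤
      Real.pi / 3 * ((1 + 3 / 2 * a) * Real.exp (-(3 * a))) := by
    calc _ ≤ ∫ u in (2 * Real.pi / 3)..Real.pi, (1 + 3 / 2 * a) * Real.exp (-(3 * a)) := by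
          apply intervalIntegral.integral_mono_on (by linarith) (Continuous.intervalIntegrable (by fun_prop) _ _) (by simp)
          intro u hu
          have hc := mul_le_mul_of_nonneg_left (far_cos u hu.1 hu.2) ha.le
          have h1 := FF_anti 1 one_pos (a := a * (3 / 2)) (b := a * (1 - Real.cos u)) (mem_Ici.2 (by positivity))
            (mem_Ici.2 (le_trans (by positivity) hc)) hc
          unfold FF at h1
          have h2 := le_of_mul_le_mul_left h1 (by positivity)
          refine h2.trans (le_of_eq ?_)
          rw [← Real.exp_nat_mul]
          congr 1
          · ring
          · congr 1; push_cast; ring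
      _ = _ := by simp; ring
  rw [h2] at h1
  have e : 2 * M0 * (5 / 4 + 7 / (64 * a) + (3 * (11112 / 10000) / 64 + 15 * (11112 / 10000) / 256) / a ^ 2) =
    2 * (M0 + (1 / 2 + 2 * a) * (1 / (8 * a) * M0) + (11112 / 10000 + a) * (3 / (64 * a ^ 2) * M0) + 2 * a * (11112 / 10000) * (15 / (512 * a ^ 3) * M0)) := by
    field_simp; ring
  rw [e]
  have k1 := mul_le_mul_of_nonneg_left g2' (by positivity : 0 ≤ 1 / 2 + 2 * a)
  have k2 := mul_le_mul_of_nonneg_left g4' (by positivity : 0 ≤ 11112 / 10000 + a)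
  have k3 := mul_le_mul_of_nonneg_left g6' (by positivity : 0 ≤ 2 * a * (11112 / 10000))
  linarith
end

section
open MeasureTheory ProbabilityTheory Set Filter Topology
open scoped ENNReal NNReal

lemma dec_exp (n : ℕ) (c s0 σ : ℝ) (h0 : 0 < s0) (h : s0 ≤ σ) (hc : n ≤ 2 * c * s0 ^ 2) :
    σ ^ n * Real.exp (-(c * σ ^ 2)) ≤ s0 ^ n * Real.exp (-(c * s0 ^ 2)) := by
  have hσ : 0 < σ := h0.trans_le h
  have e1 : σ / s0 ≤ Real.exp (((σ / s0) ^ 2 - 1) / 2) := by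
    have := Real.add_one_le_exp (((σ / s0) ^ 2 - 1) / 2)
    nlinarith [sq_nonneg (σ / s0 - 1)]
  have e2 : (σ / s0) ^ n ≤ Real.exp (c * (σ ^ 2 - s0 ^ 2)) := by
    calc (σ / s0) ^ n ≤ Real.exp (((σ / s0) ^ 2 - 1) / 2) ^ n := by gcongr
      _ = Real.exp (n * (((σ / s0) ^ 2 - 1) / 2)) := by rw [← Real.exp_nat_mul]
      _ ≤ _ := by
        apply Real.exp_le_exp.2
        have hh : (0:ℝ) ≤ ((σ / s0) ^ 2 - 1) / 2 := by
          have : 1 ≤ σ / s0 := by rw [one_le_div h0]; exact h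
          nlinarith
        calc (n:ℝ) * (((σ / s0) ^ 2 - 1) / 2) ≤ 2 * c * s0 ^ 2 * (((σ / s0) ^ 2 - 1) / 2) := by gcongr
          _ = _ := by field_simp
  calc σ ^ n * Real.exp (-(c * σ ^ 2)) = s0 ^ n * ((σ / s0) ^ n * Real.exp (-(c * σ ^ 2))) := by
        rw [div_pow]; field_simp
    _ ≤ s0 ^ n * (Real.exp (c * (σ ^ 2 - s0 ^ 2)) * Real.exp (-(c * σ ^ 2))) := by gcongr
    _ = _ := by rw [← Real.exp_add]; congr 2; ring

lemma M0_eq (σ : ℝ) (hσ : 0 < σ) : √(Real.pi / (4 * σ ^ 2)) / 2 = √Real.pi / (4 * σ) := by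
  rw [Real.sqrt_div Real.pi_pos.le, show 4 * σ ^ 2 = (2 * σ) ^ 2 by ring, Real.sqrt_sq (by positivity)]
  field_simp; norm_num

lemma sqrtpi_le : √Real.pi ≤ 177246 / 100000 := by
  rw [Real.sqrt_le_left (by norm_num)]; linarith [Real.pi_lt_d6]

lemma sqrt2pi_le : √2 * √Real.pi / 2 ≤ 125332 / 100000 := by
  rw [← Real.sqrt_mul (by norm_num), div_le_iff₀ (by norm_num), Real.sqrt_le_left (by norm_num)]
  linarith [Real.pi_lt_d6]

set_option maxHeartbeats 2000000 in
lemma QA_bound (s0 σ D3 D5 : ℝ) (h0 : 1 ≤ s0) (h : s0 ≤ σ) (hD3 : Real.exp (-(3 * s0 ^ 2)) ≤ D3) (hD5 : Real.exp (-(5 * s0 ^ 2)) ≤ D5) :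
    QLf σ + QJ σ + QC σ 1 ≤
      125332 / 100000 * (1 / 16 + 3 * (11112 / 10000) / 64 / s0 ^ 2) + 141422 / 100000 * (10472 / 10000) * (s0 ^ 3 * D3)
      + 141422 / 100000 / (9869 / 1000) * (177246 / 200000 * (5 / 4 + 7 / 64 / s0 ^ 2 + (3 * (11112 / 10000) / 64 + 15 * (11112 / 10000) / 256) / (s0 ^ 2) ^ 2)
        + 10472 / 10000 * ((s0 + 3 / 2 * s0 ^ 3) * D3))
      + 141422 / 100000 * (s0 * D5) * (1 / (2 * (314159 / 100000)) + 1 / (314159 / 100000) + 1 / (3 / 2 * (314159 / 100000))) := by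
  have h0' : 0 < s0 := by linarith
  have hσ : 0 < σ := h0'.trans_le h
  have hσ1 : 1 ≤ σ := h0.trans h
  have hpi := Real.pi_pos
  have hpu := pi_le'
  have hpl := pi_ge'
  have hp2 := pi_sq_ge
  have hr2 := sqrt2_le
  have hsp := sqrtpi_le
  have hs2p := sqrt2pi_le
  have haa : s0 ^ 2 ≤ σ ^ 2 := by gcongr
  have hs1 : 1 ≤ s0 ^ 2 := by nlinarith
  have hD3p : 0 < D3 := (Real.exp_pos _).trans_le hD3
  have hD5p : 0 < D5 := (Real.exp_pos _).trans_le hD5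
  have d33 : σ ^ 3 * Real.exp (-(3 * σ ^ 2)) ≤ s0 ^ 3 * D3 :=
    (dec_exp 3 3 s0 σ h0' h (by push_cast; linarith)).trans (by gcongr)
  have d13 : σ * Real.exp (-(3 * σ ^ 2)) ≤ s0 * D3 := by
    have := dec_exp 1 3 s0 σ h0' h (by push_cast; linarith)
    simp only [pow_one] at this
    exact this.trans (by gcongr)
  have d15 : σ * Real.exp (-(5 * σ ^ 2)) ≤ s0 * D5 := by
    have := dec_exp 1 5 s0 σ h0' h (by push_cast; linarith)
    simp only [pow_one] at this
    exact this.trans (by gcongr)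
  have hM := (M0_eq σ hσ).le
  have hsq : 0 < σ ^ 2 := by positivity
  have L := QLf_le σ hσ _ (I0_ana (σ ^ 2) hsq _ hM)
  have J := QJ_le σ hσ _ (I01_ana (σ ^ 2) hsq _ hM)
  have L1 : QLf σ ≤ √2 * √Real.pi / 2 * (1 / 16 + 3 * (11112 / 10000) / 64 / σ ^ 2) + √2 * (Real.pi / 3) * (σ ^ 3 * Real.exp (-(3 * σ ^ 2)))
      + √2 * (σ * Real.exp (-(σ ^ 2 * Real.pi ^ 2))) * (1 / (2 * Real.pi)) := by
    refine L.trans (le_of_eq ?_)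
    field_simp
    ring
  have J1 : QJ σ ≤ √2 / Real.pi ^ 2 * (√Real.pi / 2 * (5 / 4 + 7 / 64 / σ ^ 2 + (3 * (11112 / 10000) / 64 + 15 * (11112 / 10000) / 256) / (σ ^ 2) ^ 2)
        + Real.pi / 3 * (σ * Real.exp (-(3 * σ ^ 2)) + 3 / 2 * (σ ^ 3 * Real.exp (-(3 * σ ^ 2))))) := by
    refine J.trans (le_of_eq ?_)
    field_simp
    ring
  have x1 : Real.exp (-(σ ^ 2 * Real.pi ^ 2)) ≤ Real.exp (-(5 * σ ^ 2)) := Real.exp_le_exp.2 (by nlinarith)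
  have x2 : Real.exp (-(σ ^ 2)) * Real.exp (-(σ ^ 2 * Real.pi ^ 2) / 2) ≤ Real.exp (-(5 * σ ^ 2)) := by
    rw [← Real.exp_add]; exact Real.exp_le_exp.2 (by nlinarith)
  have x3 : Real.exp (-(σ ^ 2 * (3 / 2 * Real.pi) ^ 2) / 2) ≤ Real.exp (-(5 * σ ^ 2)) := Real.exp_le_exp.2 (by nlinarith)
  have hx := Real.exp_pos (-(5 * σ ^ 2))
  have y1 : σ * Real.exp (-(σ ^ 2 * Real.pi ^ 2)) ≤ s0 * D5 := le_trans (by gcongr) d15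
  have y2 : σ * (Real.exp (-(σ ^ 2)) * Real.exp (-(σ ^ 2 * Real.pi ^ 2) / 2)) ≤ s0 * D5 := le_trans (by gcongr) d15
  have y3 : σ * Real.exp (-(σ ^ 2 * (3 / 2 * Real.pi) ^ 2) / 2) ≤ s0 * D5 := le_trans (by gcongr) d15
  have C1 : QC σ 1 = √2 * (σ * (Real.exp (-(σ ^ 2)) * Real.exp (-(σ ^ 2 * Real.pi ^ 2) / 2))) * (1 / Real.pi) +
      √2 * (σ * Real.exp (-(σ ^ 2 * (3 / 2 * Real.pi) ^ 2) / 2)) * (1 / (3 / 2 * Real.pi)) := by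
    unfold QC; ring
  have C2 : √2 * (σ * (Real.exp (-(σ ^ 2)) * Real.exp (-(σ ^ 2 * Real.pi ^ 2) / 2))) * (1 / Real.pi) ≤ 141422 / 100000 * (s0 * D5) * (1 / (314159 / 100000)) := by
    gcongr
  have C3 : √2 * (σ * Real.exp (-(σ ^ 2 * (3 / 2 * Real.pi) ^ 2) / 2)) * (1 / (3 / 2 * Real.pi)) ≤ 141422 / 100000 * (s0 * D5) * (1 / (3 / 2 * (314159 / 100000))) := by
    gcongr
  have L2 : √2 * (σ * Real.exp (-(σ ^ 2 * Real.pi ^ 2))) * (1 / (2 * Real.pi)) ≤ 141422 / 100000 * (s0 * D5) * (1 / (2 * (314159 / 100000))) := by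
    gcongr
  have L3 : √2 * √Real.pi / 2 * (1 / 16 + 3 * (11112 / 10000) / 64 / σ ^ 2) ≤ 125332 / 100000 * (1 / 16 + 3 * (11112 / 10000) / 64 / s0 ^ 2) := by
    gcongr
  have hpi3 : Real.pi / 3 ≤ 10472 / 10000 := by linarith
  have L4 : √2 * (Real.pi / 3) * (σ ^ 3 * Real.exp (-(3 * σ ^ 2))) ≤ 141422 / 100000 * (10472 / 10000) * (s0 ^ 3 * D3) := by
    gcongr
  have hsp2 : √Real.pi / 2 ≤ 177246 / 200000 := by linarith
  have J2 : σ * Real.exp (-(3 * σ ^ 2)) + 3 / 2 * (σ ^ 3 * Real.exp (-(3 * σ ^ 2))) ≤ (s0 + 3 / 2 * s0 ^ 3) * D3 := by linarith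
  have J3 : √2 / Real.pi ^ 2 * (√Real.pi / 2 * (5 / 4 + 7 / 64 / σ ^ 2 + (3 * (11112 / 10000) / 64 + 15 * (11112 / 10000) / 256) / (σ ^ 2) ^ 2)
        + Real.pi / 3 * (σ * Real.exp (-(3 * σ ^ 2)) + 3 / 2 * (σ ^ 3 * Real.exp (-(3 * σ ^ 2))))) ≤
      141422 / 100000 / (9869 / 1000) * (177246 / 200000 * (5 / 4 + 7 / 64 / s0 ^ 2 + (3 * (11112 / 10000) / 64 + 15 * (11112 / 10000) / 256) / (s0 ^ 2) ^ 2)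
        + 10472 / 10000 * ((s0 + 3 / 2 * s0 ^ 3) * D3)) := by
    gcongr
  linarith

lemma exp_neg_nat (n : ℕ) (x : ℝ) (hx : (n:ℝ) ≤ x) : Real.exp (-x) ≤ 1 / (27 / 10 : ℝ) ^ n := by
  have : Real.exp (-x) ≤ Real.exp (-(n:ℝ)) := Real.exp_le_exp.2 (by linarith)
  refine this.trans ?_
  rw [Real.exp_neg, inv_eq_one_div]
  apply one_div_le_one_div_of_le (by positivity)
  have e : Real.exp (n:ℝ) = Real.exp 1 ^ n := by rw [← Real.exp_nat_mul, mul_one]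
  rw [e]
  have := Real.exp_one_gt_d9
  gcongr
  linarith

lemma num_c1 (σ : ℝ) (h : 177 / 125 ≤ σ) (h2 : σ ≤ 17 / 10) :
    27 / 256 * (3 * σ + 1 / σ) / (6 * √6) + σ / 3 * Real.exp (-3) / √(2 * Real.pi) ≤ 53 / 1000 ∧
    QLf σ + QJ σ + QC σ 1 ≤ 3 / 2 * (1 / 2 - 53 / 1000) ^ 2 := by
  constructor
  · exact (T_le σ (177 / 125) (17 / 10) (by norm_num) h h2).trans (by norm_num)
  · refine (QA_bound (177 / 125) σ (1 / (27 / 10) ^ 6) (1 / (27 / 10) ^ 10) (by norm_num) h (exp_neg_nat 6 _ (by norm_num)) (exp_neg_nat 10 _ (by norm_num))).trans ?_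
    norm_num

lemma num_c2 (σ : ℝ) (h : 17 / 10 ≤ σ) (h2 : σ ≤ 23 / 10) :
    27 / 256 * (3 * σ + 1 / σ) / (6 * √6) + σ / 3 * Real.exp (-3) / √(2 * Real.pi) ≤ 69 / 1000 ∧
    QLf σ + QJ σ + QC σ 1 ≤ 3 / 2 * (1 / 2 - 69 / 1000) ^ 2 := by
  constructor
  · exact (T_le σ (17 / 10) (23 / 10) (by norm_num) h h2).trans (by norm_num)
  · refine (QA_bound (17 / 10) σ (1 / (27 / 10) ^ 8) (1 / (27 / 10) ^ 10) (by norm_num) h (exp_neg_nat 8 _ (by norm_num)) (exp_neg_nat 10 _ (by norm_num))).trans ?_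
    norm_num

lemma num_c3 (σ : ℝ) (h : 23 / 10 ≤ σ) (h2 : σ ≤ 27 / 10) :
    27 / 256 * (3 * σ + 1 / σ) / (6 * √6) + σ / 3 * Real.exp (-3) / √(2 * Real.pi) ≤ 80 / 1000 ∧
    QLf σ + QJ σ + QC σ 1 ≤ 3 / 2 * (1 / 2 - 80 / 1000) ^ 2 := by
  constructor
  · exact (T_le σ (23 / 10) (27 / 10) (by norm_num) h h2).trans (by norm_num)
  · refine (QA_bound (23 / 10) σ (1 / (27 / 10) ^ 15) (1 / (27 / 10) ^ 15) (by norm_num) h (exp_neg_nat 15 _ (by norm_num)) (exp_neg_nat 15 _ (by norm_num))).trans ?_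
    norm_num

lemma num_c4 (σ : ℝ) (h : 27 / 10 ≤ σ) : QLf σ + QJ σ + QC σ 1 ≤ 1 / 4 := by
  refine (QA_bound (27 / 10) σ (1 / (27 / 10) ^ 20) (1 / (27 / 10) ^ 20) (by norm_num) h (exp_neg_nat 20 _ (by norm_num)) (exp_neg_nat 20 _ (by norm_num))).trans ?_
  norm_num

lemma mx_one (σ : ℝ) (h : 1 ≤ σ) : 1 + 2 * (1 / (σ * Real.pi) ^ 2) ^ 2 - 1 / (σ * Real.pi) ^ 2 ≤ 1 := by
  have hp := Real.pi_gt_three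
  have h1 : 1 / (σ * Real.pi) ^ 2 ≤ 1 / 2 := by
    apply one_div_le_one_div_of_le (by norm_num)
    have : 3 ≤ σ * Real.pi := by nlinarith
    nlinarith
  have h0 : 0 ≤ 1 / (σ * Real.pi) ^ 2 := by positivity
  nlinarith

theorem core (m : Measure ℝ) [IsFiniteMeasure m] (P : Measure ℝ) [IsProbabilityMeasure P]
    (hm : ∀ᵐ y ∂m, y ≠ 0 ∧ |y| ≤ 1) (hP : ∀ u, charFn P u = Complex.exp (Psi m u))
    (σ : ℝ) (hσ : 0 < σ) (ha : m.real univ = σ ^ 2) (h8 : 1 / 8 ≤ σ ^ 2) :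
    wasserstein 1 P (gaussianReal 0 (Real.toNNReal (σ ^ 2))) ≤ ENNReal.ofReal (1 / 2) := by
  obtain ⟨hP4, hP4'⟩ := moment4 m P hm hP
  rw [ha] at hP4'
  have hpi3 := Real.pi_gt_three
  have h3 : 1 / (σ * (3 / 2 * Real.pi)) ^ 2 ≤ 1 / 2 := by
    apply one_div_le_one_div_of_le (by norm_num)
    rw [mul_pow]
    nlinarith [mul_le_mul h8 (show (81/4:ℝ) ≤ (3 / 2 * Real.pi) ^ 2 by nlinarith) (by norm_num) (by positivity)]
  have hQ : ∀ Mx : ℝ, 1 ≤ Mx → 1 + 2 * (1 / (σ * Real.pi) ^ 2) ^ 2 - 1 / (σ * Real.pi) ^ 2 ≤ Mx →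
      ∫⁻ u in Ioi 0, ENNReal.ofReal (Kf P (gaussianReal 0 (Real.toNNReal (σ ^ 2))) (√2 * σ) u) ≤ ENNReal.ofReal (max 0 (QLf σ + QJ σ + QC σ Mx)) := by
    intro Mx h1 h2
    refine (K_total m P hm hP hP4 σ hσ ha (QLf σ) (QJ σ + QC σ Mx) (fun η hη hη1 => low_bound m hm σ hσ ha η hη hη1)
      (fun M hM => high_bound m hm σ hσ ha Mx h1 h2 h3 M hM)).trans ?_
    apply ENNReal.ofReal_le_ofReal
    rw [← add_assoc]; exact le_max_right _ _
  have tr : ∀ Mx T : ℝ, 1 ≤ Mx → 1 + 2 * (1 / (σ * Real.pi) ^ 2) ^ 2 - 1 / (σ * Real.pi) ^ 2 ≤ Mx →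
      27 / 256 * (3 * σ + 1 / σ) / (6 * √6) + σ / 3 * Real.exp (-3) / √(2 * Real.pi) ≤ T → T < 1 / 2 →
      QLf σ + QJ σ + QC σ Mx ≤ 3 / 2 * (1 / 2 - T) ^ 2 →
      wasserstein 1 P (gaussianReal 0 (Real.toNNReal (σ ^ 2))) ≤ ENNReal.ofReal (1 / 2) := by
    intro Mx T h1 h2 hT hT2 hQT
    exact red_tr P σ hσ hP4 hP4' _ T (le_max_left _ _) (hQ Mx h1 h2) hT hT2 (max_le (by positivity) hQT)
  rcases lt_or_ge σ (177 / 125) with c | c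
  · obtain ⟨Mx, T, h1, h2, hT, hT2, hQT⟩ := num_mid σ h8 hσ c
    exact tr Mx T h1 h2 hT hT2 hQT
  have hm1 := mx_one σ (by linarith)
  rcases le_total σ (17 / 10) with c1 | c1
  · obtain ⟨a, b⟩ := num_c1 σ c c1
    exact tr 1 _ le_rfl hm1 a (by norm_num) b
  rcases le_total σ (23 / 10) with c2 | c2
  · obtain ⟨a, b⟩ := num_c2 σ c1 c2
    exact tr 1 _ le_rfl hm1 a (by norm_num) b
  rcases le_total σ (27 / 10) with c3 | c3
  · obtain ⟨a, b⟩ := num_c3 σ c2 c3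
    exact tr 1 _ le_rfl hm1 a (by norm_num) b
  · exact red_untr P hP4 _ (√2 * σ) _ (by positivity) (le_max_left _ _) (hQ 1 le_rfl hm1) (max_le (by norm_num) (num_c4 σ c3))
end

section
open MeasureTheory ProbabilityTheory Set Filter Topology
open scoped ENNReal NNReal

lemma wass_one_indep (P : Measure ℝ) [IsProbabilityMeasure P] (σ : ℝ) (hσ : 0 < σ)
    (hi : Integrable (fun x => x ^ 2) P) (hle : ∫ x, x ^ 2 ∂P ≤ σ ^ 2) :
    wasserstein 1 P (gaussianReal 0 (Real.toNNReal (σ ^ 2))) ≤ ENNReal.ofReal (Real.sqrt 2 * σ) := by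
  set G := gaussianReal 0 (Real.toNNReal (σ ^ 2)) with hG
  have hmemG : MemLp (fun x : ℝ => x) 2 G := memLp_id_gaussianReal 2
  have hiG : Integrable (fun x : ℝ => x ^ 2) G := hmemG.integrable_sq
  have hmemP : MemLp (fun x : ℝ => x) 2 P := (memLp_two_iff_integrable_sq (by fun_prop)).2 hi
  have hi1P : Integrable (fun x : ℝ => x) P := hmemP.integrable (by norm_num)
  have hi1G : Integrable (fun x : ℝ => x) G := hmemG.integrable (by norm_num)
  have hGm : ∫ x, x ∂G = 0 := integral_id_gaussianReal
  have hGv : ∫ x, x ^ 2 ∂G = σ ^ 2 := by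
    have h1 := variance_eq_sub hmemG
    have h2 : Var[fun x : ℝ => x; G] = Real.toNNReal (σ ^ 2) := variance_fun_id_gaussianReal
    rw [h2, hGm, Real.coe_toNNReal _ (sq_nonneg σ)] at h1
    simp only [Pi.pow_apply] at h1
    linarith
  set c := Real.sqrt 2 * σ with hc
  have hc0 : 0 < c := by positivity
  have hc2 : c ^ 2 = 2 * σ ^ 2 := by rw [hc, mul_pow, Real.sq_sqrt (by norm_num)]
  refine (wasserstein_one_le_coupling P G (P.prod G) (by simp [Measure.map_fst_prod]) (by simp [Measure.map_snd_prod])).trans ?_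
  have i1 : Integrable (fun z : ℝ × ℝ => z.1 ^ 2) (P.prod G) := hi.comp_fst G
  have i2 : Integrable (fun z : ℝ × ℝ => z.2 ^ 2) (P.prod G) := hiG.comp_snd P
  have i3 : Integrable (fun z : ℝ × ℝ => z.1 * z.2) (P.prod G) := hi1P.mul_prod hi1G
  have e3 : ∫ z : ℝ × ℝ, z.1 * z.2 ∂(P.prod G) = 0 := by
    rw [integral_prod_mul (fun x : ℝ => x) (fun x : ℝ => x), hGm, mul_zero]
  have e1 : ∫ z : ℝ × ℝ, z.1 ^ 2 ∂(P.prod G) = ∫ x, x ^ 2 ∂P := by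
    simpa using integral_fun_fst (μ := P) (ν := G) (fun x : ℝ => x ^ 2)
  have e2 : ∫ z : ℝ × ℝ, z.2 ^ 2 ∂(P.prod G) = σ ^ 2 := by
    rw [← hGv]; simpa using integral_fun_snd (μ := P) (ν := G) (fun x : ℝ => x ^ 2)
  have i4 : Integrable (fun z : ℝ × ℝ => (z.1 ^ 2 + z.2 ^ 2 - 2 * (z.1 * z.2)) / (2 * c) + c / 2) (P.prod G) :=
    (((i1.add i2).sub (i3.const_mul 2)).div_const _).add (integrable_const _)
  have pt : ∀ z : ℝ × ℝ, |z.1 - z.2| ≤ (z.1 ^ 2 + z.2 ^ 2 - 2 * (z.1 * z.2)) / (2 * c) + c / 2 := by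
    intro z
    have h : (z.1 ^ 2 + z.2 ^ 2 - 2 * (z.1 * z.2)) / (2 * c) + c / 2 - |z.1 - z.2| = (|z.1 - z.2| - c) ^ 2 / (2 * c) := by
      have h2 := sq_abs (z.1 - z.2)
      field_simp
      linear_combination (-1) * h2
    have : 0 ≤ (|z.1 - z.2| - c) ^ 2 / (2 * c) := by positivity
    linarith
  calc ∫⁻ z, ENNReal.ofReal |z.1 - z.2| ∂(P.prod G)
      ≤ ∫⁻ z : ℝ × ℝ, ENNReal.ofReal ((z.1 ^ 2 + z.2 ^ 2 - 2 * (z.1 * z.2)) / (2 * c) + c / 2) ∂(P.prod G) :=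
        lintegral_mono fun z => ENNReal.ofReal_le_ofReal (pt z)
    _ = ENNReal.ofReal (∫ z : ℝ × ℝ, (z.1 ^ 2 + z.2 ^ 2 - 2 * (z.1 * z.2)) / (2 * c) + c / 2 ∂(P.prod G)) :=
        (ofReal_integral_eq_lintegral_ofReal i4 (ae_of_all _ fun z => (abs_nonneg _).trans (pt z))).symm
    _ ≤ ENNReal.ofReal c := by
        apply ENNReal.ofReal_le_ofReal
        have : ∫ z : ℝ × ℝ, (z.1 ^ 2 + z.2 ^ 2 - 2 * (z.1 * z.2)) / (2 * c) + c / 2 ∂(P.prod G)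
            = (∫ x, x ^ 2 ∂P + σ ^ 2) / (2 * c) + c / 2 := by
          have j1 : Integrable (fun z : ℝ × ℝ => z.1 ^ 2 + z.2 ^ 2) (P.prod G) := i1.add i2
          have j2 : Integrable (fun z : ℝ × ℝ => z.1 ^ 2 + z.2 ^ 2 - 2 * (z.1 * z.2)) (P.prod G) := j1.sub (i3.const_mul 2)
          rw [integral_add (j2.div_const _) (integrable_const _),
            integral_div, integral_sub j1 (i3.const_mul 2), integral_add i1 i2, integral_const_mul, e1, e2, e3]
          simp
        rw [this]
        have : (∫ x, x ^ 2 ∂P + σ ^ 2) / (2 * c) ≤ c / 2 := by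
          rw [div_le_iff₀ (by positivity)]; nlinarith
        linarith

lemma wass_scale (P G : Measure ℝ) (ε : ℝ) (hε : 0 < ε) :
    wasserstein 1 (P.map (fun x => ε * x)) (G.map (fun x => ε * x)) ≤ ENNReal.ofReal ε * wasserstein 1 P G := by
  have hne : ENNReal.ofReal ε ≠ 0 := by simpa using hε
  rw [mul_comm, ← ENNReal.div_le_iff hne ENNReal.ofReal_ne_top]
  conv_rhs => unfold wasserstein wassersteinCost
  refine le_iInf₂ fun π hπ => ?_
  obtain ⟨hp, h1, h2⟩ := hπ
  rw [ENNReal.div_le_iff hne ENNReal.ofReal_ne_top]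
  have hm : Measurable (fun z : ℝ × ℝ => (ε * z.1, ε * z.2)) := by fun_prop
  have := Measure.isProbabilityMeasure_map (μ := π) hm.aemeasurable
  refine (wasserstein_one_le_coupling _ _ (π.map (fun z : ℝ × ℝ => (ε * z.1, ε * z.2))) ?_ ?_).trans ?_
  · rw [Measure.map_map (by fun_prop) hm, ← h1, Measure.map_map (by fun_prop) (by fun_prop)]; rfl
  · rw [Measure.map_map (by fun_prop) hm, ← h2, Measure.map_map (by fun_prop) (by fun_prop)]; rfl
  · rw [lintegral_map (by fun_prop) hm]
    simp only [ENNReal.rpow_one, div_one]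
    rw [mul_comm, ← lintegral_const_mul _ (by fun_prop)]
    refine lintegral_mono fun z => ?_
    simp only
    rw [← ENNReal.ofReal_mul hε.le, ← mul_sub, abs_mul, abs_of_pos hε]

lemma final_two (ν : Measure ℝ) (hν0 : ν {0} = 0)
    (hνlevy : ∫⁻ x, ENNReal.ofReal (min (x ^ 2) 1) ∂ν ≠ ⊤)
    (ε t : ℝ) (hε0 : 0 < ε) (hε1 : ε ≤ 1) (ht : 0 < t)
    (s2 : ℝ) (hs2 : s2 = ∫ x in {x : ℝ | |x| ≤ ε}, x ^ 2 ∂ν) (hs2pos : 0 < s2)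
    (ρt : Measure ℝ) (hρtP : IsProbabilityMeasure ρt)
    (hρt : ∀ u : ℝ, charFn ρt u = Complex.exp ((t : ℂ) *
      ∫ x in {x : ℝ | |x| ≤ ε}, lkIntegrandC u x ∂ν)) :
    wasserstein 1 ρt (gaussianReal 0 (Real.toNNReal (t * s2)))
        ≤ ENNReal.ofReal (min (2 * Real.sqrt (t * s2)) (ε / 2)) := by
  set S := {x : ℝ | |x| ≤ ε} with hS
  have hSm : MeasurableSet S := measurableSet_le (by fun_prop) (by fun_prop)
  set νS := ν.restrict S with hνS
  have hSae : ∀ᵐ x ∂νS, |x| ≤ ε := ae_restrict_mem hSm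
  have hIntg : Integrable (fun x : ℝ => x ^ 2) νS := by
    refine ⟨by fun_prop, ?_⟩
    rw [hasFiniteIntegral_iff_ofReal (ae_of_all _ fun x => sq_nonneg x)]
    refine lt_of_le_of_lt ?_ (lt_top_iff_ne_top.2 hνlevy)
    refine le_trans (lintegral_mono_ae ?_) (lintegral_mono' Measure.restrict_le_self le_rfl)
    filter_upwards [hSae] with x hx
    apply ENNReal.ofReal_le_ofReal
    have : x ^ 2 ≤ 1 := by rw [← sq_abs]; nlinarith [abs_nonneg x]
    exact le_min le_rfl this
  set d : ℝ → ℝ≥0∞ := fun x => ENNReal.ofReal (t * (x / ε) ^ 2) with hd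
  have hdm : Measurable d := by fun_prop
  set m := (νS.withDensity d).map (fun x => x / ε) with hmdef
  have hdiv : Measurable (fun x : ℝ => x / ε) := by fun_prop
  have hdint : Integrable (fun x : ℝ => t * (x / ε) ^ 2) νS := by
    have := hIntg.const_mul (t / ε ^ 2)
    refine this.congr (ae_of_all _ fun x => ?_)
    simp only; field_simp
  have huniv : m univ = ENNReal.ofReal (t * s2 / ε ^ 2) := by
    rw [hmdef, Measure.map_apply hdiv MeasurableSet.univ, preimage_univ, withDensity_apply _ MeasurableSet.univ,
      Measure.restrict_univ, ← ofReal_integral_eq_lintegral_ofReal hdint (ae_of_all _ fun x => by positivity)]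
    congr 1
    rw [hs2, mul_div_right_comm, ← integral_const_mul]
    congr 1; ext x; field_simp
  haveI : IsFiniteMeasure m := ⟨by rw [huniv]; exact ENNReal.ofReal_lt_top⟩
  set σ := Real.sqrt (t * s2) / ε with hσ
  have hσ0 : 0 < σ := by positivity
  have hσ2 : σ ^ 2 = t * s2 / ε ^ 2 := by rw [hσ, div_pow, Real.sq_sqrt (by positivity)]
  have ha : m.real univ = σ ^ 2 := by
    rw [Measure.real, huniv, ENNReal.toReal_ofReal (by positivity), hσ2]
  have hm : ∀ᵐ y ∂m, y ≠ 0 ∧ |y| ≤ 1 := by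
    have hset : MeasurableSet {y : ℝ | y ≠ 0 ∧ |y| ≤ 1} :=
      ((measurableSet_singleton (0 : ℝ)).compl).inter (measurableSet_le (f := fun y : ℝ => |y|) (g := fun _ => (1 : ℝ)) (by fun_prop) (by fun_prop))
    rw [hmdef, ae_map_iff hdiv.aemeasurable hset]
    refine (withDensity_absolutelyContinuous νS d).ae_le ?_
    have h0 : ∀ᵐ x ∂νS, x ≠ 0 := by
      refine ae_restrict_of_ae ?_
      rw [ae_iff]; simpa using hν0
    filter_upwards [hSae, h0] with x hx hx0
    refine ⟨div_ne_zero hx0 hε0.ne', ?_⟩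
    rw [abs_div, abs_of_pos hε0, div_le_one hε0]; exact hx
  have hPsi : ∀ u, Psi m u = t * ∫ x, lkIntegrandC (u / ε) x ∂νS := by
    intro u
    have hmeas : Measurable (fun y : ℝ => lkIntegrandC u y / (y : ℂ) ^ 2) := by
      unfold lkIntegrandC; fun_prop
    unfold Psi
    rw [hmdef, integral_map hdiv.aemeasurable hmeas.aestronglyMeasurable,
      integral_withDensity_eq_integral_toReal_smul hdm (ae_of_all _ fun x => ENNReal.ofReal_lt_top), ← integral_const_mul]
    congr 1; ext x
    rw [hd]; simp only
    rw [ENNReal.toReal_ofReal (by positivity)]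
    have e : lkIntegrandC u (x / ε) = lkIntegrandC (u / ε) x := by
      unfold lkIntegrandC; rw [show u * (x / ε) = u / ε * x by ring]
    rw [e]
    by_cases hx : x = 0
    · subst hx; simp [lkIntegrandC]
    · have hxc : (x : ℂ) ≠ 0 := by exact_mod_cast hx
      have hec : (ε : ℂ) ≠ 0 := by exact_mod_cast hε0.ne'
      rw [Complex.real_smul]; push_cast; field_simp
  set P := ρt.map (fun x => x / ε) with hPdef
  haveI : IsProbabilityMeasure P := Measure.isProbabilityMeasure_map hdiv.aemeasurable
  have hP : ∀ u, charFn P u = Complex.exp (Psi m u) := by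
    intro u
    rw [hPsi, ← hρt]
    unfold charFn
    rw [hPdef, integral_map hdiv.aemeasurable (by fun_prop)]
    congr 1; ext x; rw [show u * (x / ε) = u / ε * x by ring]
  obtain ⟨i2, l2⟩ := moment2 m P hP
  have w1 := wass_one_indep P σ hσ0 i2 (l2.trans_eq ha)
  have hs2' : Real.sqrt 2 ≤ 2 := by rw [Real.sqrt_le_left (by norm_num)]; norm_num
  have w2 : wasserstein 1 P (gaussianReal 0 (Real.toNNReal (σ ^ 2))) ≤ ENNReal.ofReal (2 * σ) :=
    w1.trans (ENNReal.ofReal_le_ofReal (by gcongr))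
  have w3 : wasserstein 1 P (gaussianReal 0 (Real.toNNReal (σ ^ 2))) ≤ ENNReal.ofReal (1 / 2) := by
    rcases le_total (1 / 8) (σ ^ 2) with h | h
    · exact core m P hm hP σ hσ0 ha h
    · refine w1.trans (ENNReal.ofReal_le_ofReal ?_)
      refine le_of_sq_le_sq ?_ (by norm_num)
      rw [mul_pow, Real.sq_sqrt (by norm_num)]; linarith
  have hsc := wass_scale P (gaussianReal 0 (Real.toNNReal (σ ^ 2))) ε hε0
  have eP : P.map (fun x => ε * x) = ρt := by
    rw [hPdef, Measure.map_map (by fun_prop) hdiv]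
    have : ((fun x => ε * x) ∘ fun x => x / ε) = id := by
      ext x; simp only [Function.comp, id]; field_simp
    rw [this, Measure.map_id]
  have eG : (gaussianReal 0 (Real.toNNReal (σ ^ 2))).map (fun x => ε * x) = gaussianReal 0 (Real.toNNReal (t * s2)) := by
    rw [gaussianReal_map_const_mul, mul_zero]
    congr 1
    ext
    simp only [NNReal.coe_mul, NNReal.coe_mk]
    rw [Real.coe_toNNReal _ (sq_nonneg σ), Real.coe_toNNReal _ (by positivity), hσ2]; field_simp
  rw [eP, eG] at hsc
  refine hsc.trans ?_
  rw [ENNReal.ofReal_min]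
  refine le_min ?_ ?_
  · refine (mul_le_mul_right w2 _).trans_eq ?_
    rw [← ENNReal.ofReal_mul hε0.le, hσ]; congr 1; field_simp
  · refine (mul_le_mul_right w3 _).trans_eq ?_
    rw [← ENNReal.ofReal_mul hε0.le]; congr 1; ring
end

section
open MeasureTheory ProbabilityTheory Set Filter Topology
open scoped ENNReal NNReal

lemma gpdf_anti (v : ℝ≥0) (x y z : ℝ) (hz : |z - x| ≤ |z - y|) :
    gaussianPDF y v z ≤ gaussianPDF x v z := by
  unfold gaussianPDF gaussianPDFReal
  apply ENNReal.ofReal_le_ofReal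
  have : (z - x) ^ 2 ≤ (z - y) ^ 2 := sq_le_sq.2 hz
  gcongr

lemma gauss_tv_aux (v : ℝ≥0) (hv : v ≠ 0) (x y : ℝ) (hxy : x ≤ y) (A : Set ℝ) (hA : MeasurableSet A) :
    (gaussianReal x v).real A - (gaussianReal y v).real A ≤ (Real.sqrt (2 * Real.pi * v))⁻¹ * (y - x) := by
  set c := (x + y) / 2 with hc
  have hmono : ∀ B : Set ℝ, MeasurableSet B → B ⊆ Iic c → (gaussianReal y v).real B ≤ (gaussianReal x v).real B := by
    intro B hB hBc
    refine ENNReal.toReal_mono (measure_ne_top _ _) ?_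
    rw [gaussianReal_apply _ hv, gaussianReal_apply _ hv]
    refine setLIntegral_mono (measurable_gaussianPDF _ _) fun z hz => gpdf_anti v _ _ _ ?_
    have hzc : z ≤ c := hBc hz
    apply sq_le_sq.1
    nlinarith
  have hmono2 : ∀ B : Set ℝ, MeasurableSet B → B ⊆ Ioi c → (gaussianReal x v).real B ≤ (gaussianReal y v).real B := by
    intro B hB hBc
    refine ENNReal.toReal_mono (measure_ne_top _ _) ?_
    rw [gaussianReal_apply _ hv, gaussianReal_apply _ hv]
    refine setLIntegral_mono (measurable_gaussianPDF _ _) fun z hz => gpdf_anti v _ _ _ ?_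
    have hzc : c < z := hBc hz
    apply sq_le_sq.1
    nlinarith
  have s1 : ∀ w, (gaussianReal w v).real A = (gaussianReal w v).real (A ∩ Iic c) + (gaussianReal w v).real (A \ Iic c) :=
    fun w => (measureReal_inter_add_diff (μ := gaussianReal w v) (s := A) measurableSet_Iic).symm
  have s2 : ∀ w, (gaussianReal w v).real (Iic c) = (gaussianReal w v).real (Iic c ∩ A) + (gaussianReal w v).real (Iic c \ A) :=
    fun w => (measureReal_inter_add_diff (μ := gaussianReal w v) (s := Iic c) hA).symm
  have h1 := hmono (Iic c \ A) (measurableSet_Iic.diff hA) diff_subset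
  have h2 := hmono2 (A \ Iic c) (hA.diff measurableSet_Iic) (fun z hz => mem_Ioi.2 (not_le.1 hz.2))
  have h3 : (gaussianReal x v).real (Iic c) ≤ (gaussianReal y v).real (Iic c) + (Real.sqrt (2 * Real.pi * v))⁻¹ * (y - x) := by
    -- shift the first law by `y - x`
    have e : (gaussianReal x v).real (Iic c) = (gaussianReal y v).real (Iic (c + (y - x))) := by
      have := gaussianReal_map_const_add (μ := x) (v := v) (y - x)
      rw [show x + (y - x) = y by ring] at this
      rw [← this, map_measureReal_apply (by fun_prop) measurableSet_Iic]
      congr 1; ext z; simp only [mem_Iic, mem_preimage]; constructor <;> intro h <;> linarith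
    rw [e, ← Iic_union_Ioc_eq_Iic (show c ≤ c + (y - x) by linarith)]
    refine (measureReal_union_le _ _).trans ?_
    gcongr
    have hb : (gaussianReal y v) (Ioc c (c + (y - x))) ≤ ENNReal.ofReal ((Real.sqrt (2 * Real.pi * v))⁻¹ * (y - x)) := by
      rw [gaussianReal_apply _ hv]
      calc ∫⁻ z in Ioc c (c + (y - x)), gaussianPDF y v z
          ≤ ∫⁻ z in Ioc c (c + (y - x)), ENNReal.ofReal ((Real.sqrt (2 * Real.pi * v))⁻¹) := by
            refine lintegral_mono fun z => ?_
            unfold gaussianPDF gaussianPDFReal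
            apply ENNReal.ofReal_le_ofReal
            refine mul_le_of_le_one_right (by positivity) (Real.exp_le_one_iff.2 ?_)
            exact div_nonpos_of_nonpos_of_nonneg (neg_nonpos.2 (sq_nonneg _)) (by positivity)
        _ = _ := by
            rw [setLIntegral_const, Real.volume_Ioc, ← ENNReal.ofReal_mul (by positivity)]
            congr 2; ring
    exact ENNReal.toReal_le_of_le_ofReal (mul_nonneg (by positivity) (by linarith)) hb
  have e1 := s1 x
  have e2 := s1 y
  have e3 := s2 x
  have e4 := s2 y
  rw [inter_comm] at e3 e4
  linarith

lemma gauss_tv (v : ℝ≥0) (hv : v ≠ 0) (x y : ℝ) (A : Set ℝ) (hA : MeasurableSet A) :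
    |(gaussianReal x v).real A - (gaussianReal y v).real A| ≤ (Real.sqrt (2 * Real.pi * v))⁻¹ * |x - y| := by
  wlog h : x ≤ y generalizing x y
  · rw [abs_sub_comm, abs_sub_comm x]; exact this y x (le_of_not_ge h)
  rw [abs_sub_comm x, abs_of_nonneg (sub_nonneg.2 h), abs_le]
  have h1 := gauss_tv_aux v hv x y h A hA
  have h2 := gauss_tv_aux v hv x y h Aᶜ hA.compl
  rw [probReal_compl_eq_one_sub hA, probReal_compl_eq_one_sub hA] at h2
  constructor <;> linarith

lemma conv_gauss_real (P : Measure ℝ) [IsProbabilityMeasure P] (v : ℝ≥0) (A : Set ℝ) (hA : MeasurableSet A) :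
    (P.conv (gaussianReal 0 v)) A = ∫⁻ x, gaussianReal x v A ∂P := by
  unfold Measure.conv
  rw [Measure.map_apply (by fun_prop) hA, Measure.prod_apply (measurableSet_preimage (by fun_prop) hA)]
  congr 1; ext x
  have := gaussianReal_map_const_add (μ := 0) (v := v) x
  rw [zero_add] at this
  rw [← this, Measure.map_apply (by fun_prop) hA]; rfl

lemma gauss_meas (v : ℝ≥0) (hv : v ≠ 0) (A : Set ℝ) (hA : MeasurableSet A) :
    Continuous (fun x => (gaussianReal x v).real A) := by
  have : LipschitzWith (Real.toNNReal (Real.sqrt (2 * Real.pi * v))⁻¹) (fun x => (gaussianReal x v).real A) :=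
    LipschitzWith.of_dist_le_mul fun x y => by
      rw [Real.dist_eq, Real.dist_eq, Real.coe_toNNReal _ (by positivity)]
      exact gauss_tv v hv x y A hA
  exact this.continuous

lemma conv_gauss_real' (P : Measure ℝ) [IsProbabilityMeasure P] (v : ℝ≥0) (A : Set ℝ) (hA : MeasurableSet A) (hv : v ≠ 0) :
    ((P.conv (gaussianReal 0 v)) A).toReal = ∫ x, (gaussianReal x v).real A ∂P := by
  rw [conv_gauss_real P v A hA, integral_eq_lintegral_of_nonneg_ae (ae_of_all _ fun x => measureReal_nonneg)
    (gauss_meas v hv A hA).aestronglyMeasurable]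
  congr 1; congr 1; ext x; rw [ofReal_measureReal]

lemma tv_le_wass (P Q : Measure ℝ) [IsProbabilityMeasure P] [IsProbabilityMeasure Q] (v : ℝ≥0) (hv : v ≠ 0) :
    ENNReal.ofReal (tvDist (P.conv (gaussianReal 0 v)) (Q.conv (gaussianReal 0 v)))
      ≤ ENNReal.ofReal ((Real.sqrt (2 * Real.pi * v))⁻¹) * wasserstein 1 P Q := by
  have hv' : (0 : ℝ) < v := by positivity
  set K := (Real.sqrt (2 * Real.pi * v))⁻¹ with hK
  have hK0 : 0 < K := by positivity
  have hne : ENNReal.ofReal K ≠ 0 := by simpa using hK0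
  rw [mul_comm, ← ENNReal.div_le_iff hne ENNReal.ofReal_ne_top]
  unfold wasserstein wassersteinCost
  refine le_iInf₂ fun π hπ => ?_
  obtain ⟨hp, h1, h2⟩ := hπ
  rw [ENNReal.div_le_iff hne ENNReal.ofReal_ne_top]
  simp only [ENNReal.rpow_one, div_one]
  set I := ∫⁻ z : ℝ × ℝ, ENNReal.ofReal |z.1 - z.2| ∂π with hI
  by_cases hIt : I = ⊤
  · rw [hIt, ENNReal.top_mul hne]; exact le_top
  refine ENNReal.ofReal_le_of_le_toReal ?_
  unfold tvDist
  haveI : Nonempty {A : Set ℝ // MeasurableSet A} := ⟨⟨∅, MeasurableSet.empty⟩⟩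
  refine ciSup_le fun A => ?_
  obtain ⟨A, hA⟩ := A
  simp only
  have hF := gauss_meas v hv A hA
  set F := fun x => (gaussianReal x v).real A with hFd
  rw [conv_gauss_real' P v A hA hv, conv_gauss_real' Q v A hA hv]
  have e1 : ∫ x, F x ∂P = ∫ z, F z.1 ∂π := by
    rw [← h1, integral_map (by fun_prop) hF.aestronglyMeasurable]
  have e2 : ∫ x, F x ∂Q = ∫ z, F z.2 ∂π := by
    rw [← h2, integral_map (by fun_prop) hF.aestronglyMeasurable]
  have hb : ∀ x, ‖F x‖ ≤ 1 := fun x => by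
    rw [Real.norm_of_nonneg measureReal_nonneg]; exact measureReal_le_one
  have i1 : Integrable (fun z : ℝ × ℝ => F z.1) π :=
    Integrable.of_bound (by fun_prop) 1 (ae_of_all _ fun z => hb _)
  have i2 : Integrable (fun z : ℝ × ℝ => F z.2) π :=
    Integrable.of_bound (by fun_prop) 1 (ae_of_all _ fun z => hb _)
  rw [e1, e2, ← integral_sub i1 i2]
  have iz : Integrable (fun z : ℝ × ℝ => |z.1 - z.2|) π := by
    refine ⟨by fun_prop, ?_⟩
    rw [hasFiniteIntegral_iff_ofReal (ae_of_all _ fun x => abs_nonneg _)]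
    exact lt_top_iff_ne_top.2 hIt
  calc |∫ z : ℝ × ℝ, F z.1 - F z.2 ∂π| ≤ ∫ z : ℝ × ℝ, |F z.1 - F z.2| ∂π := abs_integral_le_integral_abs
    _ ≤ ∫ z : ℝ × ℝ, K * |z.1 - z.2| ∂π :=
        integral_mono (i1.sub i2).abs (iz.const_mul K) fun z => gauss_tv v hv z.1 z.2 A hA
    _ = (I * ENNReal.ofReal K).toReal := by
        rw [integral_const_mul, ENNReal.toReal_mul, ENNReal.toReal_ofReal hK0.le, mul_comm, hI,
          integral_eq_lintegral_of_nonneg_ae (ae_of_all _ fun x => abs_nonneg _) (by fun_prop)]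

lemma final_one (ν : Measure ℝ) (ε Sg t : ℝ) (hSg : 0 < Sg) (ht : 0 < t)
    (s2 : ℝ) (hs2pos : 0 < s2)
    (μt ρt : Measure ℝ) (hμtP : IsProbabilityMeasure μt) (hρtP : IsProbabilityMeasure ρt)
    (hμt : ∀ u : ℝ, charFn μt u = Complex.exp ((t : ℂ) *
      (((-(u ^ 2 * Sg ^ 2) / 2 : ℝ) : ℂ) + ∫ x in {x : ℝ | |x| ≤ ε}, lkIntegrandC u x ∂ν)))
    (hρt : ∀ u : ℝ, charFn ρt u = Complex.exp ((t : ℂ) *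
      ∫ x in {x : ℝ | |x| ≤ ε}, lkIntegrandC u x ∂ν)) :
    ENNReal.ofReal (tvDist μt (gaussianReal 0 (Real.toNNReal (t * (Sg ^ 2 + s2)))))
      ≤ ENNReal.ofReal (Real.sqrt (2 / (Real.pi * t * Sg ^ 2)))
        * wasserstein 1 ρt (gaussianReal 0 (Real.toNNReal (t * s2))) := by
  set v := Real.toNNReal (t * Sg ^ 2) with hv
  have hvr : (v : ℝ) = t * Sg ^ 2 := Real.coe_toNNReal _ (by positivity)
  have hv0 : v ≠ 0 := by
    intro h; rw [h] at hvr; have : 0 < t * Sg ^ 2 := by positivity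
    simp at hvr; rcases hvr with h | h <;> linarith
  have hcf : ∀ (M : Measure ℝ) u, charFun M u = charFn M u := by
    intro M u; rw [charFun_apply_real]; unfold charFn; congr 1; ext x; push_cast; rfl
  have eμ : μt = ρt.conv (gaussianReal 0 v) := by
    refine Measure.ext_of_charFun ?_
    ext u
    rw [charFun_conv, hcf, hcf, hμt, hρt, charFun_gaussianReal, ← Complex.exp_add, hvr]
    congr 1; push_cast; ring
  have eG : gaussianReal 0 (Real.toNNReal (t * (Sg ^ 2 + s2))) = (gaussianReal 0 (Real.toNNReal (t * s2))).conv (gaussianReal 0 v) := by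
    rw [gaussianReal_conv_gaussianReal, add_zero, hv, ← Real.toNNReal_add (by positivity) (by positivity)]
    congr 2; ring
  rw [eμ, eG]
  refine (tv_le_wass ρt _ v hv0).trans ?_
  gcongr
  rw [hvr, ← Real.sqrt_inv]
  apply Real.sqrt_le_sqrt
  rw [inv_eq_one_div, div_le_div_iff₀ (by positivity) (by positivity)]
  have : 0 < Real.pi * t * Sg ^ 2 := by positivity
  nlinarith
end

/-- Total variation bound between the marginal of a Lévy process with
Gaussian part `Σ² > 0` and compensated jumps of size at most `ε`, and the corresponding
Gaussian, via the `W_1` distance of the small-jump part from its Gaussian approximation. -/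
theorem statement17 (ν : Measure ℝ) (hν0 : ν {0} = 0)
    (hνlevy : ∫⁻ x, ENNReal.ofReal (min (x ^ 2) 1) ∂ν ≠ ⊤)
    (ε Sg t : ℝ) (hε0 : 0 < ε) (hε1 : ε ≤ 1) (hSg : 0 < Sg) (ht : 0 < t)
    (s2 : ℝ) (hs2 : s2 = ∫ x in {x : ℝ | |x| ≤ ε}, x ^ 2 ∂ν) (hs2pos : 0 < s2)
    (μt ρt : Measure ℝ) (hμtP : IsProbabilityMeasure μt) (hρtP : IsProbabilityMeasure ρt)
    (hμt : ∀ u : ℝ, charFn μt u = Complex.exp ((t : ℂ) *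
      (((-(u ^ 2 * Sg ^ 2) / 2 : ℝ) : ℂ) + ∫ x in {x : ℝ | |x| ≤ ε}, lkIntegrandC u x ∂ν)))
    (hρt : ∀ u : ℝ, charFn ρt u = Complex.exp ((t : ℂ) *
      ∫ x in {x : ℝ | |x| ≤ ε}, lkIntegrandC u x ∂ν)) :
    ENNReal.ofReal (tvDist μt (gaussianReal 0 (Real.toNNReal (t * (Sg ^ 2 + s2)))))
      ≤ ENNReal.ofReal (Real.sqrt (2 / (Real.pi * t * Sg ^ 2)))
        * wasserstein 1 ρt (gaussianReal 0 (Real.toNNReal (t * s2)))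
    ∧ wasserstein 1 ρt (gaussianReal 0 (Real.toNNReal (t * s2)))
        ≤ ENNReal.ofReal (min (2 * Real.sqrt (t * s2)) (ε / 2)) := by
  exact ⟨final_one ν ε Sg t hSg ht s2 hs2pos μt ρt hμtP hρtP hμt hρt,
    final_two ν hν0 hνlevy ε t hε0 hε1 ht s2 hs2 hs2pos ρt hρtP hρt⟩
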